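/- Let G be a plane graph (a graph with a fixed non-crossing topological embedding in the plane). Then G is generically rigid in the plane if and only if G can be stretched to become a pseudo-triangulation of its vertex set with the given topological embedding, i.e., there is a straight-line non-crossing realization of G, with the given embedding, whose bounded faces are all pseudo-triangles and which contains the convex hull edges of its vertex set. -/

import Mathlib

/-! ## Combinatorial plane graphs via rotation systems -/

/-- The permutation of darts of a simple graph reversing each dart. -/
def dartSymmPerm {V : Type} (G : SimpleGraph V) : Equiv.Perm G.Dart where
  toFun := SimpleGraph.Dart.symm
  invFun := SimpleGraph.Dart.symm
  left_inv d := SimpleGraph.Dart.symm_symm d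
  right_inv d := SimpleGraph.Dart.symm_symm d

/-- The setoid on `α` whose classes are the cycles (orbits) of a permutation `σ`. -/
def faceSetoid {α : Type} (σ : Equiv.Perm α) : Setoid α :=
  ⟨σ.SameCycle, ⟨fun x => Equiv.Perm.SameCycle.refl σ x,
    fun h => h.symm, fun h h' => h.trans h'⟩⟩

/-- A (topological, non-crossing) embedding of a connected graph `G` in the plane, encoded
combinatorially: a rotation system (the counterclockwise cyclic order of the darts around
each vertex), which is planar in the sense of Euler's formula (the number of orbits of the
face permutation `rot * symm` is the number of faces), together with a distinguished
outer (unbounded) face.  A *plane graph* is a graph `G` together with such a structure. -/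
structure PlaneEmb {V : Type} (G : SimpleGraph V) where
  rot : Equiv.Perm G.Dart
  rot_fst : ∀ d : G.Dart, (rot d).fst = d.fst
  rot_vertex : ∀ d d' : G.Dart, d.fst = d'.fst → ∃ n : ℕ, (rot ^ n) d = d'
  connected : G.Connected
  outer : Quotient (faceSetoid (rot * dartSymmPerm G))
  euler : Nat.card V + Nat.card (Quotient (faceSetoid (rot * dartSymmPerm G)))
      = Nat.card G.edgeSet + 2

namespace PlaneEmb

variable {V : Type} {G : SimpleGraph V}

/-- The faces of a plane graph: orbits of the face permutation. -/
abbrev Face (E : PlaneEmb G) : Type := Quotient (faceSetoid (E.rot * dartSymmPerm G))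

/-- The face having the dart `d` on its contour. -/
def dartFace (E : PlaneEmb G) (d : G.Dart) : E.Face :=
  Quotient.mk (faceSetoid (E.rot * dartSymmPerm G)) d

/-- Each dart `d` determines an *angle* of the plane graph, namely the angle at the vertex
`d.fst` between the edges of `d` and `rot d`; `E.angleFace d` is the face this angle lies in. -/
def angleFace (E : PlaneEmb G) (d : G.Dart) : E.Face :=
  Quotient.mk (faceSetoid (E.rot * dartSymmPerm G)) d.symm

end PlaneEmb

/-- A vertex is *pointed* (w.r.t. an assignment `big` of which angles are labelled big)
if some angle at it is labelled big. -/
def PointedVx {V : Type} {G : SimpleGraph V} (big : G.Dart → Prop) (v : V) : Prop :=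
  ∃ d : G.Dart, big d ∧ d.fst = v

/-- A *combinatorial pseudo-triangulation labelling* (CPT-labelling): every bounded face has
exactly three small angles, all angles of the unbounded face are big, and no vertex is
incident to more than one big angle. -/
structure IsCPTLabelling {V : Type} {G : SimpleGraph V} (E : PlaneEmb G)
    (big : G.Dart → Prop) : Prop where
  bounded_small : ∀ F : E.Face, F ≠ E.outer →
    Nat.card {d : G.Dart | E.angleFace d = F ∧ ¬ big d} = 3
  outer_big : ∀ d : G.Dart, E.angleFace d = E.outer → big d
  one_big : ∀ d d' : G.Dart, big d → big d' → d.fst = d'.fst → d = d'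

/-- The generalized Laman property of a combinatorial pseudo-triangulation: any `x` non-pointed
plus `y` pointed vertices, with `x + y ≥ 2`, induce at most `3x + 2y - 3` edges. -/
def GenLaman {V : Type} (G : SimpleGraph V) (big : G.Dart → Prop) : Prop :=
  ∀ S : Set V, 2 ≤ Nat.card S →
    (Nat.card ((G.induce S).edgeSet) : ℤ) ≤
      3 * Nat.card {v ∈ S | ¬ PointedVx big v} + 2 * Nat.card {v ∈ S | PointedVx big v} - 3

/-! ## Rigidity -/

/-- Dot product in the plane. -/
def dot2 (u w : ℝ × ℝ) : ℝ := u.1 * w.1 + u.2 * w.2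

/-- Rotation by 90 degrees. -/
def rot90 (u : ℝ × ℝ) : ℝ × ℝ := (-u.2, u.1)

/-- `q` is an infinitesimal motion of the bar-and-joint framework `(G, p)`. -/
def IsInfMotion {V : Type} (G : SimpleGraph V) (p q : V → ℝ × ℝ) : Prop :=
  ∀ u v : V, G.Adj u v → dot2 (p u - p v) (q u - q v) = 0

/-- Trivial infinitesimal motions: those coming from rigid motions of the plane
(infinitesimal rotations and translations). -/
def IsTrivialMotion {V : Type} (p q : V → ℝ × ℝ) : Prop :=
  ∃ (a : ℝ) (t : ℝ × ℝ), ∀ v : V, q v = a • rot90 (p v) + t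

/-- The framework `(G, p)` is infinitesimally rigid: it has no non-trivial infinitesimal
motions. -/
def InfRigid {V : Type} (G : SimpleGraph V) (p : V → ℝ × ℝ) : Prop :=
  ∀ q : V → ℝ × ℝ, IsInfMotion G p q → IsTrivialMotion p q

/-- A configuration of points is *generic* if its coordinates are algebraically
independent over `ℚ`. -/
def GenericConf {V : Type} (p : V → ℝ × ℝ) : Prop :=
  AlgebraicIndependent ℚ (fun x : V ⊕ V => Sum.elim (fun v => (p v).1) (fun v => (p v).2) x)

/-- A graph is *generically rigid in the plane* if every generic framework on it has no
non-trivial infinitesimal motions. -/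
def GenRigid {V : Type} (G : SimpleGraph V) : Prop :=
  ∀ p : V → ℝ × ℝ, GenericConf p → InfRigid G p

/-- A graph is *isostatic* (generically minimally rigid) if it is generically rigid and
removing any edge destroys generic rigidity. -/
def Isostatic {V : Type} (G : SimpleGraph V) : Prop :=
  GenRigid G ∧ ∀ e ∈ G.edgeSet, ¬ GenRigid (G.deleteEdges {e})

/-- Laman's condition: exactly `2n - 3` edges, and every `k ≥ 2` vertices span at most
`2k - 3` edges. -/
def LamanGraph {V : Type} (L : SimpleGraph V) : Prop :=
  (Nat.card L.edgeSet : ℤ) = 2 * Nat.card V - 3 ∧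
  ∀ S : Set V, 2 ≤ Nat.card S →
    (Nat.card ((L.induce S).edgeSet) : ℤ) ≤ 2 * Nat.card S - 3

/-! ## Geometry: straight-line drawings, angles, stretching -/

/-- The counterclockwise angle from the direction `u` to the direction `w`,
normalized to lie in `(0, 2π]` (a full turn for `w` pointing in the direction of `u`). -/
noncomputable def ccwAngle (u w : ℝ × ℝ) : ℝ :=
  if 0 < Complex.arg ((⟨w.1, w.2⟩ : ℂ) / (⟨u.1, u.2⟩ : ℂ)) then
    Complex.arg ((⟨w.1, w.2⟩ : ℂ) / (⟨u.1, u.2⟩ : ℂ))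
  else Complex.arg ((⟨w.1, w.2⟩ : ℂ) / (⟨u.1, u.2⟩ : ℂ)) + 2 * Real.pi

/-- The (counterclockwise) geometric angle, in the straight-line drawing `p`, of the angle of
the dart `d`, i.e. the angle at `d.fst` between the edge of `d` and the edge of `rot d`. -/
noncomputable def dartAngle {V : Type} {G : SimpleGraph V} (E : PlaneEmb G)
    (p : V → ℝ × ℝ) (d : G.Dart) : ℝ :=
  ccwAngle (p d.snd - p d.fst) (p (E.rot d).snd - p (E.rot d).fst)

/-- A straight-line drawing is non-crossing: distinct edges meet only in common endpoints,
and no vertex lies on an edge not incident to it. -/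
def NonCrossing {V : Type} (G : SimpleGraph V) (p : V → ℝ × ℝ) : Prop :=
  (∀ a b c d : V, G.Adj a b → G.Adj c d → ({a, b} : Set V) ≠ {c, d} →
    segment ℝ (p a) (p b) ∩ segment ℝ (p c) (p d) ⊆ p '' ({a, b} ∩ {c, d} : Set V)) ∧
  (∀ x a b : V, G.Adj a b → x ≠ a → x ≠ b → p x ∉ segment ℝ (p a) (p b))

/-- The points of the drawing are in general position: no three of them are collinear. -/
def GenPos {V : Type} (p : V → ℝ × ℝ) : Prop :=
  ∀ u v w : V, u ≠ v → u ≠ w → v ≠ w → ¬ Collinear ℝ ({p u, p v, p w} : Set (ℝ × ℝ))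

/-- The straight-line drawing `p` realizes the plane graph `(G, E)`: it is injective and
non-crossing, and around every (non-isolated) vertex the counterclockwise angles between
rotation-consecutive darts sum to `2π`, so the drawing induces the given rotation system. -/
def RealizesEmb {V : Type} [Fintype V] [DecidableEq V] (G : SimpleGraph V)
    [DecidableRel G.Adj] (E : PlaneEmb G) (p : V → ℝ × ℝ) : Prop :=
  Function.Injective p ∧ NonCrossing G p ∧
  ∀ v : V, (∃ d : G.Dart, d.fst = v) →
    ∑ d ∈ Finset.univ.filter (fun d : G.Dart => d.fst = v), dartAngle E p d = 2 * Real.pi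

/-- The drawing `p` *stretches* the angle labelling `big` of the plane graph `(G, E)`:
it realizes the embedding, has its (finitely many) vertices in general position, and every
angle labelled big is reflex (> 180°) while every angle labelled small is convex (< 180°).
If `big` is a CPT-labelling this makes `p` a pseudo-triangulation of its vertex set:
every bounded face is a pseudo-triangle and the convex hull edges are present. -/
def Stretches {V : Type} [Fintype V] [DecidableEq V] (G : SimpleGraph V)
    [DecidableRel G.Adj] (E : PlaneEmb G) (big : G.Dart → Prop) (p : V → ℝ × ℝ) : Prop :=
  RealizesEmb G E p ∧ GenPos p ∧
  ∀ d : G.Dart, (big d → Real.pi < dartAngle E p d) ∧ (¬ big d → dartAngle E p d < Real.pi)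

/-- The drawing `p` makes the plane graph `(G, E)` a pseudo-triangulation of its vertex set
(with the given embedding): for the labelling of the angles of the drawing as big (reflex)
or small (convex), every bounded face has exactly three small angles (is a pseudo-triangle)
and all outer angles are big (so the convex hull edges are present). -/
def StretchesToPT {V : Type} [Fintype V] [DecidableEq V] (G : SimpleGraph V)
    [DecidableRel G.Adj] (E : PlaneEmb G) (p : V → ℝ × ℝ) : Prop :=
  ∃ big : G.Dart → Prop, IsCPTLabelling E big ∧ Stretches G E big p

/-- A vertex `v` of a geometric straight-line drawing is *pointed* if all the edges at `v`
lie in a closed half-plane supported at `v`. -/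
def GeoPointed {V : Type} (G : SimpleGraph V) (p : V → ℝ × ℝ) (v : V) : Prop :=
  ∃ u : ℝ × ℝ, u ≠ 0 ∧ ∀ w : V, G.Adj v w → 0 ≤ dot2 u (p w - p v)

/-! ## Subgraphs, outer face, corners -/

/-- One step of dual connectivity avoiding the edge set `A`: the faces `F`, `F'` are the two
sides of some edge of `G` not belonging to `A`. -/
def FaceStep {V : Type} {G : SimpleGraph V} (E : PlaneEmb G) (A : Set (Sym2 V)) :
    E.Face → E.Face → Prop :=
  fun F F' => ∃ d : G.Dart, E.dartFace d = F ∧ E.dartFace d.symm = F' ∧ d.edge ∉ A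

/-- The face `F` of `G` is contained in the outer (unbounded) face of the plane subgraph of
`G` with edge set `A`: `F` can reach the outer face of `G` in the dual graph without
crossing the edges of `A`. -/
def InOuterOf {V : Type} {G : SimpleGraph V} (E : PlaneEmb G) (A : Set (Sym2 V))
    (F : E.Face) : Prop :=
  Relation.ReflTransGen (FaceStep E A) F E.outer

/-- `v` is a *corner* of the subgraph `H` of the combinatorial pseudo-triangulation
`(G, E, big)`: either `v` is pointed in `G` and its big angle is contained in the
outer face of `H`, or `v` is non-pointed in `G` and two consecutive (small) angles at `v`
are contained in the outer face of `H`. -/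
def IsCPTCorner {V : Type} {G : SimpleGraph V} (E : PlaneEmb G) (big : G.Dart → Prop)
    (H : G.Subgraph) (v : V) : Prop :=
  (v ∈ H.verts ∧ ∃ d : G.Dart, big d ∧ d.fst = v ∧ InOuterOf E H.edgeSet (E.angleFace d)) ∨
  (v ∈ H.verts ∧ ¬ PointedVx big v ∧ ∃ d : G.Dart, d.fst = v ∧
    InOuterOf E H.edgeSet (E.angleFace d) ∧ InOuterOf E H.edgeSet (E.angleFace (E.rot d)) ∧
    (E.rot d).edge ∉ H.edgeSet)

/-- A plane graph has *non-degenerate faces* if no edge appears twice on the contour cycle of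
a face, i.e. the edges incident to every face form a simple closed cycle. -/
def NonDegenerateFaces {V : Type} {G : SimpleGraph V} (E : PlaneEmb G) : Prop :=
  ∀ d : G.Dart, ¬ (E.rot * dartSymmPerm G).SameCycle d d.symm


namespace PTri
open Finset

/-! ### Laman edge sets -/
section laman
variable {V : Type} [Fintype V] [DecidableEq V]

structure Laman (L : Finset (Sym2 V)) : Prop where
  nd : ∀ e ∈ L, ¬ e.IsDiag
  tot : L.card + 3 = 2 * Fintype.card V
  cnt : ∀ S : Finset V, 2 ≤ S.card → (L ∩ S.sym2).card + 3 ≤ 2 * S.card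

def Tight (L : Finset (Sym2 V)) (S : Finset V) : Prop := (L ∩ S.sym2).card + 3 = 2 * S.card

variable {L : Finset (Sym2 V)}

lemma Laman.univ (hL : Laman L) : Tight L Finset.univ := by
  simp [Tight, hL.tot]

lemma Laman.inter_union (hL : Laman L) {S T : Finset V} (hS : Tight L S) (hT : Tight L T)
    (h : 2 ≤ (S ∩ T).card) : Tight L (S ∩ T) ∧ Tight L (S ∪ T) ∧
      ∀ e ∈ L, e ∈ (S ∪ T).sym2 → e ∈ S.sym2 ∨ e ∈ T.sym2 := by
  have h1 := hL.cnt _ h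
  have h2 := hL.cnt (S ∪ T) (h.trans (card_le_card (inter_subset_left.trans subset_union_left)))
  have h3 := card_union_add_card_inter S T
  have h4 := card_union_add_card_inter (L ∩ S.sym2) (L ∩ T.sym2)
  have h5 : (L ∩ S.sym2) ∩ (L ∩ T.sym2) = L ∩ (S ∩ T).sym2 := by
    ext e; simp only [mem_inter, mem_sym2_iff]; grind
  have h6 : (L ∩ S.sym2) ∪ (L ∩ T.sym2) ⊆ L ∩ (S ∪ T).sym2 := by
    intro e; simp only [mem_inter, mem_union, mem_sym2_iff]; grind
  have h7 := card_le_card h6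
  unfold Tight at *
  rw [h5] at h4
  refine ⟨by omega, by omega, fun e he he' => ?_⟩
  have h8 := eq_of_subset_of_card_le h6 (by omega)
  have : e ∈ (L ∩ S.sym2) ∪ (L ∩ T.sym2) := h8 ▸ mem_inter.2 ⟨he, he'⟩
  simp only [mem_inter, mem_union] at this
  tauto

lemma Laman.two_le (_hL : Laman L) {S : Finset V} (hS : Tight L S) : 2 ≤ S.card := by
  unfold Tight at hS; omega

/-- every proper cut contains at least two edges -/
lemma Laman.cut (hL : Laman L) (S : Finset V) (h0 : S.Nonempty) (h1 : S ≠ Finset.univ) :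
    ∃ e ∈ L, e ∉ S.sym2 ∧ e ∉ Sᶜ.sym2 ∧ (3 ≤ Fintype.card V → ∃ e' ∈ L, e' ≠ e ∧ e' ∉ S.sym2 ∧ e' ∉ Sᶜ.sym2) := by
  set K := L.filter (fun e => e ∉ S.sym2 ∧ e ∉ Sᶜ.sym2) with hK
  have hsub : L ⊆ (L ∩ S.sym2) ∪ (L ∩ Sᶜ.sym2) ∪ K := by
    intro e he; simp only [mem_union, mem_inter, hK, mem_filter]; tauto
  have hc := (card_le_card hsub).trans ((card_union_le _ _).trans (Nat.add_le_add_right (card_union_le _ _) _))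
  have e1 : ∀ T : Finset V, T.card = 1 → (L ∩ T.sym2).card = 0 := by
    intro T hT
    obtain ⟨a, rfl⟩ := card_eq_one.1 hT
    rw [card_eq_zero, eq_empty_iff_forall_notMem]
    intro e he
    simp only [mem_inter, mem_sym2_iff, mem_singleton] at he
    apply hL.nd e he.1
    induction e with | h x y =>
    have := he.2 x (by simp); have := he.2 y (by simp); simp_all
  have a1 := hL.cnt S; have a2 := hL.cnt Sᶜ; have a3 := hL.tot
  have a4 := card_compl_add_card S
  have a5 := h0.card_pos
  have a6 : 0 < Sᶜ.card := by
    rw [card_pos]; by_contra h; rw [not_nonempty_iff_eq_empty, compl_eq_empty_iff] at h; exact h1 h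
  have b1 := e1 S; have b2 := e1 Sᶜ
  have hk : 1 ≤ K.card ∧ (3 ≤ Fintype.card V → 2 ≤ K.card) := by
    rcases Nat.lt_or_ge S.card 2 with h | h <;> rcases Nat.lt_or_ge Sᶜ.card 2 with h' | h'
    · have := b1 (by omega); have := b2 (by omega); omega
    · have := b1 (by omega); have := a2 h'; omega
    · have := b2 (by omega); have := a1 h; omega
    · have := a1 h; have := a2 h'; omega
  obtain ⟨e, he⟩ := card_pos.1 hk.1
  have he' := mem_filter.1 he
  refine ⟨e, he'.1, he'.2.1, he'.2.2, fun h3 => ?_⟩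
  obtain ⟨e', h', hne⟩ := exists_mem_ne (hk.2 h3) e
  have := mem_filter.1 h'
  exact ⟨e', this.1, hne, this.2.1, this.2.2⟩

/-- exchange -/
lemma Laman.exchange (hL : Laman L) {a b : V} (hab : a ≠ b) (h : s(a, b) ∉ L) (C : Finset (Sym2 V))
    (hC : C.card ≤ 3) (hCe : s(a, b) ∈ C) : ∃ f ∈ L, f ∉ C ∧ Laman (insert s(a, b) (L.erase f)) := by
  classical
  obtain ⟨T, hT, hmin⟩ := exists_min_image (Finset.univ.filter (fun T : Finset V => Tight L T ∧ a ∈ T ∧ b ∈ T))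
    Finset.card ⟨Finset.univ, by simp [hL.univ]⟩
  simp only [mem_filter, mem_univ, true_and] at hT hmin
  have hsub : ∀ S, Tight L S → a ∈ S → b ∈ S → T ⊆ S := by
    intro S hS ha hb
    have h2 : 2 ≤ (S ∩ T).card := by
      rw [← card_pair hab]
      apply card_le_card; intro x; simp only [mem_insert, mem_singleton, mem_inter]
      rintro (rfl | rfl) <;> tauto
    have h3 := hmin (S ∩ T) ⟨(hL.inter_union hS hT.1 h2).1, by simp [ha, hT.2.1], by simp [hb, hT.2.2]⟩
    have := eq_of_subset_of_card_le (inter_subset_right (s₁ := S) (s₂ := T)) h3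
    rw [← this]; exact inter_subset_left
  have hT2 := hL.two_le hT.1
  have hT3 : 3 ≤ T.card := by
    by_contra hlt
    have h2 : T.card = 2 := by omega
    have hTe : T = {a, b} := by
      symm; apply eq_of_subset_of_card_le
      · intro x; simp only [mem_insert, mem_singleton]; rintro (rfl | rfl) <;> tauto
      · rw [card_pair hab, h2]
    have h1 : (L ∩ T.sym2).card = 1 := by have := hT.1; unfold Tight at this; omega
    obtain ⟨e, he⟩ := card_eq_one.1 h1
    have he' : e ∈ L ∩ T.sym2 := by rw [he]; simp
    simp only [mem_inter, mem_sym2_iff, hTe, mem_insert, mem_singleton] at he'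
    have hnd := hL.nd e he'.1
    induction e with | h x y =>
    have hx := he'.2 x (by simp); have hy := he'.2 y (by simp)
    simp only [Sym2.mk_isDiag_iff] at hnd
    rcases hx with rfl | rfl <;> rcases hy with rfl | rfl
    · exact hnd rfl
    · exact h he'.1
    · rw [Sym2.eq_swap] at he'; exact h he'.1
    · exact hnd rfl
  have hcard : 3 ≤ (L ∩ T.sym2).card := by have := hT.1; unfold Tight at this; omega
  obtain ⟨f, hf, hfC⟩ : ∃ f ∈ L ∩ T.sym2, f ∉ C := by
    by_contra hcon
    push Not at hcon
    have : L ∩ T.sym2 ⊆ C.erase s(a, b) := by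
      intro f hf; refine mem_erase.2 ⟨?_, hcon f hf⟩
      rintro rfl; exact h (mem_inter.1 hf).1
    have := card_le_card this
    rw [card_erase_of_mem hCe] at this; omega
  rw [mem_inter] at hf
  have hne : s(a, b) ∉ L.erase f := fun hh => h (mem_of_mem_erase hh)
  refine ⟨f, hf.1, hfC, ⟨?_, ?_, ?_⟩⟩
  · intro e he
    rcases mem_insert.1 he with rfl | he
    · simpa using hab
    · exact hL.nd e (mem_of_mem_erase he)
  · rw [card_insert_of_notMem hne, card_erase_of_mem hf.1]
    have := hL.tot; have := card_pos.2 ⟨f, hf.1⟩; omega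
  · intro S hS
    have h1 := hL.cnt S hS
    by_cases hab' : a ∈ S ∧ b ∈ S
    · by_cases ht : Tight L S
      · have hTS := hsub S ht hab'.1 hab'.2
        have hfS : f ∈ L ∩ S.sym2 := mem_inter.2 ⟨hf.1, sym2_mono hTS hf.2⟩
        have : insert s(a, b) (L.erase f) ∩ S.sym2 ⊆ insert s(a, b) ((L ∩ S.sym2).erase f) := by
          intro e; simp only [mem_inter, mem_insert, mem_erase]; tauto
        have h4 := (card_le_card this).trans (card_insert_le _ _)
        rw [card_erase_of_mem hfS] at h4
        have := card_pos.2 ⟨f, hfS⟩; omega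
      · have : insert s(a, b) (L.erase f) ∩ S.sym2 ⊆ insert s(a, b) (L ∩ S.sym2) := by
          intro e; simp only [mem_inter, mem_insert, mem_erase]; tauto
        have h4 := (card_le_card this).trans (card_insert_le _ _)
        unfold Tight at ht; omega
    · have : insert s(a, b) (L.erase f) ∩ S.sym2 ⊆ L ∩ S.sym2 := by
        intro e; simp only [mem_inter, mem_insert, mem_erase]
        rintro ⟨rfl | h, h'⟩
        · rw [mk_mem_sym2_iff] at h'; exact absurd h' hab'
        · exact ⟨h.2, h'⟩
      have := card_le_card this; omega

end laman
end PTri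

namespace PTri
open Finset
set_option linter.all false

/-- combinatorial plane maps (planarity is encoded by exactness mod 2) -/
structure PMap (V D : Type) [Fintype D] [DecidableEq V] where
  σ : Equiv.Perm D
  τ : Equiv.Perm D
  tail : D → V
  ττ : ∀ d, τ (τ d) = d
  tail_σ : ∀ d, tail (σ d) = tail d
  trans : ∀ g : D → Prop, (∀ d, g d → g (σ d)) → ∀ d d', tail d = tail d' → g d → g d'
  simple : ∀ d d', tail d = tail d' → tail (τ d) = tail (τ d') → d = d'
  noloop : ∀ d, tail d ≠ tail (τ d)
  surj : Function.Surjective tail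
  exact : ∀ f : D → ZMod 2, (∀ d, f (τ d) = f d) →
    (∀ v, ∑ d ∈ Finset.univ.filter (fun d => tail d = v), f d = 0) →
    ∃ g : D → ZMod 2, (∀ d, g (τ (σ d)) = g d) ∧ ∀ d, f d = g d + g (τ d)
  o : D

namespace PMap
variable {V D : Type} [Fintype V] [DecidableEq V] [Fintype D] [DecidableEq D] (M : PMap V D)

def head (d : D) : V := M.tail (M.τ d)
def ψ : Equiv.Perm D := M.τ * M.σ
def e (d : D) : Sym2 V := s(M.tail d, M.head d)

lemma ψ_apply (d : D) : M.ψ d = M.τ (M.σ d) := rfl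
lemma head_ψ (d : D) : M.head (M.ψ d) = M.tail d := by
  rw [head, ψ_apply, M.ττ, M.tail_σ]
lemma head_τ (d : D) : M.head (M.τ d) = M.tail d := by rw [head, M.ττ]
lemma tail_τ (d : D) : M.tail (M.τ d) = M.head d := rfl
lemma e_τ (d : D) : M.e (M.τ d) = M.e d := by rw [e, e, head_τ, tail_τ, Sym2.eq_swap]
lemma ne_head (d : D) : M.tail d ≠ M.head d := M.noloop d
lemma eq_of (d d' : D) (h : M.tail d = M.tail d') (h' : M.head d = M.head d') : d = d' :=
  M.simple d d' h h'
lemma τ_ne (d : D) : M.τ d ≠ d := fun h => M.ne_head d (by rw [head, h])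
lemma ψ_σinv (d : D) : M.ψ (M.σ.symm d) = M.τ d := by rw [ψ_apply]; simp
lemma tail_σinv (d : D) : M.tail (M.σ.symm d) = M.tail d := by
  rw [← M.tail_σ (M.σ.symm d)]; simp
lemma e_eq {d d' : D} (h : M.e d = M.e d') : d = d' ∨ d = M.τ d' := by
  rw [e, e, Sym2.eq_iff] at h
  rcases h with h | h
  · exact Or.inl (M.eq_of _ _ h.1 h.2)
  · exact Or.inr (M.eq_of _ _ (by rw [h.1, tail_τ]) (by rw [h.2, head_τ]))
lemma e_ndiag (d : D) : ¬ (M.e d).IsDiag := by simpa [e] using M.ne_head d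
lemma e_mem {S : Finset V} (d : D) : M.e d ∈ S.sym2 ↔ M.tail d ∈ S ∧ M.head d ∈ S := by
  rw [e, mk_mem_sym2_iff]
lemma τ_eq {x y : D} : M.τ x = y ↔ x = M.τ y :=
  ⟨fun h => by rw [← h, M.ττ], fun h => by rw [h, M.ττ]⟩
lemma e_of_tails {d d' : D} (h : M.tail d = M.head d') (h' : M.head d = M.tail d') : d = M.τ d' :=
  M.eq_of _ _ (by rw [h, tail_τ]) (by rw [h', head_τ])

/-! regions -/
def Reg (T : Finset D) : Prop := ∀ d, M.ψ d ∈ T ↔ d ∈ T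
def bd (T : Finset D) : Finset D := T.filter (fun d => M.τ d ∉ T)

variable {M}
lemma mem_bd {T : Finset D} {d : D} : d ∈ M.bd T ↔ d ∈ T ∧ M.τ d ∉ T := by simp [bd]

lemma Reg.τ_iff {T : Finset D} (h : M.Reg T) (d : D) : M.τ d ∈ T ↔ M.σ.symm d ∈ T := by
  rw [← ψ_σinv]; exact h _

lemma Reg.compl {T : Finset D} (h : M.Reg T) : M.Reg Tᶜ := fun d => by
  simp only [mem_compl, h d]
lemma Reg.sdiff {T S : Finset D} (h : M.Reg T) (h' : M.Reg S) : M.Reg (T \ S) := fun d => by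
  simp only [mem_sdiff, h d, h' d]
lemma Reg.symmDiff {T S : Finset D} (h : M.Reg T) (h' : M.Reg S) : M.Reg (symmDiff T S) := fun d => by
  simp only [mem_symmDiff, h d, h' d]
lemma Reg.union {T S : Finset D} (h : M.Reg T) (h' : M.Reg S) : M.Reg (T ∪ S) := fun d => by
  simp only [mem_union, h d, h' d]

lemma Reg.balance {T : Finset D} (h : M.Reg T) (v : V) :
    ((M.bd T).filter (fun d => M.tail d = v)).card = ((M.bd T).filter (fun d => M.head d = v)).card := by
  have h1 : ((M.bd T).filter (fun d => M.head d = v)).card =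
      (Finset.univ.filter (fun d => M.tail d = v ∧ d ∉ T ∧ M.σ.symm d ∈ T)).card := by
    refine card_bij' (fun d _ => M.τ d) (fun d _ => M.τ d) ?_ ?_ ?_ ?_
    · intro d hd
      simp only [mem_filter, mem_bd, mem_univ, true_and] at hd ⊢
      rw [← h.τ_iff, M.ττ]; exact ⟨hd.2, hd.1.2, hd.1.1⟩
    · intro d hd
      simp only [mem_filter, mem_bd, mem_univ, true_and] at hd ⊢
      rw [M.ττ, head_τ, h.τ_iff]; tauto
    · intro d _; exact M.ττ d
    · intro d _; exact M.ττ d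
  have h2 : ((M.bd T).filter (fun d => M.tail d = v)).card =
      (Finset.univ.filter (fun d => M.tail d = v ∧ d ∈ T ∧ M.σ.symm d ∉ T)).card := by
    congr 1; ext d; simp only [mem_filter, mem_bd, mem_univ, true_and, h.τ_iff]; tauto
  rw [h1, h2]
  have h3 : (Finset.univ.filter (fun d => M.tail d = v ∧ d ∈ T)).card =
      (Finset.univ.filter (fun d => M.tail d = v ∧ M.σ.symm d ∈ T)).card := by
    refine card_bij' (fun d _ => M.σ d) (fun d _ => M.σ.symm d) ?_ ?_ ?_ ?_ <;> intro d hd <;>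
      simp_all [M.tail_σ, M.tail_σinv]
  have h4 := card_filter_add_card_filter_not (s := Finset.univ.filter (fun d => M.tail d = v ∧ d ∈ T))
    (fun d => M.σ.symm d ∈ T)
  have h5 := card_filter_add_card_filter_not (s := Finset.univ.filter (fun d => M.tail d = v ∧ M.σ.symm d ∈ T))
    (fun d => d ∈ T)
  simp only [filter_filter] at h4 h5
  have h6 : (Finset.univ.filter (fun d => (M.tail d = v ∧ d ∈ T) ∧ M.σ.symm d ∈ T)) =
    (Finset.univ.filter (fun d => (M.tail d = v ∧ M.σ.symm d ∈ T) ∧ d ∈ T)) := by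
    ext d; simp only [mem_filter, mem_univ, true_and]; tauto
  have h7 : (Finset.univ.filter (fun d => M.tail d = v ∧ d ∈ T ∧ M.σ.symm d ∉ T)) =
    (Finset.univ.filter (fun d => (M.tail d = v ∧ d ∈ T) ∧ M.σ.symm d ∉ T)) := by
    ext d; simp only [mem_filter, mem_univ, true_and]; tauto
  have h8 : (Finset.univ.filter (fun d => M.tail d = v ∧ d ∉ T ∧ M.σ.symm d ∈ T)) =
    (Finset.univ.filter (fun d => (M.tail d = v ∧ M.σ.symm d ∈ T) ∧ d ∉ T)) := by
    ext d; simp only [mem_filter, mem_univ, true_and]; tauto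
  rw [h7, h8]; rw [h6] at h4; omega

/-- a vertex that is a tail on the boundary is also a head -/
lemma Reg.out {T : Finset D} (h : M.Reg T) {d : D} (hd : d ∈ M.bd T) :
    ∃ d' ∈ M.bd T, M.tail d' = M.head d := by
  have h1 := h.balance (M.head d)
  have : 0 < ((M.bd T).filter (fun d' => M.tail d' = M.head d)).card := by
    rw [h1]; exact card_pos.2 ⟨d, by simp [hd]⟩
  obtain ⟨d', h'⟩ := card_pos.1 this
  exact ⟨d', (mem_filter.1 h').1, (mem_filter.1 h').2⟩

lemma bd_disj {T : Finset D} {d : D} (hd : d ∈ M.bd T) : M.τ d ∉ M.bd T := by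
  rw [mem_bd] at *; tauto

lemma Reg.three {T : Finset D} (h : M.Reg T) {d : D} (hd : d ∈ M.bd T) :
    3 ≤ (M.bd T).card ∧ ((M.bd T).card = 3 → ∃ d2 d3, M.bd T = {d, d2, d3} ∧ d ≠ d2 ∧ d ≠ d3 ∧ d2 ≠ d3 ∧
      M.head d = M.tail d2 ∧ M.head d2 = M.tail d3 ∧ M.head d3 = M.tail d) := by
  obtain ⟨d2, h2, t2⟩ := h.out hd
  obtain ⟨d3, h3, t3⟩ := h.out h2
  have n12 : d ≠ d2 := by rintro rfl; exact M.ne_head _ t2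
  have n23 : d2 ≠ d3 := by rintro rfl; exact M.ne_head _ t3
  have n13 : d ≠ d3 := by
    rintro rfl
    rw [M.e_of_tails t2 t3.symm] at h2; exact bd_disj hd h2
  have hs : ({d, d2, d3} : Finset D) ⊆ M.bd T := by
    intro x; simp only [mem_insert, mem_singleton]; rintro (rfl | rfl | rfl) <;> assumption
  have hc : ({d, d2, d3} : Finset D).card = 3 := by
    rw [card_insert_of_notMem (by simp [n12, n13]), card_pair n23]
  refine ⟨hc ▸ card_le_card hs, fun hb => ?_⟩
  have hE := eq_of_subset_of_card_le hs (by omega)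
  refine ⟨d2, d3, hE.symm, n12, n13, n23, t2.symm, t3.symm, ?_⟩
  obtain ⟨d4, h4, t4⟩ := h.out h3
  rw [← hE] at h4
  simp only [mem_insert, mem_singleton] at h4
  rcases h4 with rfl | rfl | rfl
  · exact t4.symm
  · rw [M.e_of_tails t3 t4.symm] at h3; exact absurd h3 (bd_disj h2)
  · exact absurd t4 (M.ne_head _)

/-- regions from even edge sets -/
lemma reg_of_even (f : D → ZMod 2) (h1 : ∀ d, f (M.τ d) = f d)
    (h2 : ∀ v, ∑ d ∈ Finset.univ.filter (fun d => M.tail d = v), f d = 0) :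
    ∃ T, M.Reg T ∧ M.o ∉ T ∧ ∀ d, f d = 1 ↔ ¬ (d ∈ T ↔ M.τ d ∈ T) := by
  obtain ⟨g, hg, hf⟩ := M.exact f h1 h2
  refine ⟨Finset.univ.filter (fun d => g d ≠ g M.o), fun d => ?_, by simp, fun d => ?_⟩
  · simp only [mem_filter, mem_univ, true_and, ψ_apply, hg]
  · simp only [mem_filter, mem_univ, true_and, hf d]
    generalize g d = a; generalize g (M.τ d) = b; generalize g M.o = c
    revert a b c; decide

/-! with a spanning Laman set -/
def Sub (M : PMap V D) (L : Finset (Sym2 V)) : Prop := ∀ e ∈ L, ∃ d, M.e d = e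

variable {L : Finset (Sym2 V)}

lemma cut_dart (hL : Laman L) (hs : M.Sub L) (S : V → Prop) (h0 : ∃ v, S v) (h1 : ∃ v, ¬ S v) :
    ∃ d, S (M.tail d) ∧ ¬ S (M.head d) ∧ (3 ≤ Fintype.card V → ∃ d', S (M.tail d') ∧ ¬ S (M.head d') ∧ d' ≠ d) := by
  classical
  have key : ∀ e ∈ L, e ∉ (Finset.univ.filter S).sym2 → e ∉ (Finset.univ.filter S)ᶜ.sym2 →
      ∃ d, M.e d = e ∧ S (M.tail d) ∧ ¬ S (M.head d) := by
    intro e he h h'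
    obtain ⟨d, rfl⟩ := hs e he
    rw [e_mem] at h h'
    simp only [mem_filter, mem_univ, true_and, mem_compl] at h h'
    by_cases hS : S (M.tail d)
    · exact ⟨d, rfl, hS, by tauto⟩
    · exact ⟨M.τ d, M.e_τ d, by rw [tail_τ]; tauto, by rw [head_τ]; tauto⟩
  obtain ⟨a, ha⟩ := h0; obtain ⟨b, hb⟩ := h1
  obtain ⟨e, he, h, h', h3⟩ := hL.cut (Finset.univ.filter S) ⟨a, by simp [ha]⟩ (fun h => by
    have := eq_univ_iff_forall.1 h b
    simp [hb] at this)
  obtain ⟨d, rfl, hd⟩ := key e he h h'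
  refine ⟨d, hd.1, hd.2, fun hV => ?_⟩
  obtain ⟨e', he', hne, k, k'⟩ := h3 hV
  obtain ⟨d', rfl, hd'⟩ := key e' he' k k'
  exact ⟨d', hd'.1, hd'.2, fun h => hne (by rw [h])⟩

lemma Reg.const {T : Finset D} (h : M.Reg T) (hL : Laman L) (hs : M.Sub L) (hb : M.bd T = ∅) :
    T = ∅ ∨ T = Finset.univ := by
  have hτ : ∀ d, d ∈ T → M.τ d ∈ T := fun d hd => by
    by_contra hc
    have : d ∈ M.bd T := mem_bd.2 ⟨hd, hc⟩
    simp [hb] at this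
  have hσ : ∀ d, d ∈ T → M.σ d ∈ T := fun d hd => by
    have := hτ _ ((h d).2 hd); rwa [ψ_apply, M.ττ] at this
  by_contra hcon
  push Not at hcon
  obtain ⟨a, ha⟩ := hcon.1
  obtain ⟨b, hb⟩ : ∃ b, b ∉ T := by
    by_contra hh; push Not at hh; exact hcon.2 (eq_univ_iff_forall.2 hh)
  have htr := M.trans (fun d => d ∈ T) hσ
  obtain ⟨d, ⟨d', h1, h2⟩, h3, -⟩ := cut_dart (M := M) hL hs (fun v => ∃ d, M.tail d = v ∧ d ∈ T) ⟨_, a, rfl, ha⟩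
    ⟨M.tail b, fun ⟨d, h1, h2⟩ => hb (htr _ _ h1 h2)⟩
  exact h3 ⟨M.τ d, rfl, hτ _ (htr _ _ h1 h2)⟩

lemma sum_pair_even (d : D) (v : V) :
    ∑ d' ∈ Finset.univ.filter (fun d' => M.tail d' = v), (if d' = d ∨ d' = M.τ d then (1 : ZMod 2) else 0)
      = (if v = M.tail d then 1 else 0) + (if v = M.head d then 1 else 0) := by
  have : ∀ d', (if d' = d ∨ d' = M.τ d then (1 : ZMod 2) else 0) = (if d' = d then 1 else 0) + (if d' = M.τ d then 1 else 0) := by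
    intro d'
    by_cases h : d' = d
    · simp [h, (M.τ_ne d).symm]
    · simp [h]
  simp only [this, sum_add_distrib, sum_ite_eq', mem_filter, mem_univ, true_and, tail_τ]
  congr 1 <;> simp only [eq_comm]

/-- the two sides of an edge are different faces -/
lemma nb (hL : Laman L) (hs : M.Sub L) (hV : 3 ≤ Fintype.card V) (d : D) :
    ∃ T, M.Reg T ∧ d ∈ T ∧ M.τ d ∉ T := by
  set P : V → Prop := fun v => ∃ f : D → ZMod 2, (∀ d, f (M.τ d) = f d) ∧ f d = 0 ∧
    ∀ v', ∑ d ∈ Finset.univ.filter (fun d => M.tail d = v'), f d =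
      (if v' = M.tail d then 1 else 0) + (if v' = v then 1 else 0) with hP
  have hP0 : P (M.tail d) := ⟨fun _ => 0, by simp, rfl, fun v' => by
    rw [sum_const_zero, CharTwo.add_self_eq_zero]⟩
  have hP1 : P (M.head d) := by
    by_contra hc
    obtain ⟨d1, h1, h2, h3⟩ := cut_dart (M := M) hL hs P ⟨_, hP0⟩ ⟨_, hc⟩
    obtain ⟨d2, k1, k2, hne⟩ := h3 hV
    have key : ∀ d1, P (M.tail d1) → ¬ P (M.head d1) → d1 = d := by
      intro d1 h1 h2
      by_contra hne
      obtain ⟨f, f1, f2, f3⟩ := h1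
      by_cases hd : d1 = M.τ d
      · apply h2; rw [hd, head_τ]; exact hP0
      apply h2
      refine ⟨fun d' => f d' + if d' = d1 ∨ d' = M.τ d1 then 1 else 0, fun d' => ?_, ?_, fun v' => ?_⟩
      · simp only [f1, M.τ_eq, M.ττ, or_comm]
      · simp only []; rw [f2, if_neg, add_zero]; rintro (rfl | h)
        · exact hne rfl
        · apply hd; rw [h, M.ττ]
      · rw [sum_add_distrib, f3, sum_pair_even]
        have : ∀ a b c : ZMod 2, a + b + (b + c) = a + c := by decide
        exact this _ _ _
    exact hne ((key d2 k1 k2).trans (key d1 h1 h2).symm)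
  obtain ⟨f, f1, f2, f3⟩ := hP1
  obtain ⟨T, hT, ho, hf⟩ := reg_of_even (M := M) (fun d' => f d' + if d' = d ∨ d' = M.τ d then 1 else 0) (by
    intro d'; simp only [f1, M.τ_eq, M.ττ, or_comm]) (by
    intro v; rw [sum_add_distrib, f3, sum_pair_even]; exact CharTwo.add_self_eq_zero _)
  have h1 := (hf d).1 (by simp [f2])
  by_cases hd : d ∈ T
  · exact ⟨T, hT, hd, by tauto⟩
  · exact ⟨Tᶜ, hT.compl, by simpa using hd, by simp; tauto⟩

end PMap
end PTri

namespace PTri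
open Finset
set_option linter.all false
namespace PMap
variable {V D : Type} [Fintype V] [DecidableEq V] [Fintype D] [DecidableEq D] {M : PMap V D}
variable {L : Finset (Sym2 V)}

/-- faces of the sub-map with edge set `X` -/
def cls (M : PMap V D) (X : Finset (Sym2 V)) : Setoid D :=
  Relation.EqvGen.setoid (fun a b => b = M.ψ a ∨ (b = M.τ a ∧ M.e a ∉ X))

open Classical in
noncomputable def cl (M : PMap V D) (X : Finset (Sym2 V)) (d : D) : Finset D :=
  Finset.univ.filter (fun d' => (M.cls X) d' d)

variable {X : Finset (Sym2 V)}
lemma mem_cl {d d' : D} : d' ∈ M.cl X d ↔ (M.cls X) d' d := by simp [cl]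
lemma self_cl (d : D) : d ∈ M.cl X d := mem_cl.2 ((M.cls X).refl _)
lemma cl_eq {d d' : D} (h : d' ∈ M.cl X d) : M.cl X d' = M.cl X d := by
  ext x; rw [mem_cl, mem_cl]; rw [mem_cl] at h
  exact ⟨fun k => (M.cls X).trans k h, fun k => (M.cls X).trans k ((M.cls X).symm h)⟩
lemma cls_ψ (d : D) : (M.cls X) d (M.ψ d) := Relation.EqvGen.rel _ _ (Or.inl rfl)
lemma cls_τ (d : D) (h : M.e d ∉ X) : (M.cls X) d (M.τ d) := Relation.EqvGen.rel _ _ (Or.inr ⟨rfl, h⟩)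
lemma reg_cl (d : D) : M.Reg (M.cl X d) := fun d' => by
  rw [mem_cl, mem_cl]
  exact ⟨fun h => (M.cls X).trans (cls_ψ d') h, fun h => (M.cls X).trans ((M.cls X).symm (cls_ψ d')) h⟩
lemma bd_cl {d d' : D} (h : d' ∈ M.bd (M.cl X d)) : M.e d' ∈ X := by
  by_contra hc
  rw [mem_bd, mem_cl, mem_cl] at h
  exact h.2 ((M.cls X).trans ((M.cls X).symm (cls_τ d' hc)) h.1)
lemma cl_sub {S : Finset D} (hS : M.Reg S) (hb : ∀ d ∈ M.bd S, M.e d ∈ X) {d : D} (hd : d ∈ S) :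
    M.cl X d ⊆ S := by
  intro d' h
  rw [mem_cl] at h
  have : ∀ a b, (M.cls X) a b → (a ∈ S ↔ b ∈ S) := by
    intro a b hab
    induction hab with
    | rel a b h =>
      rcases h with rfl | ⟨rfl, h⟩
      · exact (hS a).symm
      · constructor
        · intro ha; by_contra hc; exact h (hb a (mem_bd.2 ⟨ha, hc⟩))
        · intro ha; by_contra hc
          exact h (M.e_τ a ▸ hb _ (mem_bd.2 ⟨ha, by rwa [M.ττ]⟩))
    | refl a => exact Iff.rfl
    | symm a b _ ih => exact ih.symm
    | trans a b c _ _ i j => exact i.trans j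
  exact (this _ _ h).2 hd

lemma card_darts (hs : M.Sub L) (hX : X ⊆ L) :
    (Finset.univ.filter (fun d => M.e d ∈ X)).card = 2 * X.card := by
  rw [card_eq_sum_card_fiberwise (f := M.e) (t := X) (fun d hd => by simpa using hd)]
  rw [sum_const_nat (m := 2), mul_comm]
  intro x hx
  obtain ⟨d, rfl⟩ := hs x (hX hx)
  rw [show (Finset.univ.filter (fun d => M.e d ∈ X)).filter (fun d' => M.e d' = M.e d) = {d, M.τ d} from ?_]
  · exact card_pair (M.τ_ne d).symm
  · ext d'
    simp only [mem_filter, mem_univ, true_and, mem_insert, mem_singleton]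
    constructor
    · intro h; exact M.e_eq h.2
    · rintro (rfl | rfl)
      · exact ⟨hx, rfl⟩
      · rw [M.e_τ]; exact ⟨hx, rfl⟩

lemma card_cls (hL : Laman L) (hs : M.Sub L) {Z : Finset V} (hZ : Tight L Z) :
    Z.card ≤ Nat.card (Quotient (M.cls (L ∩ Z.sym2))) + 1 := by
  classical
  set X := L ∩ Z.sym2 with hX
  set Q := Quotient (M.cls X)
  haveI : Fintype Q := Fintype.ofFinite _
  let J : (X → ZMod 2) →ₗ[ZMod 2] (D → ZMod 2) :=
    { toFun := fun h d => if he : M.e d ∈ X then h ⟨M.e d, he⟩ else 0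
      map_add' := fun a b => by ext d; by_cases he : M.e d ∈ X <;> simp [he]
      map_smul' := fun a b => by ext d; by_cases he : M.e d ∈ X <;> simp [he] }
  have hJ : Function.Injective J := by
    intro a b hab
    ext ⟨x, hx⟩
    obtain ⟨d, rfl⟩ := hs x (mem_inter.1 hx).1
    have := congrFun hab d
    simpa [J, hx] using this
  obtain ⟨z0, hz0⟩ := card_pos.1 (by have := hL.two_le hZ; omega : 0 < Z.card)
  let K : (D → ZMod 2) →ₗ[ZMod 2] (Z.erase z0 → ZMod 2) :=
    { toFun := fun f v => ∑ d ∈ Finset.univ.filter (fun d => M.tail d = v), f d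
      map_add' := fun a b => by ext v; simp [sum_add_distrib]
      map_smul' := fun a b => by ext v; simp [mul_sum] }
  let Φ : (Q → ZMod 2) →ₗ[ZMod 2] (D → ZMod 2) :=
    { toFun := fun g d => g (Quotient.mk _ d) + g (Quotient.mk _ (M.τ d))
      map_add' := fun a b => by ext v; simp; ring
      map_smul' := fun a b => by ext v; simp; ring }
  have h1 := LinearMap.finrank_range_add_finrank_ker (K ∘ₗ J)
  have h2 := LinearMap.finrank_range_add_finrank_ker Φ
  have h3 : Module.finrank (ZMod 2) (LinearMap.range (K ∘ₗ J)) ≤ Z.card - 1 := by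
    refine (Submodule.finrank_le _).trans ?_
    rw [Module.finrank_fintype_fun_eq_card, Fintype.card_coe, card_erase_of_mem hz0]
  rw [Module.finrank_fintype_fun_eq_card, Fintype.card_coe] at h1
  rw [Module.finrank_fintype_fun_eq_card, ← Nat.card_eq_fintype_card] at h2
  have h4 : 1 ≤ Module.finrank (ZMod 2) (LinearMap.ker Φ) := by
    rw [Submodule.one_le_finrank_iff]
    intro hb
    have : (fun _ => 1 : Q → ZMod 2) ∈ LinearMap.ker Φ := by
      rw [LinearMap.mem_ker]; ext d; exact CharTwo.add_self_eq_zero (1 : ZMod 2)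
    rw [hb, Submodule.mem_bot] at this
    exact one_ne_zero (congrFun this (Quotient.mk _ M.o))
  have h5 : (LinearMap.ker (K ∘ₗ J)).map J ≤ LinearMap.range Φ := by
    rintro f ⟨h, hh, rfl⟩
    have hKh : ∀ v ∈ Z.erase z0, ∑ d ∈ Finset.univ.filter (fun d => M.tail d = v), J h d = 0 := by
      intro v hv; exact congrFun (LinearMap.mem_ker.1 hh) ⟨v, hv⟩
    have hτ : ∀ d, J h (M.τ d) = J h d := fun d => by simp only [J, LinearMap.coe_mk, AddHom.coe_mk, M.e_τ]
    have hout : ∀ v, v ∉ Z → ∑ d ∈ Finset.univ.filter (fun d => M.tail d = v), J h d = 0 := by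
      intro v hv
      apply sum_eq_zero
      intro d hd
      have : M.e d ∉ X := by
        intro hc; rw [hX, mem_inter, e_mem] at hc
        simp only [mem_filter, mem_univ, true_and] at hd
        exact hv (hd ▸ hc.2.1)
      simp [J, this]
    have htot : ∑ d, J h d = 0 := by
      refine sum_involution (fun d _ => M.τ d) ?_ ?_ ?_ ?_
      · intro d _; rw [hτ]; exact CharTwo.add_self_eq_zero _
      · intro d _ _; exact M.τ_ne d
      · intro d _; exact mem_univ _
      · intro d _; exact M.ττ d
    have hall : ∀ v, ∑ d ∈ Finset.univ.filter (fun d => M.tail d = v), J h d = 0 := by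
      intro v
      by_cases hv : v ∈ Z
      · by_cases hz : v = z0
        · rw [← sum_fiberwise Finset.univ M.tail (J h)] at htot
          rw [← sum_erase_add _ _ (mem_univ z0), sum_eq_zero, zero_add] at htot
          · rw [hz]; exact htot
          · intro v' hv'
            by_cases k : v' ∈ Z
            · exact hKh v' (mem_erase.2 ⟨(mem_erase.1 hv').1, k⟩)
            · exact hout v' k
        · exact hKh v (mem_erase.2 ⟨hz, hv⟩)
      · exact hout v hv
    obtain ⟨g, hg, hf⟩ := M.exact (J h) hτ hall
    have hresp : ∀ a b, (M.cls X) a b → g a = g b := by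
      intro a b hab
      induction hab with
      | rel a b h' =>
        rcases h' with rfl | ⟨rfl, h'⟩
        · exact (hg a).symm
        · have := hf a
          simp only [J, LinearMap.coe_mk, AddHom.coe_mk, h', dif_neg, not_false_iff] at this
          exact CharTwo.add_eq_zero.1 this.symm
      | refl a => rfl
      | symm a b _ ih => exact ih.symm
      | trans a b c _ _ i j => exact i.trans j
    exact ⟨Quotient.lift g hresp, by ext d; simp [Φ, hf d]⟩
  have h6 := Submodule.finrank_mono h5
  rw [← (Submodule.equivMapOfInjective J hJ _).finrank_eq] at h6
  have h7 : X.card + 3 = 2 * Z.card := hZ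
  omega

/-- if there are only two classes then `Z` is small -/
lemma two_cls (hL : Laman L) (hs : M.Sub L) {Z : Finset V} (hZ : Tight L Z) (C : Finset D)
    (h : ∀ d, M.cl (L ∩ Z.sym2) d = C ∨ M.cl (L ∩ Z.sym2) d = Cᶜ) : Z.card ≤ 3 := by
  classical
  refine (card_cls hL hs hZ).trans ?_
  have : Nat.card (Quotient (M.cls (L ∩ Z.sym2))) ≤ Nat.card Bool := by
    let F : Quotient (M.cls (L ∩ Z.sym2)) → Bool := fun q => decide (M.cl (L ∩ Z.sym2) q.out = C)
    refine Nat.card_le_card_of_injective F ?_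
    intro a b hab
    have h1 := h a.out; have h2 := h b.out
    simp only [F, decide_eq_decide] at hab
    have : M.cl (L ∩ Z.sym2) a.out = M.cl (L ∩ Z.sym2) b.out := by
      by_cases hc : M.cl (L ∩ Z.sym2) a.out = C
      · rw [hc, hab.1 hc]
      · rw [h1.resolve_left hc, h2.resolve_left (fun k => hc (hab.2 k))]
    have h3 := self_cl (M := M) (X := L ∩ Z.sym2) a.out
    rw [this, mem_cl] at h3
    rw [← Quotient.out_eq a, ← Quotient.out_eq b]; exact Quotient.sound h3
  rw [Nat.card_eq_fintype_card (α := Bool), Fintype.card_bool] at this; omega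

lemma cl_bd3 (hL : Laman L) (hs : M.Sub L) {Z : Finset V} (hZ : Tight L Z) (h3 : 3 ≤ Z.card) (d : D) :
    ∃ d', d' ∈ M.bd (M.cl (L ∩ Z.sym2) d) := by
  classical
  by_contra hc
  push Not at hc
  have hb := eq_empty_iff_forall_notMem.2 hc
  rcases (reg_cl d).const hL hs hb with h | h
  · have := self_cl (M := M) (X := L ∩ Z.sym2) d; rw [h] at this; simp at this
  · have : Nat.card (Quotient (M.cls (L ∩ Z.sym2))) ≤ 1 := by
      rw [Finite.card_le_one_iff_subsingleton]
      refine ⟨fun a b => ?_⟩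
      rw [← Quotient.out_eq a, ← Quotient.out_eq b]; apply Quotient.sound
      have h1 := mem_univ a.out; have h2 := mem_univ b.out
      rw [← h, mem_cl] at h1 h2
      exact (M.cls _).trans h1 ((M.cls _).symm h2)
    have := card_cls hL hs hZ; omega

/-- selection of a triangular class -/
lemma cls_select (hL : Laman L) (hs : M.Sub L) {Z : Finset V} (hZ : Tight L Z) (h3 : 3 ≤ Z.card) (d1 d2 : D)
    (h : (M.bd (M.cl (L ∩ Z.sym2) d1)).card ≠ 3 ∨ d1 ∈ M.cl (L ∩ Z.sym2) d2) :
    ∃ d, d ∉ M.cl (L ∩ Z.sym2) d1 ∧ d ∉ M.cl (L ∩ Z.sym2) d2 ∧ (M.bd (M.cl (L ∩ Z.sym2) d)).card = 3 := by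
  classical
  by_contra hcon
  push Not at hcon
  set X := L ∩ Z.sym2 with hX
  haveI : Fintype (Quotient (M.cls X)) := Fintype.ofFinite _
  have hsum := card_darts hs (inter_subset_left : X ⊆ L)
  rw [card_eq_sum_card_fiberwise (f := fun d => (Quotient.mk (M.cls X) d)) (t := Finset.univ) (fun d hd => by simp)] at hsum
  have hq := card_cls hL hs hZ
  rw [← hX] at hq
  have hn : ∀ q ∈ (Finset.univ : Finset (Quotient (M.cls X))), 4 - (if q = Quotient.mk _ d2 then 1 else 0) ≤
      (filter (fun d => (Quotient.mk (M.cls X) d) = q) (Finset.univ.filter (fun d => M.e d ∈ X))).card := by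
    intro q _
    induction q using Quotient.ind with | _ d =>
    have hsub : M.bd (M.cl X d) ⊆ filter (fun d' => (Quotient.mk (M.cls X) d') = Quotient.mk _ d) (Finset.univ.filter (fun d => M.e d ∈ X)) := by
      intro d' hd'
      simp only [mem_filter, mem_univ, true_and]
      exact ⟨bd_cl hd', Quotient.sound (mem_cl.1 (mem_bd.1 hd').1)⟩
    have h5 := card_le_card hsub
    obtain ⟨d', hd'⟩ := cl_bd3 hL hs hZ h3 d
    have h6 := ((reg_cl d).three hd').1
    rw [← hX] at h6
    by_cases hd2 : d ∈ M.cl X d2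
    · rw [if_pos (Quotient.sound (mem_cl.1 hd2))]; omega
    · have h7 : (M.bd (M.cl X d)).card ≠ 3 := by
        by_cases hd1 : d ∈ M.cl X d1
        · rw [cl_eq hd1]; refine h.resolve_right (fun h => hd2 ?_)
          rw [cl_eq h] at hd1; exact hd1
        · exact hcon d hd1 hd2
      rw [if_neg]
      · omega
      · intro h; exact hd2 (mem_cl.2 (Quotient.exact h))
  have h8 := sum_le_sum hn
  have h9 : ∑ q : Quotient (M.cls X), (4 - (if q = Quotient.mk _ d2 then 1 else 0)) + 1 = 4 * Fintype.card (Quotient (M.cls X)) := by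
    have : ∀ q : Quotient (M.cls X), (4 - (if q = Quotient.mk _ d2 then 1 else 0)) + (if q = Quotient.mk _ d2 then 1 else 0) = 4 := by
      intro q; split_ifs <;> rfl
    have h10 := sum_congr rfl (fun q (_ : q ∈ Finset.univ) => this q)
    rw [sum_add_distrib] at h10
    simp only [sum_ite_eq', mem_univ, if_true, sum_const, card_univ, smul_eq_mul] at h10
    rw [h10, mul_comm]
  rw [hsum] at h8
  rw [Nat.card_eq_fintype_card] at hq
  have h7 : X.card + 3 = 2 * Z.card := hZ
  rw [← hX] at h8
  omega

end PMap
end PTri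

namespace PTri
open Finset
set_option linter.all false
namespace PMap
variable {V D : Type} [Fintype V] [DecidableEq V] [Fintype D] [DecidableEq D] {M : PMap V D}
variable {L : Finset (Sym2 V)}

def Tri (M : PMap V D) (T : Finset D) : Prop := M.Reg T ∧ M.o ∉ T ∧ (M.bd T).card = 3
def Single (M : PMap V D) (T : Finset D) : Prop := ∃ d, ∀ d', d' ∈ T ↔ M.ψ.SameCycle d d'

lemma tri_ψ {T : Finset D} (hT : M.Reg T) (hb : M.bd T = T) (hc : T.card = 3) {d : D} (hd : d ∈ T) :
    M.ψ (M.ψ (M.ψ d)) = d ∧ T = {d, M.ψ d, M.ψ (M.ψ d)} := by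
  have key : ∀ d ∈ T, ∃ d2, T = {d, d2, M.ψ d} ∧ M.head d = M.tail d2 ∧ M.head d2 = M.tail (M.ψ d) ∧
      d ≠ d2 ∧ d ≠ M.ψ d ∧ d2 ≠ M.ψ d := by
    intro d hd
    obtain ⟨d2, d3, hE, n1, n2, n3, h1, h2, h3⟩ := (hT.three (hb.symm ▸ hd : d ∈ M.bd T)).2 (hb.symm ▸ hc)
    rw [hb] at hE
    have h4 : M.ψ d ∈ T := (hT d).2 hd
    have h5 := M.head_ψ d
    have : M.ψ d = d3 := by
      rw [hE] at h4; simp only [mem_insert, mem_singleton] at h4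
      rcases h4 with h | h | h
      · rw [h] at h5; exact absurd h5.symm (M.ne_head d)
      · rw [h, h2] at h5; exact absurd (h5.trans h3.symm) (M.ne_head d3)
      · exact h
    subst this
    exact ⟨d2, hE, h1, h2, n1, n2, n3⟩
  obtain ⟨d2, hE, h1, h2, n1, n2, n3⟩ := key d hd
  have k1 : M.ψ (M.ψ d) = d2 := by
    have h4 : M.ψ (M.ψ d) ∈ T := (hT _).2 ((hT d).2 hd)
    have h5 := M.head_ψ (M.ψ d)
    rw [hE] at h4; simp only [mem_insert, mem_singleton] at h4
    rcases h4 with h | h | h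
    · rw [h, h1, ← h2] at h5; exact absurd h5 (M.ne_head d2)
    · exact h
    · rw [h] at h5; exact absurd h5.symm (M.ne_head _)
  refine ⟨?_, ?_⟩
  · have h4 : M.ψ (M.ψ (M.ψ d)) ∈ T := (hT _).2 ((hT _).2 ((hT d).2 hd))
    rw [hE] at h4; simp only [mem_insert, mem_singleton] at h4
    rcases h4 with h | h | h
    · exact h
    · rw [← k1] at h; exact absurd (M.ψ.injective (M.ψ.injective h)).symm n2
    · exact absurd (k1.symm.trans (M.ψ.injective h)) n1.symm
  · rw [k1, hE]; ext x; simp only [mem_insert, mem_singleton]; tauto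

lemma reg_sameCycle {T : Finset D} (hT : M.Reg T) {d d' : D} (h : M.ψ.SameCycle d d') (hd : d ∈ T) : d' ∈ T := by
  obtain ⟨n, rfl⟩ := h.exists_nat_pow_eq
  induction n with
  | zero => simpa using hd
  | succ k ih => rw [pow_succ', Equiv.Perm.mul_apply]; exact (hT _).2 (ih ⟨k, by simp⟩)

lemma single_tri (hL : Laman L) (hs : M.Sub L) (hV : 3 ≤ Fintype.card V) {T : Finset D} (hT : M.Tri T)
    (h1 : M.Single T) : M.bd T = T ∧ T.card = 3 := by
  have hb : M.bd T = T := by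
    apply Subset.antisymm (filter_subset _ _)
    intro d hd
    refine mem_bd.2 ⟨hd, fun hc => ?_⟩
    obtain ⟨S, hS, k1, k2⟩ := nb hL hs hV d
    obtain ⟨d0, h0⟩ := h1
    exact k2 (reg_sameCycle hS (((h0 d).1 hd).symm.trans ((h0 _).1 hc)) k1)
  exact ⟨hb, by rw [← hb]; exact hT.2.2⟩

lemma reg_bd_head {T : Finset D} (hT : M.Reg T) {W : V → Prop} (h : ∀ d ∈ M.bd T, W (M.tail d)) :
    ∀ d ∈ M.bd T, W (M.head d) := by
  intro d hd
  obtain ⟨d', h', e⟩ := hT.out hd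
  exact e ▸ h d' h'

lemma exch (X : Finset (Sym2 V)) (hc : X.card ≤ 3) (hX : ∀ x ∈ X, ∃ d, M.e d = x) :
    ∀ n (L : Finset (Sym2 V)), Laman L → M.Sub L → (X \ L).card = n → ∃ L', Laman L' ∧ M.Sub L' ∧ X ⊆ L' := by
  intro n
  induction n with
  | zero =>
    intro L hL hs h
    exact ⟨L, hL, hs, by rwa [card_eq_zero, sdiff_eq_empty_iff_subset] at h⟩
  | succ n ih =>
    intro L hL hs h
    obtain ⟨x, hx⟩ := card_pos.1 (by omega : 0 < (X \ L).card)
    rw [mem_sdiff] at hx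
    obtain ⟨d, rfl⟩ := hX x hx.1
    obtain ⟨f, hf, hfX, hL'⟩ := hL.exchange (M.ne_head d) hx.2 X hc hx.1
    refine ih _ hL' ?_ ?_
    · intro y hy
      rcases mem_insert.1 hy with rfl | hy
      · exact ⟨d, rfl⟩
      · exact hs y (mem_of_mem_erase hy)
    · have : X \ insert s(M.tail d, M.head d) (L.erase f) = (X \ L).erase (M.e d) := by
        ext y; simp only [mem_sdiff, mem_insert, mem_erase, e]
        constructor
        · rintro ⟨h1, h2⟩; push Not at h2
          refine ⟨h2.1, h1, fun hy => ?_⟩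
          exact h2.2 (fun hyf => hfX (hyf ▸ h1)) hy
        · rintro ⟨h1, h2, h3⟩; exact ⟨h2, by tauto⟩
      rw [this, card_erase_of_mem (mem_sdiff.2 hx), h]; rfl

/-- the subgraph in which the contraction edge is searched -/
structure Setting (M : PMap V D) (L : Finset (Sym2 V)) (W : Finset V) (C : Finset D) : Prop where
  lam : Laman L
  sub : M.Sub L
  tight : Tight L W
  three : 3 ≤ W.card
  h1 : ∀ T, M.Tri T → (∀ d ∈ M.bd T, M.tail d ∈ W) → M.Single T ∨ T = C
  hC : C = ∅ ∨ (M.Tri C ∧ ¬ M.Single C ∧ 4 ≤ W.card ∧ ∀ P, M.Reg P → Disjoint P C →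
    (∀ d ∈ M.bd P, M.tail d ∈ W ∧ M.head d ∈ W) → P = ∅ ∨ P = Cᶜ)
  lift : ∀ d, M.e d ∉ (M.bd C).image M.e → M.tail d ∈ W → M.head d ∈ W →
    (∀ Z, Tight L Z → M.tail d ∈ Z → M.head d ∈ Z → 3 ≤ Z.card → Tight L (Z ∩ W) ∧ 3 ≤ (Z ∩ W).card) ∧
    ∀ d1 d2, M.tail d1 = M.tail d → M.tail d2 = M.head d → M.head d1 = M.head d2 → M.head d1 ∈ W

lemma tri_pairs {C : Finset D} (hC : M.Tri C) {d : D} (h1 : M.tail d ∈ (M.bd C).image M.tail)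
    (h2 : M.head d ∈ (M.bd C).image M.tail) : d ∈ M.bd C ∨ M.τ d ∈ M.bd C := by
  obtain ⟨d1, k1, e1⟩ := mem_image.1 h1
  obtain ⟨d2, d3, hE, -, -, -, t1, t2, t3⟩ := (hC.1.three k1).2 hC.2.2
  obtain ⟨d4, k4, e4⟩ := mem_image.1 h2
  rw [hE] at k4 ⊢; simp only [mem_insert, mem_singleton] at k4 ⊢
  rcases k4 with rfl | rfl | rfl
  · exact absurd (e1.symm.trans e4) (M.ne_head d)
  · left; left; exact M.eq_of _ _ e1.symm (by rw [← e4, t1])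
  · right; right; right; symm; rw [← M.τ_eq]
    apply M.eq_of
    · rw [tail_τ, t3, e1]
    · rw [head_τ, e4]

lemma setting_exists (hL : Laman L) (hs : M.Sub L) (hV : 3 ≤ Fintype.card V) :
    ∃ L' W C, Setting M L' W C := by
  classical
  by_cases hex : ∃ T, M.Tri T ∧ ¬ M.Single T
  swap
  · push Not at hex
    refine ⟨L, Finset.univ, ∅, hL, hs, hL.univ, by simpa using hV, fun T hT _ => Or.inl (hex T hT), Or.inl rfl, ?_⟩
    intro d _ _ _
    simp only [inter_univ, mem_univ, implies_true, and_true]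
    exact fun Z h _ _ h' => ⟨h, h'⟩
  obtain ⟨C, hCm, hmin⟩ := exists_min_image (Finset.univ.filter (fun T => M.Tri T ∧ ¬ M.Single T)) Finset.card
    (by obtain ⟨T, hT⟩ := hex; exact ⟨T, by simpa using hT⟩)
  simp only [mem_filter, mem_univ, true_and] at hCm hmin
  obtain ⟨hC, hns⟩ := hCm
  obtain ⟨L', hL', hs', hCL⟩ := exch (M := M) ((M.bd C).image M.e) (card_image_le.trans hC.2.2.le)
    (fun x hx => by obtain ⟨d, -, h⟩ := mem_image.1 hx; exact ⟨d, h⟩) _ L hL hs rfl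
  set cs := (M.bd C).image M.tail with hcs
  set W : Finset V := Finset.univ.filter (fun v => v ∈ cs ∨ ∀ d, M.tail d = v → d ∈ C) with hW
  have hσ : ∀ d, M.σ.symm (M.τ d) ∈ C ↔ d ∈ C := fun d => by rw [← hC.1.τ_iff, M.ττ]
  have hσt : ∀ d, M.tail (M.σ.symm (M.τ d)) = M.head d := fun d => by rw [M.tail_σinv, tail_τ]
  have F1 : ∀ d ∈ C, M.tail d ∈ W := by
    intro d hd
    by_contra hc
    simp only [hW, mem_filter, mem_univ, true_and, not_or] at hc
    push Not at hc
    obtain ⟨hc1, d', h1, h2⟩ := hc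
    have := M.trans (fun x => M.tail x = M.tail d ∧ x ∉ C) (by
      rintro x ⟨hx, hx'⟩
      refine ⟨by rw [M.tail_σ, hx], fun hxC => hc1 ?_⟩
      rw [hcs, mem_image]
      exact ⟨M.σ x, mem_bd.2 ⟨hxC, by rw [hC.1.τ_iff]; simpa using hx'⟩, by rw [M.tail_σ, hx]⟩) d' d h1 ⟨h1, h2⟩
    exact this.2 hd
  have F2 : ∀ d ∈ C, M.head d ∈ W := fun d hd => hσt d ▸ F1 _ ((hσ d).2 hd)
  have F4 : ∀ d, d ∉ C → M.tail d ∈ W → M.tail d ∈ cs := by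
    intro d hd h
    rw [hW, mem_filter] at h
    exact h.2.resolve_right (fun k => hd (k d rfl))
  have F4' : ∀ d, d ∉ C → M.head d ∈ W → M.head d ∈ cs := fun d hd h =>
    hσt d ▸ F4 _ (fun k => hd ((hσ d).1 k)) (by rw [hσt]; exact h)
  obtain ⟨dC, hdC⟩ := card_pos.1 (by rw [hC.2.2]; norm_num : 0 < (M.bd C).card)
  have hdC' := (mem_bd.1 hdC).1
  have hP : ∀ P, M.Reg P → Disjoint P C →
    (∀ d ∈ M.bd P, (M.tail d ∈ W ∧ M.head d ∈ W) ∨ M.τ d ∈ C) → P = ∅ ∨ P = Cᶜ := by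
    intro P hP hd h
    have hnC : ∀ d ∈ P, d ∉ C := fun d h1 h2 => disjoint_left.1 hd h1 h2
    have k : ∀ d ∈ M.bd P, M.τ d ∈ M.bd C := by
      intro d hd
      have hn := hnC d (mem_bd.1 hd).1
      rcases h d hd with h | h
      · rcases tri_pairs hC (F4 d hn h.1) (F4' d hn h.2) with k | k
        · exact absurd (mem_bd.1 k).1 hn
        · exact k
      · exact mem_bd.2 ⟨h, by rwa [M.ττ]⟩
    rcases (M.bd P).eq_empty_or_nonempty with hb | ⟨d, hdd⟩
    · rcases hP.const hL hs hb with h | h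
      · exact Or.inl h
      · exact absurd hdC' (hnC dC (h ▸ mem_univ _))
    · right
      have hbC : (M.bd P).image M.τ = M.bd C := by
        apply eq_of_subset_of_card_le
        · intro x hx; obtain ⟨y, hy, rfl⟩ := mem_image.1 hx; exact k y hy
        · rw [card_image_of_injective _ M.τ.injective, hC.2.2]; exact (hP.three hdd).1
      have hb : M.bd (P ∪ C) = ∅ := by
        rw [eq_empty_iff_forall_notMem]
        intro x hx
        rw [mem_bd, mem_union, mem_union] at hx
        push Not at hx
        rcases hx.1 with h | h
        · exact hx.2.2 (mem_bd.1 (k x (mem_bd.2 ⟨h, hx.2.1⟩))).1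
        · have : x ∈ (M.bd P).image M.τ := hbC ▸ mem_bd.2 ⟨h, hx.2.2⟩
          obtain ⟨y, hy, rfl⟩ := mem_image.1 this
          rw [M.ττ] at hx; exact hx.2.1 (mem_bd.1 hy).1
      rcases (hP.union hC.1).const hL hs hb with h | h
      · have : dC ∈ P ∪ C := mem_union_right _ hdC'
        simp [h] at this
      · ext x; rw [mem_compl]
        refine ⟨hnC x, fun hx => (mem_union.1 (h ▸ mem_univ x : x ∈ P ∪ C)).resolve_right hx⟩
  have hcsW : cs ⊆ W := fun v hv => by simp [hW, hv]
  have hcs3 : cs.card = 3 := by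
    obtain ⟨d2, d3, hE, n1, n2, n3, t1, t2, t3⟩ := (hC.1.three hdC).2 hC.2.2
    have := M.ne_head dC; have := M.ne_head d2; have := M.ne_head d3
    rw [hcs, hE, image_insert, image_insert, image_singleton, card_eq_three]
    refine ⟨_, _, _, ?_, ?_, ?_, rfl⟩ <;> grind
  have hadj : ∀ d, M.tail d ∈ W → M.tail d ∉ cs → M.head d ∈ W := by
    intro d h1 h2
    by_cases hd : d ∈ C
    · exact F2 d hd
    · exact absurd (F4 d hd h1) h2
  -- W is tight
  set W' : Finset V := cs ∪ Wᶜ with hW'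
  have hcard : W.card + W'.card = Fintype.card V + 3 := by
    rw [hW', card_union_of_disjoint (disjoint_left.2 fun x h1 h2 => (mem_compl.1 h2) (hcsW h1)), hcs3, card_compl]
    have := card_le_univ W; omega
  have hCE : ((M.bd C).image M.e).card = 3 := by
    rw [card_image_of_injOn, hC.2.2]
    intro x hx y hy h
    rcases M.e_eq h with h | h
    · exact h
    · rw [h] at hx; exact absurd hx (bd_disj hy)
  have hu : L' ⊆ (L' ∩ W.sym2) ∪ (L' ∩ W'.sym2) := by
    intro x hx
    obtain ⟨d, rfl⟩ := hs' x hx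
    simp only [mem_union, mem_inter, e_mem, hx, true_and]
    by_contra hcon
    rw [hW', mem_union, mem_union, mem_compl, mem_compl] at hcon
    have h1 := hadj d; have h2 := hadj (M.τ d)
    rw [tail_τ, head_τ] at h2
    have := @hcsW (M.tail d); have := @hcsW (M.head d)
    tauto
  have hi : (M.bd C).image M.e ⊆ (L' ∩ W.sym2) ∩ (L' ∩ W'.sym2) := by
    intro x hx
    have hxL := hCL hx
    obtain ⟨d, hd, rfl⟩ := mem_image.1 hx
    have a1 : M.tail d ∈ cs := mem_image_of_mem _ hd
    have a2 : M.head d ∈ cs := by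
      obtain ⟨d', h', e⟩ := hC.1.out hd; exact e ▸ mem_image_of_mem _ h'
    simp only [mem_inter, e_mem, hxL, true_and, hcsW a1, hcsW a2, hW', mem_union, a1, a2, true_or, and_self]
  have hui := card_union_add_card_inter (L' ∩ W.sym2) (L' ∩ W'.sym2)
  have hW3 := hcs3 ▸ card_le_card hcsW
  have hW'3 : 3 ≤ W'.card := hcs3 ▸ card_le_card (subset_union_left : cs ⊆ W')
  have hWt : Tight L' W := by
    have a1 := card_le_card hu; have a2 := card_le_card hi
    have a3 := hL'.cnt W (by omega); have a4 := hL'.cnt W' (by omega); have a5 := hL'.tot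
    unfold Tight; omega
  have h4 : 4 ≤ W.card := by
    by_contra hlt
    have hWc : cs = W := eq_of_subset_of_card_le hcsW (by omega)
    have hbC : M.bd C = C := by
      apply Subset.antisymm (filter_subset _ _)
      intro d hd
      rcases tri_pairs hC (hWc ▸ F1 d hd : _ ∈ cs) (hWc ▸ F2 d hd : _ ∈ cs) with h | h
      · exact h
      · rw [mem_bd, M.ττ] at h; exact absurd hd h.2
    have hE := (tri_ψ hC.1 hbC (by rw [← hbC]; exact hC.2.2) hdC').2
    refine hns ⟨dC, fun d' => ⟨fun h => ?_, fun h => reg_sameCycle hC.1 h hdC'⟩⟩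
    rw [hE] at h; simp only [mem_insert, mem_singleton] at h
    rcases h with rfl | rfl | rfl
    · exact Equiv.Perm.SameCycle.refl _ _
    · exact ⟨1, by simp⟩
    · exact ⟨2, by rfl⟩
  refine ⟨L', W, C, hL', hs', hWt, by omega, ?_, Or.inr ⟨hC, hns, h4, fun P h1 h2 h3 => hP P h1 h2 fun d hd => Or.inl (h3 d hd)⟩, ?_⟩
  · intro T hT hTW
    rcases hP (T \ C) (hT.1.sdiff hC.1) sdiff_disjoint (fun d hd => by
      rw [mem_bd, mem_sdiff, mem_sdiff] at hd
      by_cases h : M.τ d ∈ C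
      · exact Or.inr h
      · have : d ∈ M.bd T := mem_bd.2 ⟨hd.1.1, by tauto⟩
        exact Or.inl ⟨hTW d this, reg_bd_head hT.1 hTW d this⟩) with h | h
    · rw [sdiff_eq_empty_iff_subset] at h
      by_contra hcon
      push Not at hcon
      have := hmin T ⟨hT, hcon.1⟩
      exact hcon.2 (eq_of_subset_of_card_le h this)
    · have : M.o ∈ T \ C := by rw [h, mem_compl]; exact hC.2.1
      exact absurd (mem_sdiff.1 this).1 hT.2.1
  · -- lifting
    have main : ∀ d, M.e d ∉ (M.bd C).image M.e → M.tail d ∈ W → M.head d ∈ W → M.tail d ∉ cs →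
      (∀ Z, Tight L' Z → M.tail d ∈ Z → M.head d ∈ Z → 3 ≤ Z.card → Tight L' (Z ∩ W) ∧ 3 ≤ (Z ∩ W).card) ∧
      ∀ d1 d2, M.tail d1 = M.tail d → M.tail d2 = M.head d → M.head d1 = M.head d2 → M.head d1 ∈ W := by
      intro d _ h1 h2 h3
      refine ⟨?_, fun d1 d2 k1 k2 k3 => hadj d1 (k1 ▸ h1) (k1 ▸ h3)⟩
      intro Z hZ z1 z2 z3
      have hp : ({M.tail d, M.head d} : Finset V) ⊆ Z ∩ W := by
        intro x; simp only [mem_insert, mem_singleton, mem_inter]; rintro (rfl | rfl) <;> exact ⟨by assumption, by assumption⟩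
      have hc2 := card_le_card hp
      rw [card_pair (M.ne_head d)] at hc2
      refine ⟨(hL'.inter_union hZ hWt hc2).1, ?_⟩
      by_contra hlt
      have hZW : ({M.tail d, M.head d} : Finset V) = Z ∩ W :=
        eq_of_subset_of_card_le hp (by rw [card_pair (M.ne_head d)]; omega)
      have hsub : L' ∩ Z.sym2 ⊆ insert (M.e d) (L' ∩ (Z.erase (M.tail d)).sym2) := by
        intro x hx
        rw [mem_inter] at hx
        obtain ⟨d', rfl⟩ := hs' x hx.1
        have gen : ∀ d', M.tail d' = M.tail d → M.head d' ∈ Z → d' = d := by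
          intro d' e1 e2
          have : M.head d' ∈ Z ∩ W := mem_inter.2 ⟨e2, hadj d' (e1 ▸ h1) (e1 ▸ h3)⟩
          rw [← hZW] at this; simp only [mem_insert, mem_singleton] at this
          rcases this with h | h
          · exact absurd (e1.trans h.symm) (M.ne_head d')
          · exact M.eq_of _ _ e1 h
        have hx2 := hx.2
        rw [e_mem] at hx2
        rw [mem_insert, mem_inter, e_mem, mem_erase, mem_erase]
        by_cases e1 : M.tail d' = M.tail d
        · left; rw [gen d' e1 hx2.2]
        by_cases e2 : M.head d' = M.tail d
        · left; rw [← gen (M.τ d') e2 (by rw [head_τ]; exact hx2.1), M.e_τ]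
        · right; exact ⟨hx.1, ⟨e1, hx2.1⟩, e2, hx2.2⟩
      have a1 := (card_le_card hsub).trans (card_insert_le _ _)
      have a2 := hL'.cnt (Z.erase (M.tail d)) (by rw [card_erase_of_mem z1]; omega)
      rw [card_erase_of_mem z1] at a2
      unfold Tight at hZ; omega
    intro d h h1 h2
    by_cases h3 : M.tail d ∈ cs
    · by_cases h4 : M.head d ∈ cs
      · exfalso; apply h
        rcases tri_pairs hC h3 h4 with k | k
        · exact mem_image_of_mem _ k
        · rw [← M.e_τ]; exact mem_image_of_mem _ k
      · have := main (M.τ d) (by rwa [M.e_τ]) (by rwa [tail_τ]) (by rwa [head_τ]) (by rwa [tail_τ])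
        rw [tail_τ, head_τ] at this
        exact ⟨fun Z a b c => this.1 Z a c b, fun d1 d2 a b c => c ▸ this.2 d2 d1 b a c.symm⟩
    · exact main d h h1 h2 h3

end PMap
end PTri

namespace PTri
open Finset
set_option linter.all false
namespace PMap
variable {V D : Type} [Fintype V] [DecidableEq V] [Fintype D] [DecidableEq D] {M : PMap V D}
variable {L : Finset (Sym2 V)} {W Z : Finset V} {C : Finset D}

structure FT (M : PMap V D) (L : Finset (Sym2 V)) (d : D) : Prop where
  p3 : M.ψ (M.ψ (M.ψ d)) = d
  out : ¬ M.ψ.SameCycle d M.o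
  e1 : M.e d ∈ L
  e2 : M.e (M.ψ d) ∈ L
  e3 : M.e (M.ψ (M.ψ d)) ∈ L

lemma head_p3 {d : D} (h : M.ψ (M.ψ (M.ψ d)) = d) : M.head d = M.tail (M.ψ (M.ψ d)) := by
  conv_lhs => rw [← h, head_ψ]

lemma FT.rot {d : D} (h : FT M L d) : FT M L (M.ψ d) :=
  ⟨by rw [h.p3], fun k => h.out ((Equiv.Perm.sameCycle_apply_left).1 k), h.e2, h.e3, by rw [h.p3]; exact h.e1⟩

lemma reg_orb3 {d : D} (h : M.ψ (M.ψ (M.ψ d)) = d) : M.Reg {d, M.ψ d, M.ψ (M.ψ d)} := by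
  intro z
  simp only [mem_insert, mem_singleton, EmbeddingLike.apply_eq_iff_eq]
  constructor
  · rintro (k | k | k)
    · right; right; apply M.ψ.injective; rw [k, h]
    · exact Or.inl k
    · exact Or.inr (Or.inl k)
  · rintro (rfl | rfl | rfl)
    · simp
    · simp
    · simp [h]

lemma single_orb3 {d : D} (h : M.ψ (M.ψ (M.ψ d)) = d) : M.Single {d, M.ψ d, M.ψ (M.ψ d)} := by
  refine ⟨d, fun d' => ⟨fun k => ?_, fun k => reg_sameCycle (reg_orb3 h) k (by simp)⟩⟩
  simp only [mem_insert, mem_singleton] at k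
  rcases k with rfl | rfl | rfl
  · exact Equiv.Perm.SameCycle.refl _ _
  · exact ⟨1, by simp⟩
  · exact ⟨2, by rfl⟩

lemma not_both (S : Setting M L W C) (hV : 3 ≤ Fintype.card V) {d : D} (h : FT M L d)
    (h1 : M.e d ∈ (M.bd C).image M.e) (h2 : M.e (M.ψ d) ∈ (M.bd C).image M.e) : False := by
  classical
  rcases S.hC with rfl | ⟨hC, hns, -, -⟩
  · simp [bd] at h1
  have hcs : ∀ z, M.e z ∈ (M.bd C).image M.e → M.tail z ∈ (M.bd C).image M.tail ∧ M.head z ∈ (M.bd C).image M.tail := by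
    intro z hz
    obtain ⟨b, hb, hbz⟩ := mem_image.1 hz
    have t1 : M.tail b ∈ (M.bd C).image M.tail := mem_image_of_mem _ hb
    have t2 : M.head b ∈ (M.bd C).image M.tail :=
      reg_bd_head (W := fun v => v ∈ (M.bd C).image M.tail) hC.1 (fun d hd => mem_image_of_mem _ hd) b hb
    rcases M.e_eq hbz with rfl | rfl
    · exact ⟨t1, t2⟩
    · rw [head_τ] at t2; exact ⟨t2, t1⟩
  have hp : ∀ z, M.tail z ∈ (M.bd C).image M.tail → M.head z ∈ (M.bd C).image M.tail → M.e z ∈ (M.bd C).image M.e := by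
    intro z a b
    rcases tri_pairs hC a b with k | k
    · exact mem_image_of_mem _ k
    · rw [← M.e_τ]; exact mem_image_of_mem _ k
  have h3 : M.e (M.ψ (M.ψ d)) ∈ (M.bd C).image M.e := by
    refine hp _ ?_ ?_
    · rw [← head_p3 h.p3]; exact (hcs _ h1).2
    · rw [head_ψ]; exact (hcs _ h2).1
  obtain ⟨T, hT⟩ : ∃ T : Finset D, T = {d, M.ψ d, M.ψ (M.ψ d)} := ⟨_, rfl⟩
  have hTr : M.Reg T := hT ▸ reg_orb3 h.p3
  have hTs : M.Single T := hT ▸ single_orb3 h.p3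
  have hdT : d ∈ T := by simp [hT]
  have hso : ∀ z ∈ T, M.τ z ∉ T := by
    intro z hz hc
    obtain ⟨S', hS, k1, k2⟩ := nb S.lam S.sub hV z
    obtain ⟨d0, h0⟩ := hTs
    exact k2 (reg_sameCycle hS (((h0 z).1 hz).symm.trans ((h0 _).1 hc)) k1)
  have hbT : M.bd T = T := by ext z; rw [mem_bd]; exact ⟨fun k => k.1, fun k => ⟨k, hso z k⟩⟩
  have hoT : M.o ∉ T := fun k => by
    obtain ⟨d0, h0⟩ := hTs
    exact h.out (((h0 d).1 hdT).symm.trans ((h0 _).1 k))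
  have hT3 : 3 ≤ T.card := by
    have := (hTr.three (d := d) (by rw [hbT]; exact hdT)).1; rwa [hbT] at this
  have hinj : Set.InjOn M.e T := by
    intro a ha b hb hab
    rcases M.e_eq hab with k | k
    · exact k
    · exact absurd (k ▸ ha) (hso b hb)
  have hTe : ∀ z ∈ T, M.e z ∈ (M.bd C).image M.e := by
    intro z hz; rw [hT] at hz; simp only [mem_insert, mem_singleton] at hz
    rcases hz with rfl | rfl | rfl
    exacts [h1, h2, h3]
  have himg : T.image M.e = (M.bd C).image M.e := by
    refine eq_of_subset_of_card_le (image_subset_iff.2 hTe) ?_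
    rw [card_image_of_injOn hinj]; exact card_image_le.trans (hC.2.2.le.trans hT3)
  have hCx : ∀ z, M.e z ∈ (M.bd C).image M.e → (z ∈ C ↔ M.τ z ∉ C) := by
    intro z hz
    obtain ⟨b, hb, hbz⟩ := mem_image.1 hz
    rw [mem_bd] at hb
    rcases M.e_eq hbz with rfl | rfl
    · tauto
    · rw [M.ττ] at hb; tauto
  have hTx : ∀ z, M.e z ∈ (M.bd C).image M.e → (z ∈ T ↔ M.τ z ∉ T) := by
    intro z hz
    rw [← himg] at hz
    obtain ⟨b, hb, hbz⟩ := mem_image.1 hz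
    have := hso b hb
    rcases M.e_eq hbz with rfl | rfl
    · tauto
    · rw [M.ττ] at this; tauto
  have hd : M.bd (symmDiff T C) = ∅ := by
    refine eq_empty_iff_forall_notMem.2 fun y hy => ?_
    rw [mem_bd, mem_symmDiff, mem_symmDiff] at hy
    by_cases he : M.e y ∈ (M.bd C).image M.e
    · have := hCx y he; have := hTx y he; tauto
    · have k1 : ¬ (y ∈ T ∧ M.τ y ∉ T) := fun k => he (himg ▸ mem_image_of_mem _ k.1)
      have k2 : ¬ (y ∈ C ∧ M.τ y ∉ C) := fun k => he (mem_image_of_mem _ (mem_bd.2 k))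
      have k3 : ¬ (M.τ y ∈ T ∧ y ∉ T) := fun k => he (by
        rw [← M.e_τ]; exact himg ▸ mem_image_of_mem _ k.1)
      have k4 : ¬ (M.τ y ∈ C ∧ y ∉ C) := fun k => he (by
        rw [← M.e_τ]; exact mem_image_of_mem _ (mem_bd.2 (by rwa [M.ττ])))
      tauto
  rcases (hTr.symmDiff hC.1).const S.lam S.sub hd with k | k
  · rw [← Finset.bot_eq_empty, symmDiff_eq_bot] at k
    exact hns (k ▸ hTs)
  · have := mem_univ M.o; rw [← k, mem_symmDiff] at this
    have := hC.2.1; tauto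

structure Cand (M : PMap V D) (L : Finset (Sym2 V)) (W : Finset V) (C : Finset D) (d : D) : Prop where
  ft : FT M L d
  t1 : M.tail d ∈ W
  t2 : M.tail (M.ψ d) ∈ W
  t3 : M.tail (M.ψ (M.ψ d)) ∈ W
  nB : M.e (M.ψ d) ∉ (M.bd C).image M.e

structure Blk (M : PMap V D) (L : Finset (Sym2 V)) (W : Finset V) (d : D) (Z : Finset V) : Prop where
  ti : Tight L Z
  su : Z ⊆ W
  t1 : M.tail d ∈ Z
  t2 : M.tail (M.ψ d) ∈ Z
  t3 : M.tail (M.ψ (M.ψ d)) ∉ Z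
  c3 : 3 ≤ Z.card

lemma clC (S : Setting M L W C) (hZ : Tight L Z) (hZW : Z ⊆ W) (h3 : 3 ≤ Z.card) {q : D}
    (h : M.cl (L ∩ Z.sym2) q = C) : Z.card = 3 ∧ 4 ≤ W.card ∧ M.Tri C ∧ (M.bd C).image M.tail ⊆ Z := by
  have hq : q ∈ C := h ▸ self_cl q
  obtain ⟨hC, -, h4, hP⟩ := S.hC.resolve_left (fun k => by rw [k] at hq; simp at hq)
  have hb : ∀ q', ∀ d ∈ M.bd (M.cl (L ∩ Z.sym2) q'), M.tail d ∈ Z ∧ M.head d ∈ Z := fun q' d hd =>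
    (M.e_mem d).1 (mem_inter.1 (bd_cl hd)).2
  refine ⟨?_, h4, hC, ?_⟩
  · refine le_antisymm (two_cls S.lam S.sub hZ C fun d => ?_) h3
    by_cases hd : d ∈ C
    · left; rw [← h] at hd ⊢; exact cl_eq hd
    · right
      refine (hP _ (reg_cl d) ?_ fun z hz => ⟨hZW (hb d z hz).1, hZW (hb d z hz).2⟩).resolve_left
        (ne_empty_of_mem (self_cl d))
      rw [disjoint_left]; intro z hz hzC
      rw [← h] at hzC; apply hd; rw [← h, ← cl_eq hzC, cl_eq hz]; exact self_cl d
  · intro v hv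
    obtain ⟨d, hd, rfl⟩ := mem_image.1 hv
    rw [← h] at hd; exact (hb q d hd).1

lemma find (S : Setting M L W C) (hV : 3 ≤ Fintype.card V) (hZ : Tight L Z) (hZW : Z ⊆ W) (h3 : 3 ≤ Z.card) (d : D)
    (h : (M.bd (M.cl (L ∩ Z.sym2) d)).card ≠ 3 ∨ d ∈ M.cl (L ∩ Z.sym2) M.o)
    (hne : ∀ q, M.cl (L ∩ Z.sym2) q ≠ C) :
    ∃ q, FT M L q ∧ M.tail q ∈ Z ∧ M.tail (M.ψ q) ∈ Z ∧ M.tail (M.ψ (M.ψ q)) ∈ Z := by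
  obtain ⟨q, -, q2, q3⟩ := cls_select S.lam S.sub hZ h3 d M.o h
  obtain ⟨T, hT⟩ : ∃ T, T = M.cl (L ∩ Z.sym2) q := ⟨_, rfl⟩
  have hb : ∀ d ∈ M.bd T, M.e d ∈ L ∧ M.tail d ∈ Z := fun d hd => by
    rw [hT] at hd
    have := mem_inter.1 (bd_cl hd); exact ⟨this.1, ((M.e_mem d).1 this.2).1⟩
  have ho : M.o ∉ T := fun k => q2 (by rw [hT] at k; rw [cl_eq k]; exact self_cl q)
  have hqT : q ∈ T := hT ▸ self_cl q
  have hTr : M.Tri T := ⟨hT ▸ reg_cl q, ho, by rw [hT]; exact q3⟩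
  rcases S.h1 T hTr (fun d hd => hZW (hb d hd).2) with k | k
  · obtain ⟨k1, k2⟩ := single_tri S.lam S.sub hV hTr k
    rw [k1] at hb
    obtain ⟨a, b⟩ := tri_ψ hTr.1 k1 k2 hqT
    have m1 : M.ψ q ∈ T := (hTr.1 _).2 hqT
    have m2 : M.ψ (M.ψ q) ∈ T := (hTr.1 _).2 m1
    exact ⟨q, ⟨a, fun hc => ho (reg_sameCycle hTr.1 hc hqT), (hb _ hqT).1, (hb _ m1).1, (hb _ m2).1⟩,
      (hb _ hqT).2, (hb _ m1).2, (hb _ m2).2⟩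
  · exact absurd (hT ▸ k) (hne q)

lemma two_cand (S : Setting M L W C) (hV : 3 ≤ Fintype.card V) (hZW : Z ⊆ W)
    (h : ∃ q, FT M L q ∧ M.tail q ∈ Z ∧ M.tail (M.ψ q) ∈ Z ∧ M.tail (M.ψ (M.ψ q)) ∈ Z) :
    ∃ q, Cand M L W C q ∧ Cand M L W C (M.ψ q) ∧ M.tail q ∈ Z ∧ M.tail (M.ψ q) ∈ Z ∧ M.tail (M.ψ (M.ψ q)) ∈ Z := by
  obtain ⟨q, f, a, b, c⟩ := h
  have key : ∀ q, FT M L q → M.tail q ∈ Z → M.tail (M.ψ q) ∈ Z → M.tail (M.ψ (M.ψ q)) ∈ Z →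
      M.e (M.ψ q) ∉ (M.bd C).image M.e → M.e (M.ψ (M.ψ q)) ∉ (M.bd C).image M.e →
      Cand M L W C q ∧ Cand M L W C (M.ψ q) ∧ M.tail q ∈ Z ∧ M.tail (M.ψ q) ∈ Z ∧ M.tail (M.ψ (M.ψ q)) ∈ Z :=
    fun q f a b c h1 h2 => ⟨⟨f, hZW a, hZW b, hZW c, h1⟩, ⟨f.rot, hZW b, hZW c, by rw [f.p3]; exact hZW a, h2⟩, a, b, c⟩
  have n1 := not_both S hV f
  have n2 := not_both S hV f.rot
  have n3 := not_both S hV f.rot.rot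
  rw [f.p3] at n3
  by_cases h1 : M.e q ∈ (M.bd C).image M.e
  · exact ⟨q, key q f a b c (n1 h1) (fun k => n3 k h1)⟩
  by_cases h2 : M.e (M.ψ q) ∈ (M.bd C).image M.e
  · exact ⟨M.ψ q, key _ f.rot b c (by rwa [f.p3]) (n2 h2) (by rwa [f.p3])⟩
  exact ⟨_, key _ f.rot.rot c (by rwa [f.p3]) (by rwa [f.p3]) (by rwa [f.p3]) (by rwa [f.p3])⟩

lemma unblocked (S : Setting M L W C) (hV : 3 ≤ Fintype.card V) : ∃ d, Cand M L W C d ∧ ∀ Z, ¬ Blk M L W d Z := by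
  classical
  by_contra hcon
  push Not at hcon
  have h0 : ∃ d, Cand M L W C d := by
    obtain ⟨q, hq, -⟩ := two_cand S hV (subset_refl _) (find S hV S.tight (subset_refl _) S.three M.o (Or.inr (self_cl _))
      fun q hq => by
        have := clC S S.tight (subset_refl _) S.three hq; omega)
    exact ⟨q, hq⟩
  have hmax : ∀ d, ∃ Z, Cand M L W C d → Blk M L W d Z ∧ ∀ Z', Blk M L W d Z' → Z'.card ≤ Z.card := by
    intro d
    by_cases hd : Cand M L W C d
    · obtain ⟨Z0, hZ0⟩ := hcon d hd
      obtain ⟨Z, hZ, hm⟩ := exists_max_image (Finset.univ.filter (Blk M L W d)) Finset.card ⟨Z0, by simpa using hZ0⟩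
      simp only [mem_filter, mem_univ, true_and] at hZ hm
      exact ⟨Z, fun _ => ⟨hZ, hm⟩⟩
    · exact ⟨∅, fun k => absurd k hd⟩
  choose Zm hZm using hmax
  obtain ⟨d, hd, hmin⟩ := exists_min_image (Finset.univ.filter (Cand M L W C)) (fun d => (Zm d).card)
    (by obtain ⟨d, hd⟩ := h0; exact ⟨d, by simpa using hd⟩)
  simp only [mem_filter, mem_univ, true_and] at hd hmin
  obtain ⟨hB, hBm⟩ := hZm d hd
  obtain ⟨Z, hZ⟩ : ∃ Z, Z = Zm d := ⟨_, rfl⟩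
  rw [← hZ] at hB hBm
  have hne : ∀ q, M.cl (L ∩ Z.sym2) q ≠ C := fun q hq => by
    obtain ⟨a, -, b, c⟩ := clC S hB.ti hB.su hB.c3 hq
    have hdb : ∃ d, d ∈ M.bd C := card_pos.1 (by rw [b.2.2]; norm_num)
    obtain ⟨d1, k1⟩ := hdb
    obtain ⟨d2, d3, hE, -, -, -, t1, t2, t3⟩ := (b.1.three k1).2 b.2.2
    have : (M.bd C).image M.tail = Z := by
      refine eq_of_subset_of_card_le c ?_
      rw [a, hE]
      simp only [image_insert, image_singleton]
      rw [card_insert_of_notMem, card_insert_of_notMem, card_singleton]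
      · rw [mem_singleton, ← t2]; exact M.ne_head _
      · rw [mem_insert, mem_singleton, ← t1, ← t3]; push Not; refine ⟨?_, (M.ne_head _).symm⟩
        rw [t3]; exact M.ne_head _
    refine hd.nB ?_
    rcases tri_pairs (d := M.ψ d) b (by rw [this]; exact hB.t2) (by rw [this, head_ψ]; exact hB.t1) with k | k
    · exact mem_image_of_mem _ k
    · rw [← M.e_τ]; exact mem_image_of_mem _ k
  have hfind := find S hV hB.ti hB.su hB.c3 d (by
    by_contra hc; push Not at hc
    obtain ⟨T, hT⟩ : ∃ T, T = M.cl (L ∩ Z.sym2) d := ⟨_, rfl⟩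
    have hb : ∀ d ∈ M.bd T, M.tail d ∈ Z ∧ M.head d ∈ Z := fun d hd => by
      rw [hT] at hd
      exact ((M.e_mem d).1 (mem_inter.1 (bd_cl hd)).2)
    have hTr : M.Tri T := ⟨hT ▸ reg_cl d, fun k => hc.2 (by rw [hT] at k; rw [cl_eq k]; exact self_cl d), by rw [hT]; exact hc.1⟩
    rcases S.h1 T hTr (fun d hd => hB.su (hb d hd).1) with k | k
    · have := (single_tri S.lam S.sub hV hTr k).1
      have hdT : d ∈ M.bd T := by rw [this, hT]; exact self_cl d
      exact hB.t3 (by rw [← head_p3 hd.ft.p3]; exact (hb d hdT).2)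
    · exact hne d (hT ▸ k)) hne
  obtain ⟨q, hq1, hq2, ta, tb, tc⟩ := two_cand S hV hB.su hfind
  have claim : ∀ q, Cand M L W C q → M.tail q ∈ Z → M.tail (M.ψ q) ∈ Z → M.tail (M.ψ (M.ψ q)) ∈ Z →
      M.tail (M.ψ (M.ψ d)) ∈ Zm q := by
    intro q hq ta tb tc
    by_contra hx
    obtain ⟨b1, -⟩ := hZm q hq
    have hne' : M.tail q ≠ M.tail (M.ψ q) := by rw [← M.head_ψ q]; exact (M.ne_head _).symm
    have h2 : 2 ≤ (Z ∩ Zm q).card := by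
      rw [← card_pair hne']; exact card_le_card (by
        intro v hv; simp only [mem_insert, mem_singleton] at hv
        rcases hv with rfl | rfl
        · exact mem_inter.2 ⟨ta, b1.t1⟩
        · exact mem_inter.2 ⟨tb, b1.t2⟩)
    have hu := (S.lam.inter_union hB.ti b1.ti h2).2.1
    have hle := hBm _ ⟨hu, union_subset hB.su b1.su, mem_union_left _ hB.t1, mem_union_left _ hB.t2,
      by rw [mem_union]; push Not; exact ⟨hB.t3, hx⟩, hB.c3.trans (card_le_card subset_union_left)⟩
    have he := eq_of_subset_of_card_le (subset_union_left (s₁ := Z) (s₂ := Zm q)) hle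
    have hsub : Zm q ⊂ Z := by
      refine ⟨by rw [he]; exact subset_union_right, fun k => b1.t3 (k tc)⟩
    have := card_lt_card hsub
    have := hmin q hq
    rw [← hZ] at this; omega
  have c1 := claim q hq1 ta tb tc
  have c2 := claim _ hq2 tb tc (by rwa [hq1.ft.p3])
  obtain ⟨b1, -⟩ := hZm _ hq1
  obtain ⟨b2, -⟩ := hZm _ hq2
  have hb3 := b2.t3
  rw [hq1.ft.p3] at hb3
  have h2 : 2 ≤ (Zm q ∩ Zm (M.ψ q)).card := by
    rw [← card_pair (show M.tail (M.ψ (M.ψ d)) ≠ M.tail (M.ψ q) from fun k => hB.t3 (k ▸ tb))]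
    exact card_le_card (by
      intro v hv; simp only [mem_insert, mem_singleton] at hv
      rcases hv with rfl | rfl
      · exact mem_inter.2 ⟨c1, c2⟩
      · exact mem_inter.2 ⟨b1.t2, b2.t1⟩)
  have := (S.lam.inter_union b1.ti b2.ti h2).2.2 (M.e q) hq1.ft.e1 ((M.e_mem q).2
    ⟨mem_union_left _ b1.t1, mem_union_right _ (by rw [head_p3 hq1.ft.p3]; exact b2.t2)⟩)
  rcases this with k | k
  · have := ((M.e_mem q).1 k).2; rw [head_p3 hq1.ft.p3] at this; exact b1.t3 this
  · exact hb3 ((M.e_mem q).1 k).1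

structure Sel (M : PMap V D) (L : Finset (Sym2 V)) (d : D) : Prop where
  lam : Laman L
  sub : M.Sub L
  ft : FT M L d
  noblock : ∀ Z, Tight L Z → M.tail d ∈ Z → M.tail (M.ψ d) ∈ Z → M.tail (M.ψ (M.ψ d)) ∉ Z → ¬ 3 ≤ Z.card
  common : ∀ d1 d2, M.tail d1 = M.tail d → M.tail d2 = M.tail (M.ψ d) → M.head d1 = M.head d2 →
    M.head d1 ≠ M.tail (M.ψ (M.ψ d)) → FT M {M.e (M.σ d), M.e (M.ψ (M.σ d)), M.e (M.ψ (M.ψ (M.σ d)))} (M.σ d) ∧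
      M.tail (M.ψ (M.σ d)) = M.head d1

lemma select (hL : Laman L) (hs : M.Sub L) (hV : 3 ≤ Fintype.card V) : ∃ L' d, Sel M L' d := by
  classical
  obtain ⟨L, W, C, S⟩ := setting_exists hL hs hV
  obtain ⟨d, hd, hu⟩ := unblocked S hV
  have hl := S.lift (M.ψ d) hd.nB hd.t2 (by rw [head_ψ]; exact hd.t1)
  refine ⟨L, d, S.lam, S.sub, hd.ft, ?_, ?_⟩
  · intro Z hZ a b c h3
    obtain ⟨k1, k2⟩ := hl.1 Z hZ b (by rwa [head_ψ]) h3
    exact hu (Z ∩ W) ⟨k1, inter_subset_right, mem_inter.2 ⟨a, hd.t1⟩, mem_inter.2 ⟨b, hd.t2⟩,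
      fun k => c (mem_inter.1 k).1, k2⟩
  intro d1 d2 t1 t2 hh hx
  have hyW : M.head d1 ∈ W := hh ▸ hl.2 d2 d1 t2 (by rw [t1, head_ψ]) hh.symm
  have n1 := M.ne_head d1
  have n2 := M.ne_head d2
  have n3 := M.ne_head (M.ψ d)
  have hψ := M.head_ψ d
  set f : D → ZMod 2 := fun z => (if z = d1 ∨ z = M.τ d1 then 1 else 0) + (if z = d2 ∨ z = M.τ d2 then 1 else 0)
    + (if z = M.ψ d ∨ z = M.τ (M.ψ d) then 1 else 0) with hf
  have hor : ∀ z y : D, (M.τ z = y ∨ M.τ z = M.τ y) ↔ (z = y ∨ z = M.τ y) := fun z y => by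
    rw [M.τ_eq, M.τ_eq, M.ττ, or_comm]
  obtain ⟨T, hT, ho, hfT⟩ := M.reg_of_even f (fun z => by simp only [hf, hor]) (fun v => by
    simp only [hf, sum_add_distrib, M.sum_pair_even]
    rw [t1, t2, hψ, hh]
    generalize (if v = M.tail d then (1 : ZMod 2) else 0) = a
    generalize (if v = M.tail (M.ψ d) then (1 : ZMod 2) else 0) = b
    generalize (if v = M.head d2 then (1 : ZMod 2) else 0) = c
    revert a b c; decide)
  have hin : ∀ z, f z = 1 → (z = d1 ∨ z = M.τ d1) ∨ (z = d2 ∨ z = M.τ d2) ∨ (z = M.ψ d ∨ z = M.τ (M.ψ d)) := by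
    intro z hz; by_contra hc; push Not at hc
    simp only [hf] at hz
    rw [if_neg (by tauto), if_neg (by tauto), if_neg (by tauto)] at hz
    revert hz; decide
  have hbd : ∀ z ∈ M.bd T, f z = 1 := fun z hz => by
    rw [mem_bd] at hz; rw [hfT]; tauto
  have hψ1 : f (M.ψ d) = 1 := by
    simp only [hf]
    rw [if_neg, if_neg, if_pos (by simp)]
    · simp
    · rintro (k | k)
      · exact n1 (by rw [t1, ← hψ, k, hh])
      · have := congrArg M.tail k; rw [tail_τ, ← t2] at this; exact n2 this
    · rintro (k | k)
      · exact n3 (by rw [k]; rw [hψ, ← t1] at n3; exact absurd (congrArg M.tail k) n3)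
      · have := congrArg M.tail k; rw [tail_τ, ← t2, hh] at this; exact n2 this
  have hψT := (hfT _).1 hψ1
  have hmem : M.ψ d ∈ M.bd T ∨ M.τ (M.ψ d) ∈ M.bd T := by rw [mem_bd, mem_bd, M.ττ]; tauto
  have hinj : Set.InjOn M.e (M.bd T) := by
    intro a ha b hb hab
    rcases M.e_eq hab with k | k
    · exact k
    · exact absurd (k ▸ ha) (bd_disj hb)
  have hcard : (M.bd T).card = 3 := by
    refine le_antisymm ?_ (hmem.elim (fun k => (hT.three k).1) (fun k => (hT.three k).1))
    rw [← card_image_of_injOn hinj]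
    refine (card_le_card (t := {M.e d1, M.e d2, M.e (M.ψ d)}) (image_subset_iff.2 fun z hz => ?_)).trans card_le_three
    simp only [mem_insert, mem_singleton]
    rcases hin z (hbd z hz) with (rfl | rfl) | (rfl | rfl) | (rfl | rfl) <;> simp [e_τ]
  have hTr : M.Tri T := ⟨hT, ho, hcard⟩
  have hTW : ∀ z ∈ M.bd T, M.tail z ∈ W := by
    intro z hz
    rcases hin z (hbd z hz) with (rfl | rfl) | (rfl | rfl) | (rfl | rfl)
    · rw [t1]; exact hd.t1
    · exact hyW
    · rw [t2]; exact hd.t2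
    · rw [tail_τ, ← hh]; exact hyW
    · exact hd.t2
    · rw [tail_τ, hψ]; exact hd.t1
  rcases S.h1 T hTr hTW with k | k
  swap
  · exfalso; rw [k] at hmem
    rcases hmem with h | h
    · exact hd.nB (mem_image_of_mem _ h)
    · exact hd.nB (by rw [← M.e_τ]; exact mem_image_of_mem _ h)
  obtain ⟨hb, hc⟩ := single_tri S.lam S.sub hV hTr k
  rw [hb] at hmem hbd
  have hx' := head_p3 hd.ft.p3
  have nx : M.tail (M.ψ (M.ψ d)) ≠ M.tail (M.ψ d) := by rw [← M.head_ψ (M.ψ d)]; exact M.ne_head _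
  have hσT : M.σ d ∈ T := by
    rcases hmem with h | h
    · exfalso
      have hdT : d ∈ T := by rw [← hd.ft.p3]; exact (hT _).2 ((hT _).2 h)
      rcases hin d (hbd d hdT) with (h | h) | (h | h) | (h | h)
      · rw [← h] at hx; exact hx hx'
      · rw [h, tail_τ] at t1; exact M.ne_head _ t1
      · rw [← h] at hh; exact hx (hh.trans hx')
      · have := congrArg M.head h; rw [head_τ, t2, hx'] at this; exact nx this
      · rw [← h] at hψ; exact M.ne_head d hψ.symm
      · have := congrArg M.head h; rw [head_τ, hx'] at this; exact nx this
    · rwa [ψ_apply, M.ττ] at h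
  obtain ⟨p3, hTe⟩ := tri_ψ hT hb hc hσT
  have ho' : ¬ M.ψ.SameCycle (M.σ d) M.o := fun hc => ho (reg_sameCycle hT hc hσT)
  refine ⟨⟨p3, ho', by simp, by simp, by simp⟩, ?_⟩
  have hm : M.ψ (M.σ d) ∈ T := (hT _).2 hσT
  have hhd : M.head (M.ψ (M.σ d)) = M.tail d := by rw [head_ψ, M.tail_σ]
  rcases hin _ (hbd _ hm) with (h | h) | (h | h) | (h | h)
  · rw [h, ← t1] at hhd; exact absurd hhd.symm n1
  · rw [h, tail_τ]
  · rw [h, ← hh, ← t1] at hhd; exact absurd hhd.symm n1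
  · rw [h, tail_τ, hh]
  · have := M.ψ.injective h
    have h5 := congrArg M.head this
    rw [head, ← ψ_apply, hx'] at h5; exact absurd h5.symm nx
  · have h6 := congrArg M.head h; rw [hhd, head_τ, ← hψ] at h6; exact absurd h6.symm n3

end PMap
end PTri

namespace PTri
open Finset
set_option linter.all false
open Classical in
/-- data for a contraction of the edge `uw` of the facial triangle `w,u,x` -/
structure CT {V D : Type} [Fintype D] [DecidableEq V] [Fintype V] [DecidableEq D] (M : PMap V D) where
  wx : D
  c3 : Prop
  p3 : M.ψ (M.ψ (M.ψ wx)) = wx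
  out : ¬ M.ψ.SameCycle wx M.o
  q3 : c3 → M.ψ (M.ψ (M.ψ (M.σ wx))) = M.σ wx
  qout : c3 → ¬ M.ψ.SameCycle (M.σ wx) M.o
  qx : c3 → M.tail (M.ψ (M.σ wx)) ≠ M.tail (M.ψ (M.ψ wx))
  com : ∀ d1 d2, M.tail d1 = M.tail wx → M.tail d2 = M.tail (M.ψ wx) → M.head d1 = M.head d2 →
    M.head d1 = M.tail (M.ψ (M.ψ wx)) ∨ (c3 ∧ M.head d1 = M.tail (M.ψ (M.σ wx)))
  nbr : ∀ d, ∃ T, M.Reg T ∧ d ∈ T ∧ M.τ d ∉ T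
namespace CT
variable {V D : Type} [Fintype V] [DecidableEq V] [Fintype D] [DecidableEq D] {M : PMap V D} (K : CT M)
def uw := M.ψ K.wx
def xu := M.ψ (M.ψ K.wx)
def wu := M.σ K.wx
def ux := M.σ K.uw
def xw := M.τ K.wx
def yw := M.ψ K.wu
def uy := M.ψ K.yw
def wy := M.σ K.wu
def yu := M.τ K.uy
def w := M.tail K.wx
def u := M.tail K.uw
def x := M.tail K.xu
def y := M.tail K.yw

structure Tab (K : CT M) : Prop where
  s1 : M.σ K.wx = K.wu
  s2 : M.σ K.uw = K.ux
  s3 : M.σ K.xu = K.xw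
  s4 : M.σ K.wu = K.wy
  s5 : M.σ K.yw = K.yu
  s6 : K.c3 → M.σ K.uy = K.uw
  t1 : M.τ K.wu = K.uw
  t1' : M.τ K.uw = K.wu
  t2 : M.τ K.ux = K.xu
  t2' : M.τ K.xu = K.ux
  t3 : M.τ K.xw = K.wx
  t3' : M.τ K.wx = K.xw
  t4 : M.τ K.wy = K.yw
  t4' : M.τ K.yw = K.wy
  t5 : M.τ K.yu = K.uy
  t5' : M.τ K.uy = K.yu
  a1 : M.tail K.wx = K.w
  a2 : M.tail K.wu = K.w
  a3 : M.tail K.wy = K.w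
  a4 : M.tail K.uw = K.u
  a5 : M.tail K.ux = K.u
  a6 : M.tail K.xu = K.x
  a7 : M.tail K.xw = K.x
  a8 : M.tail K.yw = K.y
  a9 : M.tail K.yu = K.y
  a10 : K.c3 → M.tail K.uy = K.u
  n1 : K.u ≠ K.w
  n2 : K.u ≠ K.x
  n3 : K.w ≠ K.x
  n4 : K.w ≠ K.y
  n5 : K.c3 → K.y ≠ K.u
  n6 : K.c3 → K.y ≠ K.x

lemma tab : Tab K := by
  have t1 : M.τ K.wu = K.uw := rfl
  have s2 : M.σ K.uw = K.ux := rfl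
  have t2 : M.τ K.ux = K.xu := rfl
  have t4 : M.τ K.wy = K.yw := rfl
  have s3 : M.σ K.xu = K.xw := by
    have := K.p3; rw [M.ψ_apply, M.τ_eq] at this; exact this
  have t5' : M.τ K.uy = K.yu := rfl
  have s5 : M.σ K.yw = K.yu := by rw [yu, uy, M.ψ_apply, M.ττ]
  have s6 : K.c3 → M.σ K.uy = K.uw := fun h => by
    have := K.q3 h; rw [M.ψ_apply, M.τ_eq] at this; exact this
  have hs := M.tail_σ
  have a2 : M.tail K.wu = K.w := hs _
  have a5 : M.tail K.ux = K.u := hs _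
  have a7 : M.tail K.xw = K.x := by rw [← s3]; exact hs _
  have a9 : M.tail K.yu = K.y := by rw [← s5]; exact hs _
  have nl := M.noloop
  refine ⟨rfl, s2, s3, rfl, s5, s6, t1, M.τ_eq.2 t1.symm, t2, M.τ_eq.2 t2.symm, M.ττ _, rfl, t4, M.τ_eq.2 t4.symm, M.ττ _, t5',
    rfl, a2, (hs _).trans a2, rfl, a5, rfl, a7, rfl, a9, fun h => by rw [← hs, s6 h]; rfl, ?_, ?_, ?_, ?_, ?_, ?_⟩
  · have := nl K.wu; rw [t1, a2] at this; exact this.symm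
  · have := nl K.ux; rw [t2, a5] at this; exact this
  · have := nl K.wx; exact fun h => this (h.trans a7.symm)
  · have := nl K.wy; rw [t4, wy, hs, a2] at this; exact this
  · intro h
    have := nl K.uy; rw [t5', a9, ← hs, s6 h] at this; exact this.symm
  · exact fun h => K.qx h

def Rem (e : D) : Prop := e = K.wx ∨ e = K.uw ∨ e = K.xu ∨ e = K.wu ∨ (K.c3 ∧ (e = K.uy ∨ e = K.yw))
open Classical in
noncomputable def rep (e : D) : D := if e = K.wx then K.ux else if e = K.xu then K.xw else
  if K.c3 ∧ e = K.uy then K.wy else if K.c3 ∧ e = K.yw then K.yu else e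

lemma rep_wx : K.rep K.wx = K.ux := by simp [rep]
lemma xu_ne : K.xu ≠ K.wx := fun h => (tab K).n3 (by rw [← (tab K).a6, h]; rfl)
lemma rep_xu : K.rep K.xu = K.xw := by simp [rep, K.xu_ne]
lemma rep_uy (h : K.c3) : K.rep K.uy = K.wy := by
  have T := tab K
  have h1 : K.uy ≠ K.wx := fun e => T.n1 (by rw [← T.a10 h, e]; rfl)
  have h2 : K.uy ≠ K.xu := fun e => T.n2 (by rw [← T.a10 h, e]; rfl)
  simp [rep, h, h1, h2]
lemma rep_yw (h : K.c3) : K.rep K.yw = K.yu := by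
  have T := tab K
  have h1 : K.yw ≠ K.wx := fun e => T.n4 (by rw [← T.a8, e]; rfl)
  have h2 : K.yw ≠ K.xu := fun e => T.n6 h (by rw [← T.a8, e]; rfl)
  have h3 : K.yw ≠ K.uy := fun e => T.n5 h (by rw [← T.a8, e, T.a10 h])
  simp [rep, h, h1, h2, h3]
lemma rep_ret {e : D} (h : ¬ K.Rem e) : K.rep e = e := by
  simp only [Rem] at h; push Not at h
  simp only [rep]
  rw [if_neg h.1, if_neg h.2.2.1, if_neg (fun k => (h.2.2.2.2 k.1).1 k.2), if_neg (fun k => (h.2.2.2.2 k.1).2 k.2)]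

lemma nrem {e : D} : ¬ K.Rem e ↔ e ≠ K.wx ∧ e ≠ K.uw ∧ e ≠ K.xu ∧ e ≠ K.wu ∧ (K.c3 → e ≠ K.uy ∧ e ≠ K.yw) := by
  simp only [Rem]; push Not; rfl

/-- retained named darts -/
lemma ret_ux : ¬ K.Rem K.ux := by
  have T := tab K; rw [nrem]; grind [Tab]
lemma ret_xw : ¬ K.Rem K.xw := by
  have T := tab K; rw [nrem]; grind [Tab]
lemma ret_wy (h : K.c3) : ¬ K.Rem K.wy := by
  have T := tab K; rw [nrem]; grind [Tab]
lemma ret_yu (h : K.c3) : ¬ K.Rem K.yu := by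
  have T := tab K; rw [nrem]; grind [Tab]
lemma ret_rep {e : D} (h : e ≠ K.uw) (h' : e ≠ K.wu) : ¬ K.Rem (K.rep e) := by
  by_cases hr : K.Rem e
  · rcases hr with rfl | rfl | rfl | rfl | ⟨hc, rfl | rfl⟩
    · rw [rep_wx]; exact K.ret_ux
    · exact absurd rfl h
    · rw [rep_xu]; exact K.ret_xw
    · exact absurd rfl h'
    · rw [K.rep_uy hc]; exact K.ret_wy hc
    · rw [K.rep_yw hc]; exact K.ret_yu hc
  · rwa [K.rep_ret hr]

/-- tails up to identification of `u` with `w` -/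
def f (v : V) : {v // v ≠ K.u} := if h : v = K.u then ⟨K.w, (tab K).n1.symm⟩ else ⟨v, h⟩
lemma f_u : K.f K.u = ⟨K.w, (tab K).n1.symm⟩ := by simp [f]
lemma f_ne {v : V} (h : v ≠ K.u) : K.f v = ⟨v, h⟩ := by simp [f, h]
lemma f_w : K.f K.w = K.f K.u := by rw [f_u, f_ne]
lemma f_eq {a b : V} (h : K.f a = K.f b) : a = b ∨ (a = K.u ∧ b = K.w) ∨ (a = K.w ∧ b = K.u) := by
  by_cases h1 : a = K.u <;> by_cases h2 : b = K.u
  · exact Or.inl (h1.trans h2.symm)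
  · rw [h1, f_u, K.f_ne h2] at h; exact Or.inr (Or.inl ⟨h1, (congrArg Subtype.val h).symm⟩)
  · rw [h2, f_u, K.f_ne h1] at h; exact Or.inr (Or.inr ⟨congrArg Subtype.val h, h2⟩)
  · rw [K.f_ne h1, K.f_ne h2] at h; exact Or.inl (congrArg Subtype.val h)

lemma f_rep (e : D) : K.f (M.tail (K.rep e)) = K.f (M.tail e) := by
  have T := tab K
  by_cases hr : K.Rem e
  · rcases hr with rfl | rfl | rfl | rfl | ⟨hc, rfl | rfl⟩
    · rw [rep_wx, T.a1, T.a5, f_w]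
    · rw [rep, if_neg, if_neg, if_neg, if_neg] <;> grind [Tab]
    · rw [rep_xu, T.a6, T.a7]
    · rw [rep, if_neg, if_neg, if_neg, if_neg] <;> grind [Tab]
    · rw [K.rep_uy hc, T.a3, T.a10 hc, f_w]
    · rw [K.rep_yw hc, T.a8, T.a9]
  · rw [K.rep_ret hr]

/-- reversing -/
lemma rep_τ {e : D} (h : ¬ K.Rem e) : ¬ K.Rem (K.rep (M.τ e)) ∧ K.rep (M.τ (K.rep (M.τ e))) = e := by
  have T := tab K
  have h' := K.nrem.1 h
  have ne1 : M.τ e ≠ K.uw := fun k => h'.2.2.2.1 (by rw [M.τ_eq, T.t1'] at k; exact k)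
  have ne2 : M.τ e ≠ K.wu := fun k => h'.2.1 (by rw [M.τ_eq, T.t1] at k; exact k)
  refine ⟨K.ret_rep ne1 ne2, ?_⟩
  by_cases hr : K.Rem (M.τ e)
  · rcases hr with k | k | k | k | ⟨hc, k | k⟩
    · rw [k, rep_wx, T.t2, rep_xu]; rw [M.τ_eq] at k; exact k.symm
    · exact absurd k ne1
    · rw [k, rep_xu, T.t3, rep_wx, ← T.t2', ← k, M.ττ]
    · exact absurd k ne2
    · rw [k, K.rep_uy hc, T.t4, K.rep_yw hc, ← T.t5', ← k, M.ττ]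
    · rw [k, K.rep_yw hc, T.t5, K.rep_uy hc, ← T.t4', ← k, M.ττ]
  · rw [K.rep_ret hr, M.ττ, K.rep_ret h]

abbrev D' := {e : D // ¬ K.Rem e}
noncomputable def τ' : Equiv.Perm K.D' where
  toFun e := ⟨K.rep (M.τ e.1), (K.rep_τ e.2).1⟩
  invFun e := ⟨K.rep (M.τ e.1), (K.rep_τ e.2).1⟩
  left_inv e := Subtype.ext (K.rep_τ e.2).2
  right_inv e := Subtype.ext (K.rep_τ e.2).2

/-- face permutation with `wu` skipped -/
def ψ₀ : Equiv.Perm D := Equiv.swap K.wu (M.ψ K.wu) * M.ψ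
lemma ψ_wu : M.ψ K.wx = K.uw ∧ M.ψ K.uw = K.xu ∧ M.ψ K.xu = K.wx ∧ M.ψ K.wu = K.yw ∧ M.ψ K.yw = K.uy ∧ (K.c3 → M.ψ K.uy = K.wu) :=
  ⟨rfl, rfl, K.p3, rfl, rfl, K.q3⟩
lemma ψ_ne (d : D) : M.ψ d ≠ d := fun h => M.ne_head d (by conv_rhs => rw [← h, M.head_ψ])
lemma ψ₀_wu : K.ψ₀ K.wu = K.wu := by simp [ψ₀]
lemma ψ₀_eq {e : D} (h1 : e ≠ K.wu) (h2 : M.ψ e ≠ K.wu) : K.ψ₀ e = M.ψ e := by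
  rw [ψ₀, Equiv.Perm.mul_apply, Equiv.swap_apply_of_ne_of_ne h2 (fun h => h1 (M.ψ.injective h))]
lemma ψ₀_eq' {e : D} (h2 : M.ψ e = K.wu) : K.ψ₀ e = M.ψ K.wu := by
  rw [ψ₀, Equiv.Perm.mul_apply, h2, Equiv.swap_apply_left]

lemma rem_ψ (e : D) : K.Rem (K.ψ₀ e) ↔ K.Rem e := by
  have T := tab K
  have P := K.ψ_wu
  have hwu : ∀ z, z = K.wx ∨ z = K.uw ∨ z = K.xu → z ≠ K.wu := by grind [Tab]
  have h1 : K.ψ₀ K.wx = K.uw := by rw [K.ψ₀_eq] <;> grind [Tab]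
  have h2 : K.ψ₀ K.uw = K.xu := by rw [K.ψ₀_eq] <;> grind [Tab]
  have h3 : K.ψ₀ K.xu = K.wx := by rw [K.ψ₀_eq] <;> grind [Tab]
  have h4 := K.ψ₀_wu
  have h5 : K.c3 → K.ψ₀ K.yw = K.uy := fun h => by rw [K.ψ₀_eq] <;> grind [Tab]
  have h6 : K.c3 → K.ψ₀ K.uy = K.yw := fun h => by rw [K.ψ₀_eq' (P.2.2.2.2.2 h)]; exact P.2.2.2.1
  have inj := K.ψ₀.injective
  simp only [Rem]
  constructor
  · rintro (k | k | k | k | ⟨hc, k | k⟩)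
    · rw [← h3] at k; simp [inj k]
    · rw [← h1] at k; simp [inj k]
    · rw [← h2] at k; simp [inj k]
    · rw [← h4] at k; simp [inj k]
    · rw [← h5 hc] at k; simp [inj k, hc]
    · rw [← h6 hc] at k; simp [inj k, hc]
  · rintro (rfl | rfl | rfl | rfl | ⟨hc, rfl | rfl⟩) <;> simp [*]

def ψ' : Equiv.Perm K.D' := K.ψ₀.subtypePerm (fun e => not_congr (K.rem_ψ e))
noncomputable def σ' : Equiv.Perm K.D' := K.τ' * K.ψ'

lemma σ'_eq (e : K.D') (h : M.σ e.1 ≠ K.uw) : (K.σ' e).1 = K.rep (M.σ e.1) := by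
  have h' := K.nrem.1 e.2
  show K.rep (M.τ (K.ψ₀ e.1)) = _
  rw [K.ψ₀_eq h'.2.2.2.1, M.ψ_apply, M.ττ]
  rw [M.ψ_apply, ne_eq, M.τ_eq, (tab K).t1]; exact h
lemma σ'_eq' (e : K.D') (h : M.σ e.1 = K.uw) : (K.σ' e).1 = K.rep (M.σ K.wu) := by
  show K.rep (M.τ (K.ψ₀ e.1)) = _
  rw [K.ψ₀_eq' (by rw [M.ψ_apply, h, (tab K).t1']), M.ψ_apply, M.ττ]
end CT
end PTri

namespace PTri
open Finset
set_option linter.all false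
namespace CT
variable {V D : Type} [Fintype V] [DecidableEq V] [Fintype D] [DecidableEq D] {M : PMap V D} (K : CT M)

noncomputable instance : Fintype K.D' := Fintype.ofFinite _

lemma com' {d1 d2 : D} (h1 : M.tail d1 = K.w) (h2 : M.tail d2 = K.u) (h : M.head d1 = M.head d2) :
    (d1 = K.wx ∧ d2 = K.ux) ∨ (K.c3 ∧ d1 = K.wy ∧ d2 = K.uy) := by
  have T := tab K
  rcases K.com d1 d2 h1 h2 h with k | ⟨hc, k⟩
  · refine Or.inl ⟨M.eq_of _ _ h1 (k.trans T.a7.symm), M.eq_of _ _ (h2.trans T.a5.symm) ?_⟩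
    rw [← h, k, PMap.head, T.t2]; rfl
  · refine Or.inr ⟨hc, M.eq_of _ _ (h1.trans T.a3.symm) k, M.eq_of _ _ (h2.trans (T.a10 hc).symm) ?_⟩
    rw [← h, k, PMap.head, T.t5', T.a9]; rfl

open Classical in
noncomputable def ar : D := if K.c3 then M.σ.symm K.uy else M.σ.symm K.uw
lemma tail_ar : M.tail K.ar = K.u := by
  have T := tab K
  rw [ar]; split_ifs with h
  · rw [M.tail_σinv, T.a10 h]
  · rw [M.tail_σinv, T.a4]
lemma σ_ar : (K.c3 ∧ M.σ K.ar = K.uy) ∨ (¬ K.c3 ∧ M.σ K.ar = K.uw) := by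
  rw [ar]; split_ifs with h <;> simp [h]
lemma σ_ne (d : D) (h : ∃ d', d' ≠ d ∧ M.tail d' = M.tail d) : M.σ d ≠ d := fun k => by
  obtain ⟨d', h1, h2⟩ := h
  exact h1 (M.trans (fun z => z = d) (fun z hz => by rw [hz, k]) d d' h2.symm rfl)
lemma ret_ar : ¬ K.Rem K.ar := by
  have T := tab K
  have ht := K.tail_ar
  have h1 : K.ux ≠ K.uw := fun h => T.n3 (by
    have := congrArg M.τ h; rw [T.t2, T.t1'] at this; rw [← T.a6, this, T.a2])
  have h2 : K.c3 → K.ux ≠ K.uy := fun hc h => T.n6 hc (by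
    have := congrArg M.τ h; rw [T.t2, T.t5'] at this; rw [← T.a6, this, T.a9])
  have h3 : K.c3 → K.uw ≠ K.uy := fun hc h => T.n4 (by
    have := congrArg M.τ h; rw [T.t1', T.t5'] at this; rw [← T.a2, this, T.a9])
  rw [nrem]; rcases K.σ_ar with ⟨hc, k⟩ | ⟨hc, k⟩ <;> grind [Tab]
lemma σ'_ar : (K.σ' ⟨K.ar, K.ret_ar⟩).1 = K.rep (M.σ K.wu) := by
  have T := tab K
  rcases K.σ_ar with ⟨hc, k⟩ | ⟨hc, k⟩
  · rw [K.σ'_eq _ (by rw [k]; intro h; exact T.n4 (by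
      have := congrArg M.τ h; rw [T.t1', T.t5'] at this; rw [← T.a2, ← this, T.a9])), k, K.rep_uy hc, T.s4, K.rep_ret (K.ret_wy hc)]
  · exact K.σ'_eq' _ k
lemma σ'_u {e : D} (h : ¬ K.Rem e) (ht : M.tail e = K.u) (hne : e ≠ K.ar) :
    ¬ K.Rem (M.σ e) ∧ (K.σ' ⟨e, h⟩).1 = M.σ e ∧ M.σ e ≠ K.ux := by
  have T := tab K
  have hs := M.tail_σ e
  have h' := K.nrem.1 h
  have inj : ∀ z, M.σ e = M.σ z → e = z := fun z hz => M.σ.injective hz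
  have h1 : M.σ e ≠ K.uw := fun k => by
    rcases K.σ_ar with ⟨hc, k'⟩ | ⟨hc, k'⟩
    · exact (h'.2.2.2.2 hc).1 (inj _ (k.trans (T.s6 hc).symm))
    · exact hne (inj _ (k.trans k'.symm))
  have h2 : K.c3 → M.σ e ≠ K.uy := fun hc k => by
    rcases K.σ_ar with ⟨hc, k'⟩ | ⟨hc', k'⟩
    · exact hne (inj _ (k.trans k'.symm))
    · exact hc' hc
  have hr : ¬ K.Rem (M.σ e) := by rw [nrem]; grind [Tab]
  refine ⟨hr, by rw [K.σ'_eq _ h1, K.rep_ret hr], fun k => h'.2.1 (inj _ (k.trans T.s2.symm))⟩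
lemma σ'_w {e : D} (h : ¬ K.Rem e) (ht : M.tail e = K.w) :
    (M.σ e = K.wx ∧ (K.σ' ⟨e, h⟩).1 = K.ux) ∨ (¬ K.Rem (M.σ e) ∧ (K.σ' ⟨e, h⟩).1 = M.σ e) := by
  have T := tab K
  have hs := M.tail_σ e
  have h' := K.nrem.1 h
  have h1 : M.σ e ≠ K.uw := by grind [Tab]
  by_cases k : M.σ e = K.wx
  · left; refine ⟨k, ?_⟩; rw [K.σ'_eq _ h1, k, rep_wx]
  · right
    have h2 : M.σ e ≠ K.wu := fun k => h'.1 (M.σ.injective (k.trans T.s1.symm))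
    have hr : ¬ K.Rem (M.σ e) := by rw [nrem]; grind [Tab]
    exact ⟨hr, by rw [K.σ'_eq _ h1, K.rep_ret hr]⟩

lemma trans' (g : K.D' → Prop) (hg : ∀ e, g e → g (K.σ' e)) (d d' : K.D') (ht : K.f (M.tail d.1) = K.f (M.tail d'.1))
    (hd : g d) : g d' := by
  have T := tab K
  have gs : ∀ {e : D} (h : ¬ K.Rem e) {e' : D} (h' : ¬ K.Rem e'), g ⟨e, h⟩ → (K.σ' ⟨e, h⟩).1 = e' → g ⟨e', h'⟩ := by
    intro e h e' h' k1 k2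
    have := hg _ k1; convert this using 1; exact Subtype.ext k2.symm
  have L1 : ∀ e : K.D', M.tail e.1 = K.w → g e → g ⟨K.ux, K.ret_ux⟩ := by
    intro e he hge
    by_contra hc
    obtain ⟨⟨h, -⟩, -⟩ := M.trans (fun z => (∃ h, g ⟨z, h⟩) ∧ M.tail z = K.w) (fun z ⟨⟨h, k⟩, k2⟩ => by
      rcases K.σ'_w h k2 with ⟨k3, k4⟩ | ⟨k3, k4⟩
      · exact absurd (gs h _ k k4) hc
      · exact ⟨⟨k3, gs h k3 k k4⟩, by rw [M.tail_σ, k2]⟩) e.1 K.wx he ⟨⟨e.2, hge⟩, he⟩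
    exact h (Or.inl rfl)
  have hb : g ⟨K.ar, K.ret_ar⟩ → g ⟨K.ux, K.ret_ux⟩ ∧ ∀ h, g ⟨M.σ K.wu, h⟩ := by
    intro k
    by_cases hw : M.σ K.wu = K.wx
    · refine ⟨gs _ _ k (by rw [σ'_ar, hw, rep_wx]), fun h => absurd (Or.inl hw) h⟩
    · have : ¬ K.Rem (M.σ K.wu) := by
        have := M.tail_σ K.wu
        have h2 : M.σ K.wu ≠ K.wu := fun k => by
          have h := M.trans (fun z => z = K.wu) (fun z hz => by rw [hz, k]) K.wu K.wx (T.a2.trans T.a1.symm) rfl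
          rw [h] at hw; exact hw k
        rw [nrem]; grind [Tab]
      have h3 : g ⟨M.σ K.wu, this⟩ := gs _ _ k (by rw [σ'_ar, K.rep_ret this])
      exact ⟨L1 _ (by show M.tail (M.σ K.wu) = _; rw [M.tail_σ, T.a2]) h3, fun _ => h3⟩
  have L2 : ∀ e : K.D', M.tail e.1 = K.u → g e → g ⟨K.ux, K.ret_ux⟩ := by
    intro e he hge
    by_contra hc
    obtain ⟨⟨h, -⟩, -⟩ := M.trans (fun z => (∃ h, g ⟨z, h⟩) ∧ M.tail z = K.u) (fun z ⟨⟨h, k⟩, k2⟩ => by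
      by_cases hz : z = K.ar
      · subst hz; exact absurd (hb k).1 hc
      · obtain ⟨k3, k4, -⟩ := K.σ'_u h k2 hz
        exact ⟨⟨k3, gs h k3 k k4⟩, by rw [M.tail_σ, k2]⟩) e.1 K.uw he ⟨⟨e.2, hge⟩, he⟩
    exact h (by simp [Rem])
  have L3 : g ⟨K.ux, K.ret_ux⟩ → ∀ e : K.D', M.tail e.1 = K.u → g e := by
    intro hx e he
    refine M.trans (fun z => M.tail z = K.u → ∀ h, g ⟨z, h⟩) (fun z k k1 h => ?_) K.ux e.1 (T.a5.trans he.symm) (fun _ _ => hx) he e.2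
    rw [M.tail_σ] at k1
    by_cases hr : K.Rem z
    · rcases hr with rfl | rfl | rfl | rfl | ⟨hc, rfl | rfl⟩
      · exact absurd k1 T.n1.symm
      · exact hx
      · exact absurd k1 T.n2.symm
      · exact absurd (T.a2.symm.trans k1) T.n1.symm
      · exact absurd (by rw [T.s6 hc]; simp [Rem]) h
      · exact absurd k1 (T.n5 hc)
    · by_cases hz : z = K.ar
      · subst hz; exact absurd (by rcases K.σ_ar with ⟨a, b⟩ | ⟨a, b⟩ <;> simp [b, Rem, a]) h
      · exact gs hr h (k k1 hr) (K.σ'_u hr k1 hz).2.1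
  have L4 : g ⟨K.ux, K.ret_ux⟩ → ∀ e : K.D', M.tail e.1 = K.w → g e := by
    intro hx e he
    refine M.trans (fun z => M.tail z = K.w → ∀ h, g ⟨z, h⟩) (fun z k k1 h => ?_) K.wu e.1 (T.a2.trans he.symm)
      (fun _ h => absurd (by simp [Rem]) h) he e.2
    rw [M.tail_σ] at k1
    by_cases hr : K.Rem z
    · rcases hr with rfl | rfl | rfl | rfl | ⟨hc, rfl | rfl⟩
      · exact absurd (by simp [Rem, T.s1]) h
      · exact absurd k1 T.n1
      · exact absurd k1 T.n3.symm
      · exact (hb (L3 hx _ K.tail_ar)).2 h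
      · exact absurd ((T.a10 hc).symm.trans k1) T.n1
      · exact absurd k1 T.n4.symm
    · rcases K.σ'_w hr k1 with ⟨k3, k4⟩ | ⟨k3, k4⟩
      · exact absurd (Or.inl k3) h
      · exact gs hr h (k k1 hr) k4
  by_cases hv : M.tail d.1 = K.u ∨ M.tail d.1 = K.w
  · have hx : g ⟨K.ux, K.ret_ux⟩ := hv.elim (fun h => L2 d h hd) (fun h => L1 d h hd)
    have hv' : M.tail d'.1 = K.u ∨ M.tail d'.1 = K.w := by
      rcases K.f_eq ht with h | h | h
      · rwa [← h]
      · exact Or.inr h.2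
      · exact Or.inl h.2
    exact hv'.elim (L3 hx d') (L4 hx d')
  · push Not at hv
    have ht' : M.tail d.1 = M.tail d'.1 := by
      rcases K.f_eq ht with h | h | h
      · exact h
      · exact absurd h.1 hv.1
      · exact absurd h.1 hv.2
    have := M.trans (fun z => M.tail z = M.tail d.1 → ∀ h, g ⟨K.rep z, h⟩) (fun z k k1 h => ?_) d.1 d'.1 ht'
      (fun _ h => by convert hd using 1; exact Subtype.ext (K.rep_ret d.2)) ht'.symm (by rw [K.rep_ret d'.2]; exact d'.2)
    · convert this using 1; exact Subtype.ext (K.rep_ret d'.2).symm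
    · rw [M.tail_σ] at k1
      by_cases hr : K.Rem z
      · rcases hr with rfl | rfl | rfl | rfl | ⟨hc, rfl | rfl⟩
        · exact absurd k1.symm hv.2
        · exact absurd k1.symm hv.1
        · have := k k1 (by rw [rep_xu]; exact K.ret_xw)
          convert this using 2; rw [rep_xu, T.s3, K.rep_ret K.ret_xw]
        · exact absurd (k1.symm.trans T.a2) hv.2
        · exact absurd (k1.symm.trans (T.a10 hc)) hv.1
        · have := k k1 (by rw [K.rep_yw hc]; exact K.ret_yu hc)
          convert this using 2; rw [K.rep_yw hc, T.s5, K.rep_ret (K.ret_yu hc)]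
      · have hne : M.σ z ≠ K.uw := fun e => hv.1 (by rw [← k1, ← M.tail_σ, e, T.a4])
        refine gs hr h ?_ (K.σ'_eq ⟨z, hr⟩ hne)
        have := k k1 (by rwa [K.rep_ret hr])
        convert this using 2; rw [K.rep_ret hr]

lemma simple' (d d' : K.D') (h1 : K.f (M.tail d.1) = K.f (M.tail d'.1)) (h2 : K.f (M.head d.1) = K.f (M.head d'.1)) : d = d' := by
  have T := tab K
  have key : ∀ d d' : K.D', M.tail d.1 = K.w → M.tail d'.1 = K.u → M.head d.1 = M.head d'.1 → False := by
    intro d d' a b c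
    rcases K.com' a b c with h | h
    · exact d.2 (Or.inl h.1)
    · exact d'.2 (by simp [Rem, h])
  have key2 : ∀ d d' : K.D', M.head d.1 = K.w → M.head d'.1 = K.u → M.tail d.1 = M.tail d'.1 → False := by
    intro d d' a b c
    rcases K.com' (d1 := M.τ d.1) (d2 := M.τ d'.1) a b (by rw [M.head_τ, M.head_τ, c]) with h | h
    · exact d'.2 (by have h := h.2; rw [M.τ_eq, T.t2] at h; simp [Rem, h])
    · exact d.2 (by rw [M.τ_eq, T.t4] at h; simp [Rem, h])
  have key3 : ∀ d : K.D', M.tail d.1 = K.u → M.head d.1 ≠ K.w := fun d a b =>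
    d.2 (by have := M.eq_of d.1 K.uw a (by rw [b, PMap.head, T.t1', T.a2]); simp [Rem, this])
  have n1 := M.ne_head d.1
  have n2 := M.ne_head d'.1
  rcases K.f_eq h1 with a | a | a <;> rcases K.f_eq h2 with b | b | b
  · exact Subtype.ext (M.eq_of _ _ a b)
  · exact (key2 _ _ b.2 b.1 a.symm).elim
  · exact (key2 _ _ b.1 b.2 a).elim
  · exact (key _ _ a.2 a.1 b.symm).elim
  · exact absurd (a.1.trans b.1.symm) n1
  · exact absurd b.1 (key3 d a.1)
  · exact (key _ _ a.1 a.2 b).elim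
  · exact absurd b.2 (key3 d' a.2)
  · exact absurd (a.1.trans b.1.symm) n1

lemma noloop' (d : K.D') : K.f (M.tail d.1) ≠ K.f (M.head d.1) := by
  have T := tab K
  intro h
  rcases K.f_eq h with a | a | a
  · exact M.ne_head _ a
  · have := M.eq_of d.1 K.uw a.1 (by rw [a.2, PMap.head, T.t1', T.a2]); exact d.2 (by simp [Rem, this])
  · have := M.eq_of d.1 K.wu (a.1.trans T.a2.symm) (by rw [a.2, PMap.head, T.t1, T.a4]); exact d.2 (by simp [Rem, this])

lemma surj' (v : {v // v ≠ K.u}) : ∃ d : K.D', K.f (M.tail d.1) = v := by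
  have T := tab K
  by_cases hv : v.1 = K.w
  · refine ⟨⟨K.ux, K.ret_ux⟩, ?_⟩
    show K.f (M.tail K.ux) = v
    rw [T.a5, f_u]; exact Subtype.ext hv.symm
  · obtain ⟨d, hd⟩ := M.surj v.1
    refine ⟨⟨K.rep d, K.ret_rep ?_ ?_⟩, ?_⟩
    · rintro rfl; exact v.2 (hd.symm.trans T.a4)
    · rintro rfl; exact hv (hd.symm.trans T.a2)
    · show K.f (M.tail (K.rep d)) = v
      rw [f_rep, hd, K.f_ne v.2]

end CT
end PTri

namespace PTri
open Finset
set_option linter.all false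
namespace CT
variable {V D : Type} [Fintype V] [DecidableEq V] [Fintype D] [DecidableEq D] {M : PMap V D} (K : CT M)

lemma sum_ret {A : Type} [AddCommMonoid A] (F : D → A) (h : ∀ e, K.Rem e → F e = 0) (P : D → Prop) [DecidablePred P] [DecidablePred fun e : K.D' => P e.1] :
    ∑ e ∈ Finset.univ.filter P, F e = ∑ e ∈ Finset.univ.filter (fun e : K.D' => P e.1), F e.1 := by
  symm
  refine sum_bij_ne_zero (fun e _ _ => e.1) (fun e he _ => by simpa using he) (fun a _ _ b _ _ k => Subtype.ext k)
    (fun b hb hb0 => ⟨⟨b, fun k => hb0 (h b k)⟩, by simpa using hb, hb0, rfl⟩) (fun _ _ _ => rfl)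

lemma iffs : (∀ e, e = K.ux ↔ M.tail e = K.u ∧ M.head e = K.x) ∧ (∀ e, e = K.wx ↔ M.tail e = K.w ∧ M.head e = K.x) ∧
    (∀ e, e = K.uw ↔ M.tail e = K.u ∧ M.head e = K.w) ∧ (∀ e, e = K.wu ↔ M.tail e = K.w ∧ M.head e = K.u) ∧
    (∀ e, e = K.xu ↔ M.tail e = K.x ∧ M.head e = K.u) ∧ (∀ e, e = K.xw ↔ M.tail e = K.x ∧ M.head e = K.w) ∧
    (∀ e, e = K.wy ↔ M.tail e = K.w ∧ M.head e = K.y) ∧ (∀ e, e = K.yw ↔ M.tail e = K.y ∧ M.head e = K.w) ∧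
    (K.c3 → ∀ e, e = K.yu ↔ M.tail e = K.y ∧ M.head e = K.u) ∧ (K.c3 → ∀ e, e = K.uy ↔ M.tail e = K.u ∧ M.head e = K.y) := by
  have T := tab K
  have h : ∀ z a b, M.tail z = a → M.tail (M.τ z) = b → ∀ e, e = z ↔ M.tail e = a ∧ M.head e = b := by
    rintro z a b rfl rfl e
    exact ⟨fun h => by rw [h]; exact ⟨rfl, rfl⟩, fun h => M.eq_of _ _ h.1 h.2⟩
  refine ⟨h _ _ _ T.a5 ?_, h _ _ _ T.a1 ?_, h _ _ _ T.a4 ?_, h _ _ _ T.a2 ?_, h _ _ _ T.a6 ?_, h _ _ _ T.a7 ?_,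
    h _ _ _ T.a3 ?_, h _ _ _ T.a8 ?_, fun hc => h _ _ _ T.a9 ?_, fun hc => h _ _ _ (T.a10 hc) ?_⟩
  · rw [T.t2, T.a6]
  · rw [T.t3', T.a7]
  · rw [T.t1', T.a2]
  · rw [T.t1, T.a4]
  · rw [T.t2', T.a5]
  · rw [T.t3, T.a1]
  · rw [T.t4, T.a8]
  · rw [T.t4', T.a3]
  · rw [T.t5, T.a10 hc]
  · rw [T.t5', T.a9]

open Classical in
/-- switching function -/
noncomputable def sw (F : D → ZMod 2) (a b A : ZMod 2) (e : D) : ZMod 2 :=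
  F e + ((if e = K.ux then a else 0) + (if e = K.wx then a else 0)) +
      ((if e = K.yu then (if K.c3 then b else 0) else 0) + (if e = K.yw then (if K.c3 then b else 0) else 0)) +
      ((if e = K.uw then A else 0) + (if e = K.wu then A else 0))

lemma sw_val (F : D → ZMod 2) (a b A : ZMod 2) : 
    K.sw F a b A K.ux = F K.ux + a ∧ K.sw F a b A K.xu = F K.xu ∧ K.sw F a b A K.wx = F K.wx + a ∧ K.sw F a b A K.xw = F K.xw ∧
    K.sw F a b A K.uw = F K.uw + A ∧ K.sw F a b A K.wu = F K.wu + A ∧ (K.c3 → K.sw F a b A K.wy = F K.wy ∧ 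
    K.sw F a b A K.yw = F K.yw + b ∧ K.sw F a b A K.uy = F K.uy ∧ K.sw F a b A K.yu = F K.yu + b) ∧
    ∀ e, ¬ K.Rem e → ¬ K.Rem (M.τ e) → K.sw F a b A e = F e := by
  have T := tab K
  obtain ⟨i1, i2, i3, i4, i5, i6, i7, i8, i9, i10⟩ := K.iffs
  have j1 := (i1 _).1 rfl
  have j2 := (i2 _).1 rfl
  have j3 := (i3 _).1 rfl
  have j4 := (i4 _).1 rfl
  have j5 := (i5 _).1 rfl
  have j6 := (i6 _).1 rfl
  have j7 := (i7 _).1 rfl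
  have j8 := (i8 _).1 rfl
  have n1 := T.n1; have n2 := T.n2; have n3 := T.n3; have n4 := T.n4
  have m1 := n1.symm; have m2 := n2.symm; have m3 := n3.symm; have m4 := n4.symm
  have last : ∀ e, ¬ K.Rem e → ¬ K.Rem (M.τ e) → K.sw F a b A e = F e := by
    intro e h h'
    rw [nrem] at h h'
    simp only [Ne, M.τ_eq, T.t3', T.t1', T.t2', T.t1, T.t5', T.t4'] at h'
    obtain ⟨h1, h2, h3, h4, h5⟩ := h
    obtain ⟨g1, g2, g3, g4, g5⟩ := h'
    by_cases hc : K.c3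
    · simp [sw, h1, h2, h4, g3, (h5 hc).2, (g5 hc).1]
    · simp [sw, h1, h2, h4, g3, hc]
  by_cases hc : K.c3
  · have i9 := i9 hc; have i10 := i10 hc
    have n5 := T.n5 hc; have n6 := T.n6 hc
    have j9 := (i9 _).1 rfl
    have j10 := (i10 _).1 rfl
    have m5 := n5.symm; have m6 := n6.symm
    refine ⟨?_, ?_, ?_, ?_, ?_, ?_, fun _ => ⟨?_, ?_, ?_, ?_⟩, last⟩ <;> simp only [sw, hc] <;>
    simp only [i1, i2, i3, i4, i8, i9, j1, j2, j3, j4, j5, j6, j7, j8, j9, j10, n1, n2, n3, n4, n5, n6, m1, m2, m3, m4, m5, m6, false_and, and_false, if_false, if_true, add_zero, zero_add, and_self, true_and, and_true]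
  · refine ⟨?_, ?_, ?_, ?_, ?_, ?_, fun h => absurd h hc, last⟩ <;> simp only [sw, hc, if_false, ite_self] <;>
    simp only [i1, i2, i3, i4, j1, j2, j3, j4, j5, j6, j7, j8, n1, n2, n3, n4, m1, m2, m3, m4, false_and, and_false, if_false, if_true, add_zero, zero_add, and_self, true_and, and_true]
open Classical in
lemma exact' (f : K.D' → ZMod 2) (h1 : ∀ d, f (K.τ' d) = f d)
    (h2 : ∀ v, ∑ d ∈ Finset.univ.filter (fun d : K.D' => K.f (M.tail d.1) = v), f d = 0) :
    ∃ g : K.D' → ZMod 2, (∀ d, g (K.τ' (K.σ' d)) = g d) ∧ ∀ d, f d = g d + g (K.τ' d) := by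
  have T := tab K
  have c2 : ∀ a : ZMod 2, a + a = 0 := by decide
  set F : D → ZMod 2 := fun e => if h : ¬ K.Rem e then f ⟨e, h⟩ else 0 with hF
  have F0 : ∀ e, K.Rem e → F e = 0 := fun e h => by simp [hF, h]
  have F1 : ∀ e (h : ¬ K.Rem e), F e = f ⟨e, h⟩ := fun e h => by simp [hF, h]
  have Fτ : ∀ e, ¬ K.Rem e → F (K.rep (M.τ e)) = F e := fun e h => by
    rw [F1 e h, F1 _ (K.rep_τ h).1]; exact h1 ⟨e, h⟩
  have Fxw : F K.xw = F K.ux := by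
    have := Fτ _ K.ret_xw; rw [T.t3, rep_wx] at this; exact this.symm
  have Fyu : K.c3 → F K.yu = F K.wy := fun hc => by
    have := Fτ _ (K.ret_yu hc); rw [T.t5, K.rep_uy hc] at this; exact this.symm
  set a := F K.ux
  set b := F K.wy
  set A := (∑ e ∈ Finset.univ.filter (fun e => M.tail e = K.u), F e) + a with hA
  have hS := K.sw_val F a b A
  set fl := K.sw F a b A with hfl
  obtain ⟨v1, v2, v3, v4, v5, v6, v7, flF⟩ := hS
  rw [F0 K.xu (by simp [Rem])] at v2
  rw [F0 K.wx (by simp [Rem]), zero_add] at v3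
  rw [F0 K.uw (by simp [Rem]), zero_add] at v5
  rw [F0 K.wu (by simp [Rem]), zero_add] at v6
  rw [Fxw] at v4
  rw [c2] at v1
  have v7 : K.c3 → fl K.wy = b ∧ fl K.yw = b ∧ fl K.uy = 0 ∧ fl K.yu = 0 := fun hc => by
    obtain ⟨p1, p2, p3, p4⟩ := v7 hc
    rw [F0 K.yw (by simp [Rem, hc]), zero_add] at p2
    rw [F0 K.uy (by simp [Rem, hc])] at p3
    rw [Fyu hc, c2] at p4
    exact ⟨p1, p2, p3, p4⟩
  have fl1 : ∀ e, fl (M.τ e) = fl e := by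
    intro e
    by_cases hr : K.Rem e
    · rcases hr with rfl | rfl | rfl | rfl | ⟨hc, rfl | rfl⟩
      · rw [T.t3', v3, v4]
      · rw [T.t1', v5, v6]
      · rw [T.t2', v1, v2]
      · rw [T.t1, v5, v6]
      · rw [T.t5', (v7 hc).2.2.1, (v7 hc).2.2.2]
      · rw [T.t4', (v7 hc).1, (v7 hc).2.1]
    by_cases hr' : K.Rem (M.τ e)
    · rcases hr' with k | k | k | k | ⟨hc, k | k⟩ <;> rw [k] <;> rw [M.τ_eq] at k <;> rw [k]
      · rw [T.t3', v3, v4]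
      · rw [T.t1', v5, v6]
      · rw [T.t2', v1, v2]
      · rw [T.t1, v5, v6]
      · rw [T.t5', (v7 hc).2.2.1, (v7 hc).2.2.2]
      · rw [T.t4', (v7 hc).1, (v7 hc).2.1]
    · rw [flF e hr hr', flF _ hr' (by rw [M.ττ]; exact hr), ← Fτ e hr, K.rep_ret hr']
  have hsv : ∀ v, v ≠ K.u → v ≠ K.w → ∑ e ∈ Finset.univ.filter (fun e => M.tail e = v), F e = 0 := by
    intro v k1 k2
    rw [K.sum_ret F F0, ← h2 (K.f v)]
    refine sum_congr (filter_congr fun e _ => ⟨fun h => by rw [h], fun h => ?_⟩) fun e _ => F1 _ _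
    rcases K.f_eq h with h | h | h
    exacts [h, absurd h.2 k2, absurd h.2 k1]
  have hsw : ∑ e ∈ Finset.univ.filter (fun e => M.tail e = K.u), F e + ∑ e ∈ Finset.univ.filter (fun e => M.tail e = K.w), F e = 0 := by
    rw [K.sum_ret F F0, K.sum_ret F F0, ← sum_union, ← h2 (K.f K.u), ← filter_or]
    · refine sum_congr (filter_congr fun e _ => ⟨fun h => ?_, fun h => ?_⟩) fun e _ => F1 _ _
      · rcases h with h | h
        · rw [h]
        · rw [h, f_w]
      · rcases K.f_eq h with h | h | h
        exacts [Or.inl h, Or.inl h.1, Or.inr h.1]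
    · rw [disjoint_filter]; intro e _ h h'; exact T.n1 (h.symm.trans h')
  have single : ∀ (v : V) (d : D) (c : ZMod 2), ∑ e ∈ Finset.univ.filter (fun e => M.tail e = v), (if e = d then c else 0)
      = if M.tail d = v then c else 0 := fun v d c => by
    rw [sum_filter, Finset.sum_eq_single d] <;> simp +contextual
  obtain ⟨g, hg, hfg⟩ := M.exact fl fl1 (fun v => by
    simp only [hfl, sw, sum_add_distrib, single, T.a1, T.a2, T.a4, T.a5, T.a8, T.a9]
    rw [c2 (if K.y = v then _ else _), add_zero]
    by_cases k1 : v = K.u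
    · subst k1; rw [if_pos rfl, if_neg T.n1.symm, if_pos rfl, if_neg T.n1.symm, add_zero, add_zero, hA]; exact c2 _
    by_cases k2 : v = K.w
    · subst k2; rw [if_neg T.n1, if_pos rfl, if_neg T.n1, if_pos rfl, zero_add, zero_add, hA]
      generalize ∑ e ∈ Finset.univ.filter (fun e => M.tail e = K.u), F e = s at *
      generalize ∑ e ∈ Finset.univ.filter (fun e => M.tail e = K.w), F e = t at *
      have : ∀ s t a : ZMod 2, s + t = 0 → t + a + (s + a) = 0 := by decide
      exact this _ _ _ hsw
    · rw [hsv v k1 k2, if_neg (Ne.symm k1), if_neg (Ne.symm k2), if_neg (Ne.symm k1), if_neg (Ne.symm k2)]; simp)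
  have hg' : ∀ d, g (M.ψ d) = g d := hg
  have ceq : ∀ a b : ZMod 2, 0 = a + b → a = b := by decide
  have P := K.ψ_wu
  have gux : g K.ux = g K.wx := by
    have := hfg K.ux; rw [T.t2, v1] at this
    rw [ceq _ _ this, ← P.2.2.1, hg']
  have gyu : K.c3 → g K.yu = g K.yw := fun hc => by
    have := hfg K.yu; rw [T.t5, (v7 hc).2.2.2] at this
    rw [ceq _ _ this, ← P.2.2.2.2.1, hg']
  have gxw : a = g K.xw + g K.wx := by
    have := hfg K.xw; rwa [T.t3, v4] at this
  have gwy : K.c3 → b = g K.wy + g K.yw := fun hc => by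
    have := hfg K.wy; rwa [T.t4, (v7 hc).1] at this
  refine ⟨fun e => g e.1, fun e => ?_, fun e => ?_⟩
  · have : K.τ' (K.σ' e) = K.ψ' e := Subtype.ext (K.rep_τ (K.ψ' e).2).2
    rw [this]; show g (K.ψ₀ e.1) = g e.1
    by_cases h : M.ψ e.1 = K.wu
    · rw [K.ψ₀_eq' h, hg', ← h, hg']
    · rw [K.ψ₀_eq (K.nrem.1 e.2).2.2.2.1 h, hg']
  · rw [← F1 e.1 e.2]; show _ = g e.1 + g (K.rep (M.τ e.1))
    obtain ⟨e, he⟩ := e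
    show F e = g e + g (K.rep (M.τ e))
    by_cases hr' : K.Rem (M.τ e)
    · rcases hr' with k | k | k | k | ⟨hc, k | k⟩ <;> rw [k] <;> rw [M.τ_eq] at k
      · rw [T.t3'] at k; rw [k, rep_wx, Fxw, gux, gxw]
      · rw [T.t1'] at k; subst k; exact absurd (by simp [Rem]) he
      · rw [T.t2'] at k; subst k; rw [rep_xu, gux, add_comm]; exact gxw
      · rw [T.t1] at k; subst k; exact absurd (by simp [Rem]) he
      · rw [T.t5'] at k; subst k; rw [K.rep_uy hc, gyu hc, Fyu hc, add_comm]; exact gwy hc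
      · rw [T.t4'] at k; subst k; rw [K.rep_yw hc, gyu hc]; exact gwy hc
    · rw [← flF e he hr', hfg, K.rep_ret hr']

open Classical in
lemma ret_o : ¬ K.Rem (if M.o = K.wu then M.ψ M.o else M.o) := by
  have T := tab K
  have P := K.ψ_wu
  have h1 : ∀ z, z = K.wx ∨ z = K.uw ∨ z = K.xu → ¬ M.ψ.SameCycle z M.o := by
    rintro z (rfl | rfl | rfl)
    · exact K.out
    · exact fun h => K.out ((Equiv.Perm.sameCycle_apply_left).1 h)
    · exact fun h => K.out (by rw [← P.2.2.1]; exact (Equiv.Perm.sameCycle_apply_left).2 h)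
  have h2 : K.c3 → ∀ z, z = K.wu ∨ z = K.yw ∨ z = K.uy → ¬ M.ψ.SameCycle z M.o := by
    rintro hc z (rfl | rfl | rfl)
    · exact K.qout hc
    · exact fun h => K.qout hc ((Equiv.Perm.sameCycle_apply_left).1 h)
    · exact fun h => K.qout hc (by
        show M.ψ.SameCycle K.wu M.o
        rw [← P.2.2.2.2.2 hc]; exact (Equiv.Perm.sameCycle_apply_left).2 h)
  have r := Equiv.Perm.SameCycle.refl M.ψ M.o
  have r' : M.ψ.SameCycle (M.ψ M.o) M.o := (Equiv.Perm.sameCycle_apply_left).2 r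
  have hn : M.ψ M.o ≠ M.o := fun h => M.ne_head M.o (by conv_rhs => rw [← h, M.head_ψ])
  split_ifs with h
  · rw [nrem]
    refine ⟨fun k => h1 _ (by simp [k]) r', fun k => h1 _ (by simp [k]) r', fun k => h1 _ (by simp [k]) r',
      fun k => hn (k.trans h.symm), fun hc => absurd (h ▸ r) (h2 hc K.wu (by simp))⟩
  · rw [nrem]
    exact ⟨fun k => h1 _ (by simp [k]) r, fun k => h1 _ (by simp [k]) r, fun k => h1 _ (by simp [k]) r, h,
      fun hc => ⟨fun k => h2 hc _ (by simp [k]) r, fun k => h2 hc _ (by simp [k]) r⟩⟩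

open Classical in
/-- the contracted map -/
noncomputable def M' : PMap {v // v ≠ K.u} K.D' where
  σ := K.σ'
  τ := K.τ'
  tail e := K.f (M.tail e.1)
  ττ e := Subtype.ext (K.rep_τ e.2).2
  tail_σ e := by
    have T := tab K
    by_cases h : M.σ e.1 = K.uw
    · have : M.tail e.1 = K.u := by rw [← M.tail_σ, h]; exact T.a4
      rw [K.σ'_eq' e h, f_rep, M.tail_σ, T.a2, f_w, this]
    · rw [K.σ'_eq e h, f_rep, M.tail_σ]
  trans g hg d d' := K.trans' g hg d d'
  simple d d' h1 h2 := K.simple' d d' h1 (by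
    have : ∀ e : K.D', K.f (M.tail (K.τ' e).1) = K.f (M.head e.1) := fun e => K.f_rep _
    rwa [this, this] at h2)
  noloop d := by
    have : ∀ e : K.D', K.f (M.tail (K.τ' e).1) = K.f (M.head e.1) := fun e => K.f_rep _
    rw [this]; exact K.noloop' d
  surj := K.surj'
  exact f h1 h2 := K.exact' f h1 (by convert h2)
  o := ⟨if M.o = K.wu then M.ψ M.o else M.o, K.ret_o⟩

end CT
end PTri

namespace PTri
open Finset
set_option linter.all false
namespace CT
variable {V D : Type} [Fintype V] [DecidableEq V] [Fintype D] [DecidableEq D] {M : PMap V D} (K : CT M)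

lemma f_head_rep (e : D) : K.f (M.head (K.rep e)) = K.f (M.head e) := by
  have T := tab K
  have h : ∀ z, M.head z = M.tail (M.τ z) := fun _ => rfl
  by_cases hr : K.Rem e
  · rcases hr with rfl | rfl | rfl | rfl | ⟨hc, rfl | rfl⟩
    · rw [rep_wx, h, h, T.t2, T.t3', T.a6, T.a7]
    · rw [rep, if_neg, if_neg, if_neg, if_neg] <;> grind [Tab]
    · rw [rep_xu, h, h, T.t3, T.t2', T.a1, T.a5, f_w]
    · rw [rep, if_neg, if_neg, if_neg, if_neg] <;> grind [Tab]
    · rw [K.rep_uy hc, h, h, T.t4, T.t5', T.a8, T.a9]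
    · rw [K.rep_yw hc, h, h, T.t5, T.t4', T.a10 hc, T.a3, f_w]
  · rw [K.rep_ret hr]

lemma tail' (e : K.D') : K.M'.tail e = K.f (M.tail e.1) := rfl
lemma head' (e : K.D') : K.M'.head e = K.f (M.head e.1) := K.f_rep _

lemma f_val (s : {v // v ≠ K.u}) : K.f s.1 = s := K.f_ne s.2

variable {L : Finset (Sym2 V)}
def L' (L : Finset (Sym2 V)) : Finset (Sym2 {v // v ≠ K.u}) := ((L.erase s(K.u, K.w)).erase s(K.u, K.x)).image (Sym2.map K.f)

lemma lam' (hL : Laman L) (h1 : s(K.u, K.w) ∈ L) (h2 : s(K.u, K.x) ∈ L)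
    (hb : ∀ Z, Tight L Z → K.w ∈ Z → K.u ∈ Z → K.x ∉ Z → ¬ 3 ≤ Z.card) : Laman (K.L' L) := by
  have T := tab K
  have hcV : Fintype.card {v // v ≠ K.u} + 1 = Fintype.card V := by
    have h : 0 < Fintype.card V := Fintype.card_pos_iff.2 ⟨K.u⟩
    have : Fintype.card {v // v ≠ K.u} = Fintype.card V - 1 := by
      rw [Fintype.card_subtype_compl, Fintype.card_subtype_eq]
    omega
  have hne : s(K.u, K.x) ≠ s(K.u, K.w) := by
    intro h; rw [Sym2.eq_iff] at h
    rcases h with h | h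
    · exact T.n3 h.2.symm
    · exact T.n1 h.1
  have tri : ∀ z, z ≠ K.u → z ≠ K.w → z ≠ K.x → s(K.u, z) ∈ L → s(K.w, z) ∈ L → False := by
    intro z z1 z2 z3 k1 k2
    have hc3 : ({K.u, K.w, z} : Finset V).card = 3 := by
      rw [card_insert_of_notMem, card_insert_of_notMem, card_singleton] <;> simp [T.n1, z1.symm, z2.symm]
    refine hb {K.u, K.w, z} ?_ (by simp) (by simp) (by simp [T.n2.symm, T.n3.symm, z3.symm]) hc3.ge
    have e3 : ({s(K.u, K.w), s(K.u, z), s(K.w, z)} : Finset (Sym2 V)).card = 3 := by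
      rw [card_insert_of_notMem, card_insert_of_notMem, card_singleton] <;> simp [T.n1, z1.symm, z2.symm, Sym2.eq_iff, T.n1.symm, z1, z2]
    have := card_le_card (show ({s(K.u, K.w), s(K.u, z), s(K.w, z)} : Finset (Sym2 V)) ⊆ L ∩ ({K.u, K.w, z} : Finset V).sym2 by
      intro e he
      simp only [mem_insert, mem_singleton] at he
      rcases he with rfl | rfl | rfl <;> simp [h1, k1, k2])
    have := hL.cnt {K.u, K.w, z} (by omega)
    unfold Tight; omega
  have inj : Set.InjOn (Sym2.map K.f) ((L.erase s(K.u, K.w)).erase s(K.u, K.x)) := by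
    have key : ∀ a b z : V, s(a, z) ∈ L → s(b, z) ∈ L → s(a, z) ≠ s(K.u, K.x) → s(a,z) ≠ s(K.u, K.w) → s(b, z) ≠ s(K.u, K.x) → s(b, z) ≠ s(K.u, K.w) →
        K.f a = K.f b → a = b := by
      intro a b z k1 k2 k3 k4 k5 k6 hab
      rcases K.f_eq hab with h | ⟨rfl, rfl⟩ | ⟨rfl, rfl⟩
      · exact h
      · refine (tri z ?_ ?_ ?_ k1 k2).elim
        · rintro rfl; exact hL.nd _ k1 (by simp)
        · rintro rfl; exact k4 rfl
        · rintro rfl; exact k3 rfl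
      · refine (tri z ?_ ?_ ?_ k2 k1).elim
        · rintro rfl; exact hL.nd _ k2 (by simp)
        · rintro rfl; exact k6 rfl
        · rintro rfl; exact k5 rfl
    have key2 : ∀ a b c d : V, s(a, b) ∈ L → s(c, d) ∈ L → s(a, b) ≠ s(K.u, K.x) → s(a,b) ≠ s(K.u, K.w) → s(c, d) ≠ s(K.u, K.x) → s(c, d) ≠ s(K.u, K.w) →
        K.f a = K.f c → K.f b = K.f d → s(a, b) = s(c, d) := by
      intro a b c d k1 k2 k3 k4 k5 k6 h h'
      by_cases hbd : b = d
      · subst hbd; rw [key a c b k1 k2 k3 k4 k5 k6 h]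
      by_cases hac : a = c
      · subst hac; rw [key b d a (by rwa [Sym2.eq_swap]) (by rwa [Sym2.eq_swap]) (by rwa [Sym2.eq_swap]) (by rwa [Sym2.eq_swap]) (by rwa [Sym2.eq_swap]) (by rwa [Sym2.eq_swap]) h']
      exfalso
      rcases K.f_eq h with h | ⟨rfl, rfl⟩ | ⟨rfl, rfl⟩
      · exact hac h
      · rcases K.f_eq h' with h | ⟨rfl, rfl⟩ | ⟨rfl, rfl⟩
        · exact hbd h
        · exact hL.nd _ k1 (by simp)
        · exact k4 rfl
      · rcases K.f_eq h' with h | ⟨rfl, rfl⟩ | ⟨rfl, rfl⟩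
        · exact hbd h
        · exact k6 rfl
        · exact hL.nd _ k1 (by simp)
    intro e he e' he' h
    induction e with | _ a b
    induction e' with | _ c d
    simp only [coe_erase, Set.mem_diff, Set.mem_singleton_iff, mem_coe] at he he'
    rw [Sym2.map_mk, Sym2.map_mk, Sym2.eq_iff] at h
    rcases h with ⟨h, h'⟩ | ⟨h, h'⟩
    · exact key2 a b c d he.1.1 he'.1.1 he.2 he.1.2 he'.2 he'.1.2 h h'
    · rw [Sym2.eq_swap (a := c)] at *
      exact key2 a b d c he.1.1 he'.1.1 he.2 he.1.2 he'.2 he'.1.2 h h'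
  refine ⟨?_, ?_, ?_⟩
  · intro e he
    simp only [L', mem_image, mem_erase] at he
    obtain ⟨e, ⟨k1, k2, k3⟩, rfl⟩ := he
    induction e with | _ a b
    rw [Sym2.map_mk, Sym2.mk_isDiag_iff]
    intro h
    rcases K.f_eq h with h | ⟨rfl, rfl⟩ | ⟨rfl, rfl⟩
    · exact hL.nd _ k3 (by simpa using h)
    · exact k2 rfl
    · exact k2 Sym2.eq_swap
  · rw [L', card_image_of_injOn inj, card_erase_of_mem (mem_erase.2 ⟨hne, h2⟩), card_erase_of_mem h1]
    have := hL.tot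
    have : 0 < (L.erase s(K.u, K.w)).card := card_pos.2 ⟨_, mem_erase.2 ⟨hne, h2⟩⟩
    rw [card_erase_of_mem h1] at this
    omega
  · intro S' hS
    set S := Finset.univ.filter (fun v => K.f v ∈ S') with hSd
    have hsub : K.L' L ∩ S'.sym2 ⊆ (((L ∩ S.sym2).erase s(K.u, K.w)).erase s(K.u, K.x)).image (Sym2.map K.f) := by
      intro e he
      simp only [L', mem_inter, mem_image, mem_erase] at he
      obtain ⟨⟨e, ⟨k1, k2, k3⟩, rfl⟩, h⟩ := he
      refine mem_image_of_mem _ (mem_erase.2 ⟨k1, mem_erase.2 ⟨k2, mem_inter.2 ⟨k3, ?_⟩⟩⟩)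
      induction e with | _ a b
      simpa [hSd] using h
    have hcard := (card_le_card hsub).trans card_image_le
    set S0 := S'.map ⟨Subtype.val, Subtype.val_injective⟩ with hS0
    have c0 : S0.card = S'.card := card_map _
    have m0 : ∀ v, v ∈ S0 ↔ v ≠ K.u ∧ K.f v ∈ S' := by
      intro v; simp only [hS0, mem_map, Function.Embedding.coeFn_mk]
      constructor
      · rintro ⟨s, hs, rfl⟩; exact ⟨s.2, by rwa [f_val]⟩
      · rintro ⟨h, h'⟩; exact ⟨_, h', by rw [K.f_ne h]⟩
    have hu0 : K.u ∉ S0 := fun h => ((m0 _).1 h).1 rfl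
    by_cases hw : K.f K.w ∈ S'
    · have hSi : S = insert K.u S0 := by
        ext v; simp only [hSd, mem_filter, mem_univ, true_and, mem_insert, m0]
        by_cases hv : v = K.u
        · subst hv; simp [← f_w, hw]
        · simp [hv]
      have cS : S.card = S'.card + 1 := by rw [hSi, card_insert_of_notMem hu0, c0]
      have mu : K.u ∈ S := by simp [hSi]
      have mw : K.w ∈ S := by simp [hSd, hw]
      have m1 : s(K.u, K.w) ∈ L ∩ S.sym2 := by simp [h1, mu, mw]
      have cp := card_pos.2 ⟨_, m1⟩
      have hcnt := hL.cnt S (by omega)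
      by_cases hx : K.x ∈ S
      · have m2 : s(K.u, K.x) ∈ (L ∩ S.sym2).erase s(K.u, K.w) := by simp [h2, mu, hx, hne]
        have cp2 := card_pos.2 ⟨_, m2⟩
        rw [card_erase_of_mem m1] at cp2
        rw [card_erase_of_mem m2, card_erase_of_mem m1] at hcard
        omega
      · have : ¬ Tight L S := fun h => hb S h mw mu hx (by omega)
        unfold Tight at this
        have h3 := hcard.trans (card_erase_le)
        rw [card_erase_of_mem m1] at h3
        omega
    · have hSi : S = S0 := by
        ext v; simp only [hSd, mem_filter, mem_univ, true_and, m0]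
        refine ⟨fun h => ⟨?_, h⟩, fun h => h.2⟩
        rintro rfl; rw [← f_w] at h; exact hw h
      have h3 := (hcard.trans card_erase_le).trans card_erase_le
      have := hL.cnt S (by rw [hSi]; omega)
      rw [hSi, c0] at this
      rw [hSi] at h3
      omega

lemma sub' (hs : M.Sub L) : K.M'.Sub (K.L' L) := by
  have T := tab K
  intro e he
  simp only [L', mem_image, mem_erase] at he
  obtain ⟨e, ⟨k1, k2, k3⟩, rfl⟩ := he
  obtain ⟨d, rfl⟩ := hs e k3
  have hr : ¬ K.Rem (K.rep d) := K.ret_rep (by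
      rintro rfl; apply k2; rw [PMap.e, PMap.head, T.t1', T.a4, T.a2]) (by
      rintro rfl; apply k2; rw [PMap.e, PMap.head, T.t1, T.a4, T.a2, Sym2.eq_swap])
  refine ⟨⟨K.rep d, hr⟩, ?_⟩
  rw [PMap.e, head', tail', K.f_rep, K.f_head_rep]; rfl
end CT

open Classical in
lemma contract {V D : Type} [Fintype V] [DecidableEq V] [Fintype D] [DecidableEq D] {M : PMap V D} {L : Finset (Sym2 V)}
    (hL : Laman L) (hs : M.Sub L) (hV : 3 ≤ Fintype.card V) : ∃ K : CT M, ∃ L', Laman L' ∧ K.M'.Sub L' := by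
  obtain ⟨L, d, S⟩ := M.select hL hs hV
  let c3 : Prop := ∃ d1 d2, M.tail d1 = M.tail d ∧ M.tail d2 = M.tail (M.ψ d) ∧ M.head d1 = M.head d2 ∧ M.head d1 ≠ M.tail (M.ψ (M.ψ d))
  have hc : c3 → PMap.FT M {M.e (M.σ d), M.e (M.ψ (M.σ d)), M.e (M.ψ (M.ψ (M.σ d)))} (M.σ d) ∧ M.tail (M.ψ (M.σ d)) ≠ M.tail (M.ψ (M.ψ d)) := by
    rintro ⟨d1, d2, k1, k2, k3, k4⟩
    have := S.common d1 d2 k1 k2 k3 k4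
    exact ⟨this.1, this.2 ▸ k4⟩
  let K : CT M := ⟨d, c3, S.ft.p3, S.ft.out, fun h => (hc h).1.p3, fun h => (hc h).1.out, fun h => (hc h).2,
    fun d1 d2 k1 k2 k3 => by
      by_cases k4 : M.head d1 = M.tail (M.ψ (M.ψ d))
      · exact Or.inl k4
      · exact Or.inr ⟨⟨d1, d2, k1, k2, k3, k4⟩, (S.common d1 d2 k1 k2 k3 k4).2.symm⟩, M.nb S.lam S.sub hV⟩
  have T := CT.tab K
  refine ⟨K, K.L' L, K.lam' S.lam ?_ ?_ S.noblock, K.sub' S.sub⟩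
  · have := S.ft.e2
    rw [PMap.e, show M.ψ d = K.uw from rfl, PMap.head, T.t1', T.a4, T.a2] at this; exact this
  · have := S.ft.e3
    rw [PMap.e, show M.ψ (M.ψ d) = K.xu from rfl, PMap.head, T.t2', T.a6, T.a5, Sym2.eq_swap] at this; exact this
end PTri

namespace PTri
open Finset Complex
set_option linter.all false

/-- counterclockwise angle in `(0,2π]` -/
noncomputable def ccw (a b : ℂ) : ℝ := arg (-(b / a)) + Real.pi
def cr (a b : ℂ) : ℝ := a.re * b.im - a.im * b.re
/-- polar form -/
noncomputable def pl (z : ℂ) (r θ : ℝ) : ℂ := r * (exp (θ * I) * z)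

lemma ccw_pos (a b : ℂ) : 0 < ccw a b := by have := neg_pi_lt_arg (-(b/a)); unfold ccw; linarith
lemma ccw_le (a b : ℂ) : ccw a b ≤ 2 * Real.pi := by have := arg_le_pi (-(b/a)); unfold ccw; linarith

lemma ccw_if (a b : ℂ) : (if 0 < arg (b / a) then arg (b / a) else arg (b / a) + 2 * Real.pi) = if b / a = 0 then 2 * Real.pi else ccw a b := by
  unfold ccw
  generalize b / a = z
  have hp := Real.pi_pos
  by_cases h0 : z = 0
  · simp [h0]
  rw [if_neg h0]
  rcases lt_trichotomy z.im 0 with h1 | h1 | h1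
  · rw [if_neg (by have := arg_neg_iff.2 h1; linarith), arg_neg_eq_arg_add_pi_of_im_neg h1]; ring
  · obtain ⟨x, rfl⟩ : ∃ x : ℝ, z = x := ⟨z.re, Complex.ext (by simp) (by simp [h1])⟩
    have hx : x ≠ 0 := by simpa using h0
    rw [show -(x:ℂ) = ((-x : ℝ) : ℂ) by push_cast; rfl]
    rcases lt_or_gt_of_ne hx with hx | hx
    · rw [arg_ofReal_of_neg hx, arg_ofReal_of_nonneg (by linarith), if_pos hp]; ring
    · rw [arg_ofReal_of_nonneg hx.le, arg_ofReal_of_neg (by linarith), if_neg (lt_irrefl _)]; ring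
  · have h3 : 0 < arg z := by
      rcases (arg_nonneg_iff.2 h1.le).lt_or_eq with h | h
      · exact h
      · have := (arg_eq_zero_iff.1 h.symm).2; linarith
    rw [if_pos h3, arg_neg_eq_arg_sub_pi_of_im_pos h1]; ring

lemma pl_ne {z : ℂ} (hz : z ≠ 0) {r : ℝ} (hr : 0 < r) (θ : ℝ) : pl z r θ ≠ 0 := by
  simp [pl, hz, hr.ne', exp_ne_zero]

lemma ccw_pl {z : ℂ} (hz : z ≠ 0) {r s α β : ℝ} (hr : 0 < r) (hs : 0 < s) (h : 0 < β - α) (h' : β - α ≤ 2 * Real.pi) :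
    ccw (pl z r α) (pl z s β) = β - α := by
  have : -(pl z s β / pl z r α) = (s / r : ℝ) * exp ((β - α - Real.pi : ℝ) * I) := by
    have : ((β - α - Real.pi : ℝ) : ℂ) * I = β * I - α * I - Real.pi * I := by push_cast; ring
    rw [this, exp_sub, exp_sub, exp_pi_mul_I, pl, pl]
    have := exp_ne_zero (α * I)
    have : (r : ℂ) ≠ 0 := by exact_mod_cast hr.ne'
    push_cast; field_simp
  rw [ccw, this, arg_real_mul _ (by positivity), arg_exp_mul_I, toIocMod_eq_self Real.two_pi_pos |>.2]
  · ring
  · constructor <;> linarith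

lemma exists_pl {z x : ℂ} (hz : z ≠ 0) (hx : x ≠ 0) : ∃ r > 0, x = pl z r (ccw z x) := by
  refine ⟨‖x / z‖, norm_pos_iff.2 (div_ne_zero hx hz), ?_⟩
  have h := norm_mul_exp_arg_mul_I (-(x / z))
  rw [pl, ccw]; push_cast
  rw [add_mul, exp_add, exp_pi_mul_I]
  rw [norm_neg] at h
  rw [mul_neg_one, neg_mul, mul_neg, ← mul_assoc, h]; field_simp

lemma pl_zero (z : ℂ) : pl z 1 0 = z := by simp [pl]
lemma pl_smul (z : ℂ) (r s θ : ℝ) : (s : ℂ) * pl z r θ = pl z (s * r) θ := by simp [pl, mul_assoc]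
lemma pl_neg (z : ℂ) (r θ : ℝ) : - pl z r θ = pl z r (θ + Real.pi) := by
  simp only [pl]; push_cast; rw [add_mul, exp_add, exp_pi_mul_I]; ring
lemma pl_sub (z : ℂ) (r θ : ℝ) : pl z r (θ - 2 * Real.pi) = pl z r θ := by
  simp only [pl]; push_cast; rw [sub_mul, exp_sub, exp_two_pi_mul_I]; ring

lemma ccw_self {a : ℂ} (ha : a ≠ 0) : ccw a a = 2 * Real.pi := by
  simp [ccw, ha]; ring
lemma ccw_smul (a b : ℂ) {r s : ℝ} (hr : 0 < r) (hs : 0 < s) : ccw (r * a) (s * b) = ccw a b := by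
  have : -((s:ℂ) * b / (r * a)) = (s / r : ℝ) * (-(b / a)) := by push_cast; rw [mul_div_mul_comm]; ring
  rw [ccw, this, arg_real_mul _ (by positivity), ccw]

lemma cr_pl (z : ℂ) (r s α β : ℝ) : cr (pl z r α) (pl z s β) = r * s * normSq z * Real.sin (β - α) := by
  simp only [cr, pl, exp_mul_I, normSq_apply, Real.sin_sub, ← ofReal_cos, ← ofReal_sin]
  simp only [mul_re, mul_im, add_re, add_im, ofReal_re, ofReal_im, I_re, I_im]; ring

lemma cr_eq {a b : ℂ} (ha : a ≠ 0) (hb : b ≠ 0) : ∃ r > 0, cr a b = r * Real.sin (ccw a b) := by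
  obtain ⟨r, hr, h⟩ := exists_pl ha hb
  refine ⟨r * normSq a, by have := normSq_pos.2 ha; positivity, ?_⟩
  have := cr_pl a 1 r 0 (ccw a b)
  rw [pl_zero, ← h] at this; rw [this]; simp; 

lemma cr_swap (a b : ℂ) : cr a b = - cr b a := by simp [cr]; ring
lemma cr_self (a : ℂ) : cr a a = 0 := by simp [cr]; ring

lemma ccw_lt_pi {a b : ℂ} (ha : a ≠ 0) (hb : b ≠ 0) (h : 0 < cr a b) : ccw a b < Real.pi := by
  obtain ⟨r, hr, k⟩ := cr_eq ha hb
  by_contra! h2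
  have : Real.sin (ccw a b) ≤ 0 := by
    rw [← Real.sin_sub_two_pi]
    exact Real.sin_nonpos_of_nonpos_of_neg_pi_le (by linarith [ccw_le a b]) (by linarith)
  nlinarith
lemma pi_lt_ccw {a b : ℂ} (ha : a ≠ 0) (hb : b ≠ 0) (h : cr a b < 0) : Real.pi < ccw a b := by
  obtain ⟨r, hr, k⟩ := cr_eq ha hb
  by_contra! h2
  have : 0 ≤ Real.sin (ccw a b) := Real.sin_nonneg_of_nonneg_of_le_pi (ccw_pos a b).le h2
  nlinarith
lemma ccw_ne_pi {a b : ℂ} (ha : a ≠ 0) (hb : b ≠ 0) (h : cr a b ≠ 0) : ccw a b ≠ Real.pi := by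
  rcases lt_or_gt_of_ne h with h | h
  · exact (pi_lt_ccw ha hb h).ne'
  · exact (ccw_lt_pi ha hb h).ne

open Filter Topology
lemma ccw_tendsto {f g : ℝ → ℂ} {l : Filter ℝ} {a b : ℂ} (hf : Tendsto f l (𝓝 a)) (hg : Tendsto g l (𝓝 b)) (ha : a ≠ 0) (hb : b ≠ 0)
    (h : cr a b ≠ 0) : Tendsto (fun x => ccw (f x) (g x)) l (𝓝 (ccw a b)) := by
  have hc : ContinuousAt arg (-(b / a)) := by
    refine continuousAt_arg (Or.inr ?_)
    intro k
    apply h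
    have : b = -((-(b/a)).re : ℝ) * a := by
      have h3 : (-(b / a)) = (((-(b/a)).re : ℝ) : ℂ) := Complex.ext (by simp) (by rw [k]; simp)
      rw [← h3]; field_simp
    rw [this]; simp [cr]; ring
  exact ((hc.tendsto.comp ((hg.div hf ha).neg)).add tendsto_const_nhds)

lemma im_div (a b : ℂ) : (b / a).im = cr a b / normSq a := by
  simp [div_im, cr]; ring

lemma ccw_tendsto_zero {f g : ℝ → ℂ} {l : Filter ℝ} {a : ℂ} (hf : Tendsto f l (𝓝 a)) (hg : Tendsto g l (𝓝 a)) (ha : a ≠ 0)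
    (h : ∀ᶠ x in l, 0 < cr (f x) (g x)) : Tendsto (fun x => ccw (f x) (g x)) l (𝓝 0) := by
  have h1 : Tendsto (fun x => -(g x / f x)) l (𝓝[{z | z.im < 0}] (-1)) := by
    refine tendsto_nhdsWithin_iff.2 ⟨by have := (hg.div hf ha).neg; rwa [div_self ha] at this, ?_⟩
    filter_upwards [h, hf.eventually_ne ha] with x hx h0
    simp only [Set.mem_setOf_eq, neg_im, im_div]
    have := normSq_pos.2 h0
    have := div_pos hx this; linarith
  have := ((tendsto_arg_nhdsWithin_im_neg_of_re_neg_of_im_zero (z := -1) (by simp) (by simp)).comp h1).add_const Real.pi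
  rwa [neg_add_cancel] at this
lemma ccw_tendsto_two {f g : ℝ → ℂ} {l : Filter ℝ} {a : ℂ} (hf : Tendsto f l (𝓝 a)) (hg : Tendsto g l (𝓝 a)) (ha : a ≠ 0)
    (h : ∀ᶠ x in l, cr (f x) (g x) ≤ 0) : Tendsto (fun x => ccw (f x) (g x)) l (𝓝 (2 * Real.pi)) := by
  have h1 : Tendsto (fun x => -(g x / f x)) l (𝓝[{z | 0 ≤ z.im}] (-1)) := by
    refine tendsto_nhdsWithin_iff.2 ⟨by have := (hg.div hf ha).neg; rwa [div_self ha] at this, ?_⟩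
    filter_upwards [h, hf.eventually_ne ha] with x hx h0
    simp only [Set.mem_setOf_eq, neg_im, im_div]
    have := normSq_pos.2 h0
    have := div_nonpos_of_nonpos_of_nonneg hx this.le; linarith
  have := ((tendsto_arg_nhdsWithin_im_nonneg_of_re_neg_of_im_zero (z := -1) (by simp) (by simp)).comp h1).add_const Real.pi
  rwa [← two_mul] at this

/-- sums of angles around a closed cycle of directions -/
lemma sum_ccw {D : Type} [DecidableEq D] (S : Finset D) (σ : Equiv.Perm D) (hσ : ∀ d, σ d ∈ S ↔ d ∈ S) (N : D → ℂ) (hN : ∀ d ∈ S, N d ≠ 0)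
    (h0 : S.Nonempty) : ∃ k : ℕ, 1 ≤ k ∧ ∑ d ∈ S, ccw (N d) (N (σ d)) = 2 * Real.pi * k := by
  have e1 : exp ((∑ d ∈ S, ccw (N d) (N (σ d)) : ℝ) * I) = 1 := by
    push_cast; rw [sum_mul, exp_sum]
    have : ∀ d ∈ S, exp (ccw (N d) (N (σ d)) * I) = (N (σ d) / ‖N (σ d)‖) / (N d / ‖N d‖) := by
      intro d hd
      have h1 := hN d hd; have h2 := hN _ ((hσ d).2 hd)
      have h := norm_mul_exp_arg_mul_I (-(N (σ d) / N d))
      rw [norm_neg, norm_div] at h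
      have n1 : (‖N d‖ : ℂ) ≠ 0 := by simpa using h1
      have n2 : (‖N (σ d)‖ : ℂ) ≠ 0 := by simpa using h2
      rw [ccw]; push_cast at h ⊢; rw [add_mul, exp_add, exp_pi_mul_I]
      field_simp at h ⊢
      linear_combination -h
    rw [prod_congr rfl this, prod_div_distrib]
    rw [show ∏ d ∈ S, N (σ d) / ‖N (σ d)‖ = ∏ d ∈ S, N d / ‖N d‖ from
      prod_bij (fun d _ => σ d) (fun d hd => (hσ d).2 hd) (fun _ _ _ _ h => σ.injective h)
        (fun b hb => ⟨σ.symm b, by rw [← hσ]; simpa using hb, by simp⟩) (fun _ _ => rfl)]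
    refine div_self (prod_ne_zero_iff.2 fun d hd => div_ne_zero (hN d hd) (by simpa using hN d hd))
  obtain ⟨n, hn⟩ := (exp_eq_one_iff).1 e1
  have hn' : ∑ d ∈ S, ccw (N d) (N (σ d)) = 2 * Real.pi * n := by
    have := congrArg Complex.im hn; simpa [mul_comm] using this
  have hp : 0 < ∑ d ∈ S, ccw (N d) (N (σ d)) := sum_pos (fun d _ => ccw_pos _ _) h0
  have : (0:ℝ) < n := by rw [hn'] at hp; exact pos_of_mul_pos_right hp (by positivity)
  have : 0 < n := by exact_mod_cast this
  obtain ⟨k, rfl⟩ := Int.eq_ofNat_of_zero_le this.le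
  exact ⟨k, by omega, by rw [hn']; simp⟩
end PTri

namespace PTri
open Finset Complex
set_option linter.all false
namespace PMap
variable {V D : Type} [Fintype V] [DecidableEq V] [Fintype D] [DecidableEq D] (M : PMap V D)
def dir (P : V → ℂ) (d : D) : ℂ := P (M.head d) - P (M.tail d)
noncomputable def ang (P : V → ℂ) (d : D) : ℝ := ccw (M.dir P d) (M.dir P (M.σ d))
open Classical in
structure Good (P : V → ℂ) : Prop where
  inj : Function.Injective P
  gp : ∀ a b c, a ≠ b → a ≠ c → b ≠ c → cr (P b - P a) (P c - P a) ≠ 0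
  nc : ∀ d d', M.tail d ≠ M.tail d' → M.tail d ≠ M.head d' → M.head d ≠ M.tail d' → M.head d ≠ M.head d' →
    Disjoint (segment ℝ (P (M.tail d)) (P (M.head d))) (segment ℝ (P (M.tail d')) (P (M.head d')))
  sum : ∀ v, ∑ d ∈ Finset.univ.filter (fun d => M.tail d = v), M.ang P d = 2 * Real.pi
  outer : ∀ d, M.ψ.SameCycle d M.o → Real.pi < M.ang P d
  bnd : ∀ d, ¬ M.ψ.SameCycle d M.o → (Finset.univ.filter (fun d' => M.ψ.SameCycle d d' ∧ M.ang P d' < Real.pi)).card = 3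
variable {M} {P : V → ℂ}
lemma Good.ne (h : M.Good P) (d : D) : M.dir P d ≠ 0 := sub_ne_zero.2 fun k => M.ne_head d (h.inj k).symm
end PMap

namespace CT
variable {V D : Type} [Fintype V] [DecidableEq V] [Fintype D] [DecidableEq D] {M : PMap V D} (K : CT M)

lemma sc₀ (n : ℕ) : ∀ x, x ≠ K.wu → (M.ψ ^ n) x ≠ K.wu → K.ψ₀.SameCycle x ((M.ψ ^ n) x) := by
  induction n using Nat.strong_induction_on with
  | _ n ih =>
    intro x hx hy
    match n, ih, hy with
    | 0, _, _ => exact Equiv.Perm.SameCycle.refl _ _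
    | 1, ih, hy => rw [pow_one] at *; rw [← K.ψ₀_eq hx hy]; exact Equiv.Perm.sameCycle_apply_right.2 (.refl _ _)
    | n+2, ih, hy =>
      by_cases h : M.ψ x = K.wu
      · have e : (M.ψ ^ (n+2)) x = (M.ψ ^ n) (K.ψ₀ x) := by rw [K.ψ₀_eq' h, ← h, pow_add]; rfl
        rw [e] at hy ⊢
        refine Equiv.Perm.sameCycle_apply_left.1 (ih n (by omega) _ ?_ hy)
        intro k; rw [← K.ψ₀_wu] at k; exact hx (K.ψ₀.injective k)
      · have e : (M.ψ ^ (n+2)) x = (M.ψ ^ (n+1)) (K.ψ₀ x) := by rw [K.ψ₀_eq hx h, pow_succ]; rfl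
        rw [e] at hy ⊢
        refine Equiv.Perm.sameCycle_apply_left.1 (ih (n+1) (by omega) _ ?_ hy)
        intro k; rw [← K.ψ₀_wu] at k; exact hx (K.ψ₀.injective k)

lemma sc₁ (n : ℕ) (x : D) : M.ψ.SameCycle x ((K.ψ₀ ^ n) x) := by
  induction n with
  | zero => exact .refl _ _
  | succ n ih =>
    rw [pow_succ', Equiv.Perm.mul_apply]
    refine ih.trans ?_
    generalize (K.ψ₀ ^ n) x = z
    by_cases h1 : z = K.wu
    · rw [h1, ψ₀_wu]
    by_cases h : M.ψ z = K.wu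
    · rw [K.ψ₀_eq' h, ← h]; exact Equiv.Perm.sameCycle_apply_right.2 (Equiv.Perm.sameCycle_apply_right.2 (.refl _ _))
    · rw [K.ψ₀_eq h1 h]; exact Equiv.Perm.sameCycle_apply_right.2 (.refl _ _)

lemma ψ_M' : K.M'.ψ = K.ψ' := by
  ext1 e; exact Subtype.ext (K.rep_τ (K.ψ' e).2).2

lemma sc (e e' : K.D') : K.M'.ψ.SameCycle e e' ↔ M.ψ.SameCycle e.1 e'.1 := by
  rw [ψ_M', ψ', Equiv.Perm.sameCycle_subtypePerm]
  constructor
  · intro h; obtain ⟨n, -, h⟩ := h.exists_pow_eq'; rw [← h]; exact K.sc₁ n _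
  · intro h; obtain ⟨n, -, h⟩ := h.exists_pow_eq'
    have := K.sc₀ n e.1 (K.nrem.1 e.2).2.2.2.1 (by rw [h]; exact (K.nrem.1 e'.2).2.2.2.1)
    rwa [h] at this

lemma sc_o (e : K.D') : K.M'.ψ.SameCycle e K.M'.o ↔ M.ψ.SameCycle e.1 M.o := by
  rw [sc]; show M.ψ.SameCycle e.1 (if M.o = K.wu then M.ψ M.o else M.o) ↔ _
  split_ifs
  · exact Equiv.Perm.sameCycle_apply_right
  · rfl

lemma sum_rem {A : Type} [AddCommMonoid A] (F : D → A) : ∑ e, F e = ∑ e : K.D', F e.1 + (F K.wx + F K.uw + F K.xu + F K.wu) +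
    (open Classical in if K.c3 then F K.uy + F K.yw else 0) := by
  classical
  have T := tab K
  obtain ⟨i1, i2, i3, i4, i5, i6, i7, i8, i9, i10⟩ := K.iffs
  have n1 := T.n1; have n2 := T.n2; have n3 := T.n3; have n4 := T.n4
  have m1 := n1.symm; have m2 := n2.symm; have m3 := n3.symm; have m4 := n4.symm
  have d1 : K.wx ≠ K.uw := by simp [i3, T.a1, m1]
  have d2 : K.wx ≠ K.xu := by simp [i5, T.a1, n3]
  have d3 : K.wx ≠ K.wu := by rw [Ne, i4, PMap.head, T.t3', T.a7]; simp [m2]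
  have d4 : K.uw ≠ K.xu := by simp [i5, T.a4, n2]
  have d5 : K.uw ≠ K.wu := by simp [i4, T.a4, n1]
  have d6 : K.xu ≠ K.wu := by simp [i4, T.a6, m3]
  rw [← Finset.sum_filter_add_sum_filter_not Finset.univ (fun e => ¬ K.Rem e), add_assoc]
  congr 1
  · exact (Finset.sum_subtype _ (by simp) _)
  · simp only [not_not]
    by_cases hc : K.c3
    · have n5 := T.n5 hc; have n6 := T.n6 hc; have a10 := T.a10 hc
      have h0 : Finset.univ.filter (fun e => K.Rem e) = {K.wx, K.uw, K.xu, K.wu, K.uy, K.yw} := by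
        ext e; simp [Rem, hc]
      have d7 : K.uy ≠ K.yw := by simp [i8, a10, n5.symm]
      have d8 : K.wu ≠ K.uy := by intro h; have := T.a2; rw [h, a10] at this; exact n1 this
      have d9 : K.wu ≠ K.yw := by simp [i8, T.a2, n4]
      have d10 : K.xu ≠ K.uy := by intro h; have := T.a6; rw [h, a10] at this; exact n2 this
      have d11 : K.xu ≠ K.yw := by simp [i8, T.a6, (T.n6 hc).symm]
      have d12 : K.uw ≠ K.uy := by rw [Ne, i10 hc, PMap.head, T.t1', T.a2]; simp [n4]
      have d13 : K.uw ≠ K.yw := by simp [i8, T.a4, n5.symm]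
      have d14 : K.wx ≠ K.uy := by intro h; have := T.a1; rw [h, a10] at this; exact n1 this
      have d15 : K.wx ≠ K.yw := by simp [i8, T.a1, n4]
      rw [h0, if_pos hc, sum_insert, sum_insert, sum_insert, sum_insert, sum_insert, sum_singleton]
      · simp only [add_assoc]
      all_goals simp [d1,d2,d3,d4,d5,d6,d7,d8,d9,d10,d11,d12,d13,d14,d15]
    · have h0 : Finset.univ.filter (fun e => K.Rem e) = {K.wx, K.uw, K.xu, K.wu} := by
        ext e; simp [Rem, hc]
      rw [h0, if_neg hc, sum_insert, sum_insert, sum_insert, sum_singleton, add_zero]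
      · simp only [add_assoc]
      all_goals simp [d1,d2,d3,d4,d5,d6]
end CT
end PTri

namespace PTri
open Finset Complex
set_option linter.all false
lemma cr_tr {a b z : ℂ} (hz : z ≠ 0) (h1 : cr a z = 0) (h2 : cr b z = 0) : cr a b = 0 := by
  unfold cr at *
  by_contra h
  have e1 : z.re * (a.re * b.im - a.im * b.re) = 0 := by linear_combination b.re * h1 - a.re * h2
  have e2 : z.im * (a.re * b.im - a.im * b.re) = 0 := by linear_combination b.im * h1 - a.im * h2
  exact hz (Complex.ext ((mul_eq_zero.1 e1).resolve_right h) ((mul_eq_zero.1 e2).resolve_right h))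
namespace CT
variable {V D : Type} [Fintype V] [DecidableEq V] [Fintype D] [DecidableEq D] {M : PMap V D} (K : CT M)
  (P' : {v // v ≠ K.u} → ℂ)
def q (v : V) : ℂ := P' (K.f v)
def k (d : D) : ℂ := K.q P' (M.head d) - K.q P' (M.tail d)
def z0 : ℂ := K.k P' K.ux
noncomputable def Θ1 (d : D) : ℝ := ccw (K.z0 P') (K.k P' d)
open Classical in
noncomputable def Θ (d : D) : ℝ := if K.Θ1 P' d = 2 * Real.pi then 0 else K.Θ1 P' d
variable {P'}
lemma k_rep (d : D) : K.k P' (K.rep d) = K.k P' d := by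
  simp only [k, q, f_rep, f_head_rep]
lemma q_w : K.q P' K.w = K.q P' K.u := by rw [q, f_w]; rfl
lemma dir' (e : K.D') : K.M'.dir P' e = K.k P' e.1 := by rw [PMap.dir, head', tail']; rfl
lemma ang' (e : K.D') : K.M'.ang P' e = ccw (K.k P' e.1) (K.k P' (K.σ' e).1) := by
  rw [PMap.ang, dir', dir']; rfl
lemma ang'_1 (e : K.D') (h : M.σ e.1 ≠ K.uw) : K.M'.ang P' e = ccw (K.k P' e.1) (K.k P' (M.σ e.1)) := by
  rw [ang', σ'_eq _ _ h, k_rep]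
lemma ang'_2 (e : K.D') (h : M.σ e.1 = K.uw) : K.M'.ang P' e = ccw (K.k P' e.1) (K.k P' (M.σ K.wu)) := by
  rw [ang', σ'_eq' _ _ h, k_rep]
lemma Θ1_rep (d : D) : K.Θ1 P' (K.rep d) = K.Θ1 P' d := by simp only [Θ1, k_rep]
lemma Θ_rep (d : D) : K.Θ P' (K.rep d) = K.Θ P' d := by simp only [Θ, Θ1_rep]
lemma Θ_mem (d : D) : 0 ≤ K.Θ P' d ∧ K.Θ P' d < 2 * Real.pi := by
  have h1 := ccw_pos (K.z0 P') (K.k P' d)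
  have h2 := ccw_le (K.z0 P') (K.k P' d)
  have := Real.pi_pos
  unfold Θ; split_ifs with h
  · constructor <;> linarith
  · exact ⟨h1.le, lt_of_le_of_ne h2 h⟩
variable (h : K.M'.Good P')
include h
lemma k_ne {d : D} (h1 : d ≠ K.uw) (h2 : d ≠ K.wu) : K.k P' d ≠ 0 := by
  rw [← k_rep]; have := h.ne ⟨K.rep d, K.ret_rep h1 h2⟩; rwa [dir'] at this
lemma q_ne {a b : V} (hn : K.f a ≠ K.f b) : K.q P' a ≠ K.q P' b := fun k => hn (h.inj k)
lemma ux_ne : K.ux ≠ K.uw ∧ K.ux ≠ K.wu := by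
  have := K.nrem.1 K.ret_ux; exact ⟨this.2.1, this.2.2.2.1⟩
lemma z0_ne : K.z0 P' ≠ 0 := K.k_ne h (K.ux_ne h).1 (K.ux_ne h).2
lemma Θ1_pl {d : D} (h1 : d ≠ K.uw) (h2 : d ≠ K.wu) : ∃ r > 0, K.k P' d = pl (K.z0 P') r (K.Θ1 P' d) :=
  exists_pl (K.z0_ne h) (K.k_ne h h1 h2)
lemma Θ_pl {d : D} (h1 : d ≠ K.uw) (h2 : d ≠ K.wu) : ∃ r > 0, K.k P' d = pl (K.z0 P') r (K.Θ P' d) := by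
  obtain ⟨r, hr, e⟩ := K.Θ1_pl h h1 h2
  refine ⟨r, hr, ?_⟩
  unfold Θ; split_ifs with h
  · rw [h] at e; rw [e, ← pl_sub]; simp
  · exact e
lemma Θ1_ux : K.Θ1 P' K.ux = 2 * Real.pi := ccw_self (K.z0_ne h)
lemma cr_k {d d' : D} (h1 : ¬ K.Rem d) (h2 : ¬ K.Rem d') (ht : K.f (M.tail d) = K.f (M.tail d')) (hh : d ≠ d') :
    cr (K.k P' d) (K.k P' d') ≠ 0 := by
  have g := h.gp (K.f (M.tail d)) (K.f (M.head d)) (K.f (M.head d')) (K.noloop' ⟨d, h1⟩)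
    (by rw [ht]; exact K.noloop' ⟨d', h2⟩) (fun k => hh (congrArg Subtype.val (K.simple' ⟨d, h1⟩ ⟨d', h2⟩ ht k)))
  rwa [show P' (K.f (M.head d')) - P' (K.f (M.tail d)) = K.k P' d' by rw [ht]; rfl] at g
lemma Θ_eq {d : D} (h1 : ¬ K.Rem d) (ht : K.f (M.tail d) = K.f K.u) (hx : d ≠ K.ux) : K.Θ P' d = K.Θ1 P' d := by
  unfold Θ; rw [if_neg]; intro hp
  obtain ⟨r, hr, e⟩ := K.Θ1_pl h (K.nrem.1 h1).2.1 (K.nrem.1 h1).2.2.2.1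
  apply K.cr_k h h1 K.ret_ux (by rw [ht, (tab K).a5]) hx
  change cr _ (K.z0 P') = 0
  rw [e, hp, ← pl_sub]; conv => enter [1,2]; rw [← pl_zero (K.z0 P')]
  rw [cr_pl]; simp
lemma wrap (e : K.D') (ht : K.f (M.tail e.1) = K.f K.u) : K.Θ P' e.1 + K.M'.ang P' e = K.Θ1 P' (K.σ' e).1 := by
  classical
  have ex : ∀ e : K.D', ∃ k : ℕ, K.Θ P' e.1 + K.M'.ang P' e = K.Θ1 P' (K.σ' e).1 + 2 * Real.pi * k := by
    intro e
    have n1 := K.nrem.1 e.2; have n2 := K.nrem.1 (K.σ' e).2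
    obtain ⟨r, hr, e1⟩ := K.Θ_pl h n1.2.1 n1.2.2.2.1
    obtain ⟨s, hs, e2⟩ := K.Θ1_pl h n2.2.1 n2.2.2.2.1
    obtain ⟨m1, m2⟩ := K.Θ_mem (P' := P') e.1
    have m3 : 0 < K.Θ1 P' (K.σ' e).1 := ccw_pos _ _
    have m4 : K.Θ1 P' (K.σ' e).1 ≤ 2 * Real.pi := ccw_le _ _
    rw [ang', e1, e2]
    by_cases c : K.Θ P' e.1 < K.Θ1 P' (K.σ' e).1
    · refine ⟨0, ?_⟩
      rw [ccw_pl (K.z0_ne h) hr hs (by linarith) (by linarith)]; simp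
    · refine ⟨1, ?_⟩
      rw [show pl (K.z0 P') s (K.Θ1 P' (K.σ' e).1) = pl (K.z0 P') s (K.Θ1 P' (K.σ' e).1 + 2 * Real.pi) by rw [← pl_sub _ _ (_ + _)]; simp]
      rw [ccw_pl (K.z0_ne h) hr hs (by linarith) (by linarith)]; simp
  choose k hk using ex
  set S := Finset.univ.filter (fun e : K.D' => K.M'.tail e = K.f K.u) with hS
  have hs := h.sum (K.f K.u)
  have s1 : ∑ e ∈ S, K.Θ1 P' (K.σ' e).1 = ∑ e ∈ S, K.Θ1 P' e.1 := by
    apply Finset.sum_equiv K.σ'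
    · intro e; simp only [hS, Finset.mem_filter, Finset.mem_univ, true_and]
      rw [show K.M'.tail (K.σ' e) = K.M'.tail e from K.M'.tail_σ e]
    · simp
  have s2 : ∑ e ∈ S, K.Θ1 P' e.1 = ∑ e ∈ S, K.Θ P' e.1 + 2 * Real.pi := by
    have hm : (⟨K.ux, K.ret_ux⟩ : K.D') ∈ S := Finset.mem_filter.2 ⟨Finset.mem_univ _, by rw [tail', (tab K).a5]⟩
    rw [← Finset.add_sum_erase _ _ hm, ← Finset.add_sum_erase _ _ hm]
    rw [show K.Θ P' K.ux = 0 by simp [Θ, K.Θ1_ux h], K.Θ1_ux h, Finset.sum_congr rfl (g := fun e => K.Θ P' e.1)]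
    · ring
    · intro e he
      simp only [Finset.mem_erase, hS, Finset.mem_filter, Finset.mem_univ, true_and] at he
      exact (K.Θ_eq h e.2 he.2 (fun k => he.1 (Subtype.ext k))).symm
  have s3 := Finset.sum_congr (rfl : S = S) (fun e _ => hk e)
  rw [Finset.sum_add_distrib, Finset.sum_add_distrib, ← Finset.mul_sum, s1, s2] at s3
  have s4 : ∑ e ∈ S, (k e : ℝ) = 0 := by
    have hp := Real.pi_pos
    have hs : ∑ e ∈ S, K.M'.ang P' e = 2 * Real.pi := by convert hs
    rw [hs] at s3
    have : 2 * Real.pi * ∑ e ∈ S, (k e : ℝ) = 0 := by linarith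
    rcases mul_eq_zero.1 this with h | h
    · linarith
    · exact h
  have s5 := (Finset.sum_eq_zero_iff_of_nonneg (fun i _ => Nat.cast_nonneg (k i))).1 s4 e (Finset.mem_filter.2 ⟨Finset.mem_univ _, ht⟩)
  have := hk e; rw [s5] at this; simpa using this

omit h in
lemma bu_def : M.σ (M.σ.symm K.uw) = K.uw := M.σ.apply_symm_apply _
omit h in
lemma bu_tail : M.tail (M.σ.symm K.uw) = K.u := by rw [← M.tail_σ, bu_def, (tab K).a4]
omit h in
lemma u_ne_wu {d : D} (hd : M.tail d = K.u) : d ≠ K.wu := fun k => (tab K).n1 (by rw [← hd, k, (tab K).a2])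
omit h in
lemma w_ne_uw {d : D} (hd : M.tail d = K.w) : d ≠ K.uw := fun k => (tab K).n1 (by rw [← hd, k, (tab K).a4])
omit h in
lemma bu_ne : M.σ.symm K.uw ≠ K.uw := fun k => by
  have h1 := K.bu_def; rw [k, (tab K).s2] at h1
  have := K.nrem.1 K.ret_ux; exact this.2.1 h1
omit h in
lemma wy_ne : M.σ K.wu ≠ K.wu := fun k => by
  have h1 := M.σ.injective (k.trans (tab K).s1.symm)
  have := (tab K).a7
  apply (tab K).n2; rw [← (tab K).a4, ← (tab K).a7, ← (tab K).t1, h1, (tab K).t3']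
omit h in
lemma wy_tail : M.tail (M.σ K.wu) = K.w := (tab K).a3
omit h in
lemma ret_u {d : D} (hd : M.tail d = K.u) (hn : d ≠ K.uw) (hn' : M.σ d ≠ K.uw) : ¬ K.Rem d := by
  have T := tab K
  rw [K.nrem]
  refine ⟨?_, hn, ?_, K.u_ne_wu hd, fun c => ⟨?_, ?_⟩⟩
  · rintro rfl; exact T.n1 (hd.symm.trans T.a1)
  · rintro rfl; exact T.n2 (hd.symm.trans T.a6)
  · rintro rfl; exact hn' (T.s6 c)
  · rintro rfl; exact T.n5 c (T.a8.symm.trans hd)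
omit h in
lemma ret_w {d : D} (hd : M.tail d = K.w) (hn : d ≠ K.wu) (hn' : M.σ d ≠ K.wu) : ¬ K.Rem d := by
  have T := tab K
  rw [K.nrem]
  refine ⟨?_, K.w_ne_uw hd, ?_, hn, fun c => ⟨?_, ?_⟩⟩
  · rintro rfl; exact hn' T.s1
  · rintro rfl; exact T.n3 (hd.symm.trans T.a6)
  · rintro rfl; exact T.n1 ((T.a10 c).symm.trans hd)
  · rintro rfl; exact T.n4 (hd.symm.trans T.a8)
lemma α_le {d : D} (hd : M.tail d = K.u) (hn : d ≠ K.uw) : K.Θ P' d ≤ K.Θ P' (M.σ.symm K.uw) := by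
  by_contra hc
  have := M.trans (fun d => M.tail d = K.u ∧ d ≠ K.uw ∧ ¬ K.Θ P' d ≤ K.Θ P' (M.σ.symm K.uw)) ?_ d K.uw (by rw [hd, (tab K).a4]) ⟨hd, hn, hc⟩
  · exact this.2.1 rfl
  rintro d ⟨hd, hn, hc⟩
  have h1 : M.σ d ≠ K.uw := fun k => hc (by rw [← k]; simp)
  have hr := K.ret_u hd hn h1
  have h2 : M.tail (M.σ d) = K.u := by rw [M.tail_σ, hd]
  refine ⟨h2, h1, fun c => hc (le_trans ?_ c)⟩
  have w := K.wrap h ⟨d, hr⟩ (by rw [hd])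
  have a := ccw_pos (K.k P' d) (K.k P' (M.σ d))
  rw [ang'_1 _ _ h1, σ'_eq _ _ h1, ← K.Θ_eq h (K.ret_rep h1 (K.u_ne_wu h2)) (by rw [f_rep, h2]) ?_, Θ_rep] at w
  · dsimp only at w; linarith
  · have T := tab K
    have n := h1
    intro k
    by_cases hw : K.Rem (M.σ d)
    · rcases hw with e | e | e | e | ⟨c, e | e⟩
      · rw [e, T.a1] at h2; exact T.n1 h2.symm
      · exact n e
      · rw [e, T.a6] at h2; exact T.n2 h2.symm
      · exact K.u_ne_wu h2 e
      · rw [e, K.rep_uy c] at k; have := T.a3; rw [k, T.a5] at this; exact T.n1 this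
      · rw [e, T.a8] at h2; exact T.n5 c h2
    · rw [K.rep_ret hw, ← T.s2] at k; exact hn (M.σ.injective k)
lemma β_le {d : D} (hd : M.tail d = K.w) (hn : d ≠ K.wu) : K.Θ1 P' (M.σ K.wu) ≤ K.Θ1 P' d := by
  have := M.trans (fun d => M.tail d = K.w ∧ (d = K.wu ∨ K.Θ1 P' (M.σ K.wu) ≤ K.Θ1 P' d)) ?_ K.wu d (by rw [hd, (tab K).a2]) ⟨(tab K).a2, .inl rfl⟩
  · exact this.2.resolve_left hn
  rintro d ⟨hd, hc⟩
  refine ⟨by rw [M.tail_σ, hd], ?_⟩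
  by_cases e1 : d = K.wu
  · right; rw [e1]
  by_cases e2 : M.σ d = K.wu
  · left; exact e2
  right
  refine (hc.resolve_left e1).trans ?_
  have hr := K.ret_w hd e1 e2
  have h1 : M.σ d ≠ K.uw := K.w_ne_uw (by rw [M.tail_σ, hd])
  have w := K.wrap h ⟨d, hr⟩ (by rw [hd, f_w])
  have a := ccw_pos (K.k P' d) (K.k P' (M.σ d))
  rw [ang'_1 _ _ h1, σ'_eq _ _ h1, Θ1_rep, K.Θ_eq h hr (by rw [hd, f_w])] at w
  · dsimp only at w; linarith
  · rintro rfl; exact (tab K).n1 ((tab K).a5.symm.trans hd)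
lemma αβ3 (c : K.c3) : K.Θ P' (M.σ.symm K.uw) = K.Θ1 P' (M.σ K.wu) := by
  have T := tab K
  rw [← T.s6 c, Equiv.symm_apply_apply, ← Θ_rep, K.rep_uy c, T.s4, K.Θ_eq h (K.ret_wy c) (by rw [T.a3, f_w])]
  intro k; exact T.n1 (by rw [← T.a5, ← k, T.a3])
omit h in
lemma ar_eq (c : ¬ K.c3) : K.ar = M.σ.symm K.uw := by simp [ar, c]
lemma αβ2 (c : ¬ K.c3) : K.Θ P' (M.σ.symm K.uw) + K.M'.ang P' ⟨K.ar, K.ret_ar⟩ = K.Θ1 P' (M.σ K.wu) := by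
  have := K.wrap h ⟨K.ar, K.ret_ar⟩ (by rw [K.tail_ar])
  rw [σ'_ar, Θ1_rep] at this
  rw [← this, ← K.ar_eq c]
lemma αβ : K.Θ P' (M.σ.symm K.uw) ≤ K.Θ1 P' (M.σ K.wu) := by
  by_cases c : K.c3
  · exact (K.αβ3 h c).le
  · have := ccw_pos (K.k P' K.ar) (K.k P' (K.σ' ⟨K.ar, K.ret_ar⟩).1)
    rw [← K.αβ2 h c, ang']; simp only; linarith



end CT
end PTri

namespace PTri
open Finset Complex
set_option linter.all false
namespace CT
variable {V D : Type} [Fintype V] [DecidableEq V] [Fintype D] [DecidableEq D] {M : PMap V D} (K : CT M)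
  (P' : {v // v ≠ K.u} → ℂ)
noncomputable def α : ℝ := K.Θ P' (M.σ.symm K.uw)
noncomputable def β : ℝ := K.Θ1 P' (M.σ K.wu)
structure Del (δ : ℝ) (c : ℂ) : Prop where
  hc : c = pl (K.z0 P') 1 δ
  h0 : 0 < δ
  hp : δ < Real.pi
  ha : K.α P' - Real.pi < δ
  hb : δ < K.β P'
  gen : ∀ v, v ≠ K.u → v ≠ K.w → cr c (K.q P' v - K.q P' K.u) ≠ 0
  l1 : ¬ K.c3 → Real.pi < K.β P' - K.α P' → K.α P' < δ ∧ δ < K.β P' - Real.pi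
  l2 : ¬ K.c3 → K.β P' - K.α P' < Real.pi → (K.α P' < δ ∧ K.β P' - Real.pi < δ) ∨ (δ < K.α P' ∧ δ < K.β P' - Real.pi)
variable {P'} (h : K.M'.Good P')
include h
lemma wy_ne2 : M.σ K.wu ≠ K.uw ∧ M.σ K.wu ≠ K.wu := ⟨K.w_ne_uw K.wy_tail, K.wy_ne⟩
lemma exists_Del : ∃ δ c, K.Del P' δ c := by
  have hp := Real.pi_pos
  obtain ⟨a0, a1⟩ := K.Θ_mem (P' := P') (M.σ.symm K.uw)
  have b0 : 0 < K.β P' := ccw_pos _ _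
  have b1 : K.β P' ≤ 2 * Real.pi := ccw_le _ _
  change 0 ≤ K.α P' at a0
  change K.α P' < _ at a1
  have ab : K.α P' ≤ K.β P' := K.αβ h
  have ab2 : ¬ K.c3 → K.α P' < K.β P' := fun c => by
    have := K.αβ2 h c; change K.α P' + _ = K.β P' at this
    have := ccw_pos (K.k P' K.ar) (K.k P' (K.σ' ⟨K.ar, K.ret_ar⟩).1)
    rw [← ang' K ⟨K.ar, K.ret_ar⟩] at this; linarith
  have ab3 : K.c3 → K.α P' = K.β P' := K.αβ3 h
  have key : ∃ lo hi : ℝ, lo < hi ∧ ∀ δ, lo < δ → δ < hi → 0 < δ ∧ δ < Real.pi ∧ K.α P' - Real.pi < δ ∧ δ < K.β P' ∧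
      (¬ K.c3 → Real.pi < K.β P' - K.α P' → K.α P' < δ ∧ δ < K.β P' - Real.pi) ∧
      (¬ K.c3 → K.β P' - K.α P' < Real.pi → (K.α P' < δ ∧ K.β P' - Real.pi < δ) ∨ (δ < K.α P' ∧ δ < K.β P' - Real.pi)) := by
    generalize K.α P' = α at *
    generalize K.β P' = β at *
    by_cases c : K.c3
    · have := ab3 c; subst this
      refine ⟨max 0 (α - Real.pi), min Real.pi α, by simp only [max_lt_iff, lt_min_iff]; constructor <;> constructor <;> linarith, ?_⟩
      intro δ h1 h2
      rw [max_lt_iff] at h1; rw [lt_min_iff] at h2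
      exact ⟨h1.1, h2.1, h1.2, h2.2, fun k => absurd c k, fun k => absurd c k⟩
    have ab := ab2 c
    by_cases m : Real.pi < β - α
    · refine ⟨α, β - Real.pi, by linarith, ?_⟩
      intro δ h1 h2
      refine ⟨by linarith, by linarith, by linarith, by linarith, fun _ _ => ⟨h1, h2⟩, fun _ k => by linarith⟩
    by_cases b : Real.pi < β
    · refine ⟨max 0 (α - Real.pi), β - Real.pi, by simp only [max_lt_iff]; constructor <;> linarith, ?_⟩
      intro δ h1 h2
      rw [max_lt_iff] at h1
      refine ⟨h1.1, by linarith, h1.2, by linarith, fun _ k => absurd k m, fun _ k => .inr ⟨by linarith, h2⟩⟩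
    · refine ⟨α, β, ab, ?_⟩
      intro δ h1 h2
      refine ⟨by linarith, by linarith, by linarith, h2, fun _ k => absurd k m, fun _ k => .inl ⟨h1, by linarith⟩⟩
  obtain ⟨lo, hi, hlt, H⟩ := key
  have hfin : (⋃ v : V, {δ | lo < δ ∧ δ < hi ∧ v ≠ K.u ∧ v ≠ K.w ∧ cr (pl (K.z0 P') 1 δ) (K.q P' v - K.q P' K.u) = 0}).Finite := by
    apply Set.finite_iUnion
    intro v
    apply Set.Subsingleton.finite
    rintro δ ⟨h1, h2, h3, h4, h5⟩ δ' ⟨h1', h2', h3', h4', h5'⟩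
    have hz : K.q P' v - K.q P' K.u ≠ 0 := sub_ne_zero.2 (K.q_ne h fun k => by
      rcases K.f_eq k with e | ⟨-, e⟩ | ⟨e, -⟩
      · exact h3 e
      · exact (tab K).n1 e
      · exact h4 e)
    have e := cr_tr hz h5 h5'
    rw [cr_pl] at e
    have hn : normSq (K.z0 P') ≠ 0 := by simpa using K.z0_ne h
    simp only [one_mul, mul_eq_zero, hn, false_or] at e
    have H1 := H δ h1 h2; have H2 := H δ' h1' h2'
    have := (Real.sin_eq_zero_iff_of_lt_of_lt (by linarith) (by linarith)).1 e
    linarith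
  obtain ⟨δ, hδ, hn⟩ := (Set.Ioo_infinite hlt).exists_notMem_finite hfin
  obtain ⟨r1, r2, r3, r4, r5, r6⟩ := H δ hδ.1 hδ.2
  refine ⟨δ, pl (K.z0 P') 1 δ, rfl, r1, r2, r3, r4, ?_, r5, r6⟩
  intro v h1 h2 h3
  exact hn (Set.mem_iUnion.2 ⟨v, hδ.1, hδ.2, h1, h2, h3⟩)

omit h in
lemma ne_uw_head {d : D} (hd : M.tail d = K.u) (hn : d ≠ K.uw) : M.head d ≠ K.u ∧ M.head d ≠ K.w :=
  ⟨fun k => M.ne_head d (hd.trans k.symm), fun k => hn (M.eq_of _ _ (hd.trans (tab K).a4.symm) (k.trans (by rw [PMap.head, (tab K).t1', (tab K).a2])))⟩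
omit h in
lemma ne_wu_head {d : D} (hd : M.tail d = K.w) (hn : d ≠ K.wu) : M.head d ≠ K.u ∧ M.head d ≠ K.w :=
  ⟨fun k => hn (M.eq_of _ _ (hd.trans (tab K).a2.symm) (k.trans (by rw [PMap.head, (tab K).t1, (tab K).a4]))), fun k => M.ne_head d (hd.trans k.symm)⟩
omit h in
lemma k_u {d : D} (hd : M.tail d = K.u) : K.k P' d = K.q P' (M.head d) - K.q P' K.u := by rw [k, hd]
omit h in
lemma k_w {d : D} (hd : M.tail d = K.w) : K.k P' d = K.q P' (M.head d) - K.q P' K.u := by rw [k, hd, q_w]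

variable {δ : ℝ} {c : ℂ} (Δ : K.Del P' δ c)
include Δ
lemma sgn {d d' : D} (h1 : M.tail d = K.u) (h2 : M.tail d' = K.w) (h3 : d ≠ K.uw) (h4 : d' ≠ K.wu) (hh : M.head d ≠ M.head d')
    {s t lam : ℝ} (h5 : 0 ≤ s) (h6 : 0 ≤ t) (h7 : 0 ≤ lam) (h8 : 0 < s ∨ 0 < lam) :
    (lam : ℂ) * c + s * K.k P' d ≠ t * K.k P' d' := by
  intro he
  obtain ⟨e1, e2⟩ := K.ne_uw_head h1 h3
  obtain ⟨e3, e4⟩ := K.ne_wu_head h2 h4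
  have g1 := Δ.gen _ e1 e2
  have g2 : cr (K.k P' d) (K.k P' d') ≠ 0 := by
    rw [K.k_u h1, K.k_w h2]
    have inj : ∀ a b : V, a ≠ b → b ≠ K.u → b ≠ K.w → K.f a ≠ K.f b := by
      intro a b h1 h2 h3 k
      rcases K.f_eq k with e | ⟨-, e⟩ | ⟨-, e⟩
      exacts [h1 e, h3 e, h2 e]
    exact h.gp (K.f K.u) (K.f (M.head d)) (K.f (M.head d')) (inj _ _ e1.symm e1 e2) (inj _ _ e3.symm e3 e4) (inj _ _ hh e3 e4)
  rw [← K.k_u h1] at g1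
  obtain ⟨r, hr, k1⟩ := K.Θ_pl h h3 (K.u_ne_wu h1)
  obtain ⟨r', hr', k2⟩ := K.Θ1_pl h (K.w_ne_uw h2) h4
  have m1 : K.Θ P' d ≤ K.α P' := K.α_le h h1 h3
  have m2 : K.β P' ≤ K.Θ1 P' d' := K.β_le h h2 h4
  have m3 : K.α P' ≤ K.β P' := K.αβ h
  have m4 := (K.Θ_mem (P' := P') d).1
  have m5 : K.Θ1 P' d' ≤ 2 * Real.pi := ccw_le _ _
  have hn : 0 < normSq (K.z0 P') := normSq_pos.2 (K.z0_ne h)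
  have f1 : lam * cr c (K.k P' d) = - (t * cr (K.k P' d) (K.k P' d')) := by
    have := congrArg (cr (K.k P' d)) he
    simp [cr] at this ⊢; linarith
  have f2 : s * cr c (K.k P' d) = t * cr c (K.k P' d') := by
    have := congrArg (cr c) he
    simp [cr] at this ⊢; linarith
  rw [Δ.hc, k1] at g1; rw [k1, k2] at g2
  rw [Δ.hc, k1, k2] at f1 f2
  simp only [cr_pl] at f1 f2 g1 g2
  have := Δ.h0; have := Δ.hp; have := Δ.ha; have := Δ.hb
  generalize K.Θ P' d = a at *
  generalize K.Θ1 P' d' = b at *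
  generalize normSq (K.z0 P') = N at *
  have hab : a ≠ b := by rintro rfl; simp at g2
  have hab2 : b - a ≠ 2 * Real.pi := by intro k; rw [k] at g2; simp at g2
  have had : a ≠ δ := by rintro rfl; simp at g1
  have hlt : a < b := lt_of_le_of_ne (by linarith) hab
  have hlt2 : b - a < 2 * Real.pi := lt_of_le_of_ne (by linarith) hab2
  have f1' : lam * Real.sin (a - δ) = - (t * r' * Real.sin (b - a)) := by
    have : r * N ≠ 0 := by positivity
    apply mul_left_cancel₀ this; linarith
  have f2' : s * r * Real.sin (a - δ) = t * r' * Real.sin (b - δ) := by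
    have : N ≠ 0 := by positivity
    apply mul_left_cancel₀ this; linarith
  have T0 : 0 ≤ t * r' := by positivity
  have S0 : 0 ≤ s * r := by positivity
  have hS : Real.sin (a - δ) ≠ 0 := by intro k; rw [k] at g1; simp at g1
  have T : 0 < t * r' := by
    apply lt_of_le_of_ne T0; intro k; rw [← k] at f1' f2'
    simp only [zero_mul, neg_zero, mul_eq_zero, hS, or_false] at f1' f2'
    rcases h8 with h8 | h8
    · rcases f2' with e | e <;> linarith
    · linarith
  generalize t * r' = t at *
  generalize s * r = s at *
  rcases lt_or_gt_of_ne had with c | c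
  · have s1 : 0 < Real.sin (δ - a) := Real.sin_pos_of_pos_of_lt_pi (by linarith) (by linarith)
    have s2 : Real.sin (a - δ) < 0 := by rw [← neg_sub, Real.sin_neg]; linarith
    have p1 : 0 ≤ Real.sin (b - a) := by
      by_contra k; push Not at k; nlinarith [mul_nonneg h7 s1.le, mul_neg_of_pos_of_neg T k, mul_nonneg h7 (neg_nonneg.2 s2.le)]
    have p2 : Real.sin (b - δ) ≤ 0 := by
      by_contra k; push Not at k; nlinarith [mul_pos T k, mul_nonneg S0 (neg_nonneg.2 s2.le)]
    have p3 : b - a ≤ Real.pi := by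
      by_contra k; push Not at k
      have := Real.sin_neg_of_neg_of_neg_pi_lt (x := b - a - 2 * Real.pi) (by linarith) (by linarith)
      rw [Real.sin_sub_two_pi] at this; linarith
    have := Real.sin_pos_of_pos_of_lt_pi (x := b - δ) (by linarith) (by linarith)
    linarith
  · have s2 : 0 < Real.sin (a - δ) := Real.sin_pos_of_pos_of_lt_pi (by linarith) (by linarith)
    have p1 : Real.sin (b - a) ≤ 0 := by
      by_contra k; push Not at k; nlinarith [mul_nonneg h7 s2.le, mul_pos T k]
    have p2 : 0 ≤ Real.sin (b - δ) := by
      by_contra k; push Not at k; nlinarith [mul_neg_of_pos_of_neg T k, mul_nonneg S0 s2.le]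
    have p3 : Real.pi ≤ b - a := by
      by_contra k; push Not at k
      have := Real.sin_pos_of_pos_of_lt_pi (x := b - a) (by linarith) (by linarith)
      linarith
    have := Real.sin_neg_of_neg_of_neg_pi_lt (x := b - δ - 2 * Real.pi) (by linarith) (by linarith)
    rw [Real.sin_sub_two_pi] at this; linarith
end CT
end PTri

namespace PTri
open Finset Complex Filter Topology
set_option linter.all false
namespace CT
variable {V D : Type} [Fintype V] [DecidableEq V] [Fintype D] [DecidableEq D] {M : PMap V D} (K : CT M)
  (P' : {v // v ≠ K.u} → ℂ) (c : ℂ)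
def lim (d : D) : ℂ := if d = K.uw then -c else if d = K.wu then c else K.k P' d
def Pe (ε : ℝ) (v : V) : ℂ := K.q P' v + if v = K.u then ε * c else 0
def N (ε : ℝ) (d : D) : ℂ := if d = K.uw then -c else if d = K.wu then c else M.dir (K.Pe P' c ε) d
open Classical in
noncomputable def a0 (d : D) : ℝ := if d = K.xu ∨ (K.c3 ∧ d = K.yw) then 0 else ccw (K.lim P' c d) (K.lim P' c (M.σ d))
variable {P' c}
lemma dir_uw (ε : ℝ) : M.dir (K.Pe P' c ε) K.uw = ε * -c := by
  have T := tab K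
  rw [PMap.dir, PMap.head, T.t1', T.a2, T.a4, Pe, Pe, if_neg T.n1.symm, if_pos rfl, q_w]; ring
lemma dir_wu (ε : ℝ) : M.dir (K.Pe P' c ε) K.wu = ε * c := by
  have T := tab K
  rw [PMap.dir, PMap.head, T.t1, T.a2, T.a4, Pe, Pe, if_neg T.n1.symm, if_pos rfl, q_w]; ring
lemma dir_N {ε : ℝ} (hε : 0 < ε) (d : D) : ∃ r : ℝ, 0 < r ∧ M.dir (K.Pe P' c ε) d = r * K.N P' c ε d := by
  unfold N; split_ifs with h1 h2
  · exact ⟨ε, hε, by rw [h1, dir_uw]⟩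
  · exact ⟨ε, hε, by rw [h2, dir_wu]⟩
  · exact ⟨1, one_pos, by simp⟩
lemma ang_N {ε : ℝ} (hε : 0 < ε) (d : D) : M.ang (K.Pe P' c ε) d = ccw (K.N P' c ε d) (K.N P' c ε (M.σ d)) := by
  obtain ⟨r, hr, e1⟩ := K.dir_N (P' := P') (c := c) hε d
  obtain ⟨s, hs, e2⟩ := K.dir_N (P' := P') (c := c) hε (M.σ d)
  rw [PMap.ang, e1, e2, ccw_smul _ _ hr hs]
lemma Pe_tendsto (v : V) : Tendsto (fun ε => K.Pe P' c ε v) (𝓝[>] 0) (𝓝 (K.q P' v)) := by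
  have : Continuous (fun ε : ℝ => K.Pe P' c ε v) := by unfold Pe; split_ifs <;> fun_prop
  have h := this.tendsto 0
  rw [show K.Pe P' c 0 v = K.q P' v by simp [Pe]] at h
  exact h.mono_left nhdsWithin_le_nhds
lemma N_tendsto (d : D) : Tendsto (fun ε => K.N P' c ε d) (𝓝[>] 0) (𝓝 (K.lim P' c d)) := by
  unfold N lim; split_ifs
  · exact tendsto_const_nhds
  · exact tendsto_const_nhds
  · exact (K.Pe_tendsto _).sub (K.Pe_tendsto _)
lemma lim_k {d : D} (h1 : d ≠ K.uw) (h2 : d ≠ K.wu) : K.lim P' c d = K.k P' d := by simp [lim, h1, h2]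
lemma lim_uw : K.lim P' c K.uw = -c := by simp [lim]
lemma uw_ne_wu : K.wu ≠ K.uw := K.w_ne_uw (tab K).a2
lemma lim_wu : K.lim P' c K.wu = c := by simp [lim, K.uw_ne_wu]
lemma N_k {d : D} (h1 : d ≠ K.uw) (h2 : d ≠ K.wu) (ε : ℝ) : K.N P' c ε d = K.k P' d + ((if M.head d = K.u then ε * c else 0) - if M.tail d = K.u then ε * c else 0) := by
  simp only [N, h1, h2, if_false, PMap.dir, Pe, k]; ring
lemma xuw : K.xu ≠ K.uw ∧ K.xu ≠ K.wu ∧ K.xw ≠ K.uw ∧ K.xw ≠ K.wu ∧ K.wx ≠ K.uw ∧ K.wx ≠ K.wu := by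
  have T := tab K
  refine ⟨fun k => T.n2 ?_, fun k => T.n3 ?_, fun k => T.n2 ?_, fun k => T.n3 ?_, fun k => T.n1 ?_, fun k => T.n2 ?_⟩
  · rw [← T.a4, ← k, T.a6]
  · rw [← T.a2, ← k, T.a6]
  · rw [← T.a4, ← k, T.a7]
  · rw [← T.a2, ← k, T.a7]
  · rw [← T.a4, ← k, T.a1]
  · rw [← T.a4, ← T.t1, ← k, T.t3', T.a7]
lemma N_xu (ε : ℝ) : K.N P' c ε K.xu = - K.z0 P' + ε * c := by
  have T := tab K
  have X := K.xuw
  rw [N_k _ X.1 X.2.1, T.a6, if_neg T.n2.symm, PMap.head, T.t2', T.a5, if_pos rfl, sub_zero]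
  congr 1; rw [z0, k, k, PMap.head, PMap.head, T.t2, T.t2']; ring
lemma N_xw (ε : ℝ) : K.N P' c ε K.xw = - K.z0 P' := by
  have T := tab K
  have X := K.xuw
  rw [N_k _ X.2.2.1 X.2.2.2.1, T.a7, if_neg T.n2.symm, PMap.head, T.t3, T.a1, if_neg T.n1.symm, sub_zero, add_zero]
  rw [z0, k, k, PMap.head, PMap.head, T.t3, T.t2, T.a1, q_w, T.a5, T.a6, T.a7]; ring
lemma lim_xu : K.lim P' c K.xu = - K.z0 P' ∧ K.lim P' c K.xw = - K.z0 P' ∧ K.lim P' c K.wx = K.z0 P' := by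
  have X := K.xuw
  have T := tab K
  refine ⟨?_, ?_, ?_⟩
  · rw [K.lim_k X.1 X.2.1, ← add_zero (K.k P' K.xu)]; have := K.N_xu (P' := P') (c := c) 0; rw [N_k _ X.1 X.2.1] at this; simpa using this
  · rw [K.lim_k X.2.2.1 X.2.2.2.1]; have := K.N_xw (P' := P') (c := c) 0; rw [N_k _ X.2.2.1 X.2.2.2.1] at this; simpa using this
  · rw [K.lim_k X.2.2.2.2.1 X.2.2.2.2.2, ← k_rep, rep_wx]; rfl
lemma yuw (hc : K.c3) : K.yw ≠ K.uw ∧ K.yw ≠ K.wu ∧ K.yu ≠ K.uw ∧ K.yu ≠ K.wu := by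
  have T := tab K
  refine ⟨fun k => T.n5 hc ?_, fun k => T.n4 ?_, fun k => T.n5 hc ?_, fun k => T.n4 ?_⟩
  · rw [← T.a4, ← k, T.a8]
  · rw [← T.a2, ← k, T.a8]
  · rw [← T.a4, ← k, T.a9]
  · rw [← T.a2, ← k, T.a9]
lemma k_yw : K.k P' K.yw = - K.k P' (M.σ K.wu) := by
  have T := tab K; rw [k, k, PMap.head, PMap.head, T.t4', T.s4, T.t4]; ring
lemma N_yw (hc : K.c3) (ε : ℝ) : K.N P' c ε K.yw = - K.k P' (M.σ K.wu) := by
  have T := tab K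
  rw [N_k _ (K.yuw hc).1 (K.yuw hc).2.1, T.a8, if_neg (T.n5 hc), PMap.head, T.t4', T.a3, if_neg T.n1.symm, k_yw]; simp
lemma N_yu (hc : K.c3) (ε : ℝ) : K.N P' c ε K.yu = - K.k P' (M.σ K.wu) + ε * c := by
  have T := tab K
  rw [N_k _ (K.yuw hc).2.2.1 (K.yuw hc).2.2.2, T.a9, if_neg (T.n5 hc), PMap.head, T.t5, T.a10 hc, if_pos rfl, ← K.rep_yw hc, k_rep, k_yw]; simp
lemma lim_y (hc : K.c3) : K.lim P' c K.yw = - K.k P' (M.σ K.wu) ∧ K.lim P' c K.yu = - K.k P' (M.σ K.wu) := by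
  rw [K.lim_k (K.yuw hc).1 (K.yuw hc).2.1, K.lim_k (K.yuw hc).2.2.1 (K.yuw hc).2.2.2, ← K.rep_yw hc, k_rep, k_yw]; simp

variable (h : K.M'.Good P') {δ : ℝ} (Δ : K.Del P' δ c)
include h Δ
lemma c_ne : c ≠ 0 := by rw [Δ.hc]; exact pl_ne (K.z0_ne h) one_pos _
lemma lim_ne (d : D) : K.lim P' c d ≠ 0 := by
  have := K.c_ne h Δ
  unfold lim; split_ifs with h1 h2
  · simpa
  · exact this
  · exact K.k_ne h h1 h2
lemma cr_zc : 0 < cr (K.z0 P') c := by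
  rw [Δ.hc]; conv => enter [2,1]; rw [← pl_zero (K.z0 P')]
  rw [cr_pl]
  have := Real.sin_pos_of_pos_of_lt_pi Δ.h0 Δ.hp
  have hn : 0 < normSq (K.z0 P') := normSq_pos.2 (K.z0_ne h)
  simp; positivity
lemma cr_yc (hc : K.c3) : 0 < cr c (K.k P' (M.σ K.wu)) := by
  obtain ⟨r, hr, e⟩ := K.Θ1_pl h (K.wy_ne2 h).1 (K.wy_ne2 h).2
  have e3 : K.α P' = K.β P' := K.αβ3 h hc
  have := Δ.ha; have := Δ.hb
  rw [e, Δ.hc, cr_pl]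
  change 0 < _ * Real.sin (K.β P' - δ)
  have := Real.sin_pos_of_pos_of_lt_pi (x := K.β P' - δ) (by linarith) (by linarith)
  have hn : 0 < normSq (K.z0 P') := normSq_pos.2 (K.z0_ne h)
  positivity
omit h Δ in
lemma pos_nhds : ∀ᶠ ε : ℝ in 𝓝[>] 0, 0 < ε := eventually_mem_nhdsWithin
lemma ang_tendsto (d : D) : Tendsto (fun ε => M.ang (K.Pe P' c ε) d) (𝓝[>] 0) (𝓝 (K.a0 P' c d)) ∧ K.a0 P' c d ≠ Real.pi := by
  have T := tab K
  have hpi := Real.pi_pos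
  have hcongr : ∀ a, Tendsto (fun ε => ccw (K.N P' c ε d) (K.N P' c ε (M.σ d))) (𝓝[>] 0) (𝓝 a) → Tendsto (fun ε => M.ang (K.Pe P' c ε) d) (𝓝[>] 0) (𝓝 a) := by
    intro a ha; refine ha.congr' ?_
    filter_upwards [pos_nhds] with ε hε; exact (K.ang_N hε d).symm
  have z1 := K.cr_zc h Δ
  have t1 := K.N_tendsto (P' := P') (c := c) d
  have t2 := K.N_tendsto (P' := P') (c := c) (M.σ d)
  unfold a0; split_ifs with hd
  · refine ⟨hcongr _ ?_, hpi.ne⟩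
    rcases hd with rfl | ⟨hc, rfl⟩
    · rw [T.s3] at t2 ⊢; rw [K.lim_xu.1] at t1; rw [K.lim_xu.2.1] at t2
      refine ccw_tendsto_zero t1 t2 (neg_ne_zero.2 (K.z0_ne h)) ?_
      filter_upwards [pos_nhds] with ε hε
      rw [N_xu, N_xw]; have := mul_pos hε z1
      simp [cr] at this ⊢; linarith
    · rw [T.s5] at t2 ⊢; rw [(K.lim_y hc).1] at t1; rw [(K.lim_y hc).2] at t2
      refine ccw_tendsto_zero t1 t2 (neg_ne_zero.2 (K.k_ne h (K.wy_ne2 h).1 (K.wy_ne2 h).2)) ?_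
      filter_upwards [pos_nhds] with ε hε
      rw [K.N_yu hc, K.N_yw hc]; have := mul_pos hε (K.cr_yc h Δ hc)
      simp [cr] at this ⊢; linarith
  · by_cases hcr : cr (K.lim P' c d) (K.lim P' c (M.σ d)) = 0
    swap
    · exact ⟨hcongr _ (ccw_tendsto t1 t2 (K.lim_ne h Δ _) (K.lim_ne h Δ _) hcr), ccw_ne_pi (K.lim_ne h Δ _) (K.lim_ne h Δ _) hcr⟩
    push Not at hd
    have hux := K.ux_ne h
    have n1 : d ≠ K.uw := by
      rintro rfl; rw [lim_uw, T.s2, K.lim_k hux.1 hux.2] at hcr; change cr _ (K.z0 P') = 0 at hcr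
      simp [cr] at z1 hcr; linarith
    have n2 : d ≠ K.wu := by
      rintro rfl; rw [lim_wu, K.lim_k (K.wy_ne2 h).1 (K.wy_ne2 h).2, K.k_w K.wy_tail] at hcr
      exact Δ.gen _ (K.ne_wu_head K.wy_tail K.wy_ne).1 (K.ne_wu_head K.wy_tail K.wy_ne).2 hcr
    have n3 : M.σ d ≠ K.uw := by
      intro k
      have ht : M.tail d = K.u := by rw [← M.tail_σ, k, T.a4]
      rw [k, lim_uw, K.lim_k n1 n2, K.k_u ht] at hcr
      refine Δ.gen _ (K.ne_uw_head ht n1).1 (K.ne_uw_head ht n1).2 ?_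
      simp [cr] at hcr ⊢; linarith
    have n4 : M.σ d ≠ K.wu := by
      intro k; rw [k, lim_wu] at hcr; rw [← T.s1] at k; have := M.σ.injective k; subst this
      rw [K.lim_xu.2.2] at hcr; exact z1.ne' hcr
    have hr : ¬ K.Rem d := by
      rw [K.nrem]; refine ⟨?_, n1, hd.1, n2, fun c => ⟨?_, hd.2 c⟩⟩
      · rintro rfl; exact n4 T.s1
      · rintro rfl; exact n3 (T.s6 c)
    have e1 : K.lim P' c (M.σ d) = K.k P' (K.rep (M.σ d)) := by rw [K.lim_k n3 n4, k_rep]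
    have hrep : K.rep (M.σ d) = d := by
      by_contra k
      refine K.cr_k h hr (K.ret_rep n3 n4) (by rw [f_rep, M.tail_σ]) (Ne.symm k) ?_
      rw [← e1, ← hcr, K.lim_k n1 n2]
    have e2 : K.lim P' c (M.σ d) = K.lim P' c d := by rw [e1, hrep, K.lim_k n1 n2]
    rw [e2, ccw_self (K.lim_ne h Δ d)]
    rw [e2] at t2
    refine ⟨hcongr _ (ccw_tendsto_two t1 t2 (K.lim_ne h Δ d) ?_), by linarith⟩
    filter_upwards [pos_nhds] with ε hε
    have ht : M.tail (M.σ d) = M.tail d := M.tail_σ d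
    by_cases hw : K.Rem (M.σ d)
    · rcases hw with e | e | e | e | ⟨hc, e | e⟩
      · rw [e, rep_wx] at hrep; rw [e, ← hrep, T.a1, T.a5] at ht; exact absurd ht.symm T.n1
      · exact absurd e n3
      · rw [e, rep_xu] at hrep; rw [e, ← hrep, N_xu, N_xw]; have := mul_pos hε z1
        simp [cr] at this ⊢; linarith
      · exact absurd e n4
      · rw [e, K.rep_uy hc] at hrep; rw [e, ← hrep, T.a10 hc, T.a3] at ht; exact absurd ht T.n1
      · rw [e, K.rep_yw hc] at hrep; rw [e, ← hrep, K.N_yu hc, K.N_yw hc]; have := mul_pos hε (K.cr_yc h Δ hc)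
        simp [cr] at this ⊢; linarith
    · rw [K.rep_ret hw] at hrep; rw [hrep, cr_self]
end CT
end PTri

namespace PTri
open Finset Complex Filter Topology
set_option linter.all false
namespace CT
variable {V D : Type} [Fintype V] [DecidableEq V] [Fintype D] [DecidableEq D] {M : PMap V D} (K : CT M)
  {P' : {v // v ≠ K.u} → ℂ} {c : ℂ} (h : K.M'.Good P') {δ : ℝ} (Δ : K.Del P' δ c)
include h Δ
lemma a0_ret (e : K.D') (he : M.σ e.1 ≠ K.uw) : K.a0 P' c e.1 = K.M'.ang P' e := by
  have n := K.nrem.1 e.2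
  rw [a0, if_neg, ang'_1 _ _ he, K.lim_k n.2.1 n.2.2.2.1, K.lim_k he]
  · rw [← (tab K).s1]; exact fun k => n.1 (M.σ.injective k)
  · push Not; exact ⟨n.2.2.1, fun c => (n.2.2.2.2 c).2⟩
lemma a0_wx : K.a0 P' c K.wx = δ := by
  have T := tab K
  have := Δ.h0; have := Δ.hp; have := Δ.ha; have := Δ.hb
  rw [a0, if_neg, K.lim_xu.2.2, T.s1, lim_wu, Δ.hc]
  · conv => enter [1,1]; rw [← pl_zero (K.z0 P')]
    rw [ccw_pl (K.z0_ne h) one_pos one_pos (by linarith) (by linarith)]; ring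
  · push Not; exact ⟨K.xu_ne.symm, fun _ k => T.n4 (by rw [← T.a8, ← k, T.a1])⟩
lemma a0_uw : K.a0 P' c K.uw = Real.pi - δ := by
  have T := tab K
  have := Δ.h0; have := Δ.hp; have := Δ.ha; have := Δ.hb
  have hux := K.ux_ne h
  rw [a0, if_neg, lim_uw, T.s2, K.lim_k hux.1 hux.2, Δ.hc, pl_neg]
  · change ccw _ (K.z0 P') = _
    conv => enter [1,2]; rw [← pl_zero (K.z0 P')]
    rw [← pl_sub, ccw_pl (K.z0_ne h) one_pos one_pos (by linarith) (by linarith)]; ring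
  · push Not; exact ⟨K.xuw.1.symm, fun c => (K.yuw c).1.symm⟩
lemma a0_wu : K.a0 P' c K.wu = K.β P' - δ := by
  have T := tab K
  have := Δ.h0; have := Δ.hp; have := Δ.ha; have := Δ.hb
  have b1 : K.β P' ≤ 2 * Real.pi := ccw_le _ _
  obtain ⟨r, hr, e⟩ := K.Θ1_pl h (K.wy_ne2 h).1 (K.wy_ne2 h).2
  rw [a0, if_neg, lim_wu, K.lim_k (K.wy_ne2 h).1 (K.wy_ne2 h).2, e, Δ.hc]
  · change ccw _ (pl _ _ (K.β P')) = _
    rw [ccw_pl (K.z0_ne h) one_pos hr (by linarith) (by linarith)]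
  · push Not; exact ⟨K.xuw.2.1.symm, fun c => (K.yuw c).2.1.symm⟩
lemma a0_bu : K.a0 P' c (M.σ.symm K.uw) = δ + Real.pi - K.α P' := by
  have T := tab K
  have := Δ.h0; have := Δ.hp; have := Δ.ha; have := Δ.hb
  have a1 : 0 ≤ K.α P' := (K.Θ_mem _).1
  obtain ⟨r, hr, e⟩ := K.Θ_pl h K.bu_ne (K.u_ne_wu K.bu_tail)
  rw [a0, if_neg, K.bu_def, lim_uw, K.lim_k K.bu_ne (K.u_ne_wu K.bu_tail), e, Δ.hc, pl_neg]
  · change ccw (pl _ _ (K.α P')) _ = _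
    rw [ccw_pl (K.z0_ne h) hr one_pos (by linarith) (by linarith)]
  · push Not; exact ⟨fun k => T.n2 (by rw [← T.a6, ← k, K.bu_tail]), fun c k => T.n5 c (by rw [← T.a8, ← k, K.bu_tail])⟩
omit h Δ in
lemma a0_xu : K.a0 P' c K.xu = 0 := by simp [a0]
omit h Δ in
lemma a0_yw (hc : K.c3) : K.a0 P' c K.yw = 0 := by simp [a0, hc]
omit h Δ in
lemma bu3 (hc : K.c3) : M.σ.symm K.uw = K.uy := by rw [← (tab K).s6 hc, Equiv.symm_apply_apply]
omit h Δ in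
lemma σ_ret3 (hc : K.c3) (e : K.D') : M.σ e.1 ≠ K.uw := by
  intro k; rw [← (tab K).s6 hc] at k; exact ((K.nrem.1 e.2).2.2.2.2 hc).1 (M.σ.injective k)
omit h Δ in
lemma σ_ret2 (hc : ¬ K.c3) (e : K.D') (he : e ≠ ⟨K.ar, K.ret_ar⟩) : M.σ e.1 ≠ K.uw := by
  intro k; apply he; apply Subtype.ext; simp only; rw [K.ar_eq hc, ← k, Equiv.symm_apply_apply]
lemma a0_ar (hc : ¬ K.c3) : K.a0 P' c K.ar = δ + Real.pi - K.α P' := by rw [K.ar_eq hc, K.a0_bu h Δ]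
lemma ang_ar (hc : ¬ K.c3) : K.M'.ang P' ⟨K.ar, K.ret_ar⟩ = K.β P' - K.α P' := by
  have := K.αβ2 h hc; change K.α P' + _ = K.β P' at this; linarith
lemma a0_sum : ∑ d, K.a0 P' c d = ∑ e, K.M'.ang P' e + 2 * Real.pi := by
  rw [K.sum_rem, K.a0_wx h Δ, K.a0_uw h Δ, K.a0_wu h Δ, K.a0_xu]
  by_cases hc : K.c3
  · have e3 : K.α P' = K.β P' := K.αβ3 h hc
    rw [if_pos hc, K.a0_yw hc, ← K.bu3 hc, K.a0_bu h Δ, e3, Finset.sum_congr rfl fun e _ => K.a0_ret h Δ e (K.σ_ret3 hc e)]; ring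
  · rw [if_neg hc, ← Finset.add_sum_erase _ _ (Finset.mem_univ (⟨K.ar, K.ret_ar⟩ : K.D')), ← Finset.add_sum_erase _ (fun e => K.M'.ang P' e) (Finset.mem_univ (⟨K.ar, K.ret_ar⟩ : K.D')),
      Finset.sum_congr rfl fun e he => K.a0_ret h Δ e (K.σ_ret2 hc e (Finset.ne_of_mem_erase he)), K.ang_ar h Δ hc, K.a0_ar h Δ hc]
    ring
omit Δ in
lemma total : ∑ e, K.M'.ang P' e = 2 * Real.pi * (Fintype.card V - 1) := by
  classical
  rw [← Finset.sum_fiberwise_of_maps_to (t := Finset.univ) (g := K.M'.tail) (fun _ _ => Finset.mem_univ _)]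
  rw [Finset.sum_congr rfl fun v _ => (by convert h.sum v : _ = 2 * Real.pi)]
  rw [Finset.sum_const, Finset.card_univ, Fintype.card_subtype_compl, Fintype.card_subtype_eq, nsmul_eq_mul, Nat.cast_sub (Fintype.card_pos_iff.2 ⟨K.u⟩)]
  simp; ring

/-- eventual combinatorial sum -/
lemma sums : ∀ᶠ ε : ℝ in 𝓝[>] 0, Function.Injective (K.Pe P' c ε) → 
    ∀ v, ∑ d ∈ Finset.univ.filter (fun d => M.tail d = v), M.ang (K.Pe P' c ε) d = 2 * Real.pi := by
  classical
  have hp := Real.pi_pos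
  have t : Tendsto (fun ε => ∑ d, M.ang (K.Pe P' c ε) d) (𝓝[>] 0) (𝓝 (2 * Real.pi * Fintype.card V)) := by
    have := tendsto_finsetSum (Finset.univ : Finset D) (fun d _ => (K.ang_tendsto h Δ d).1)
    rw [K.a0_sum h Δ, K.total h] at this
    convert this using 2; ring
  filter_upwards [t.eventually_lt_const (u := 2 * Real.pi * Fintype.card V + 2 * Real.pi) (by linarith)] with ε hε hinj
  have ex : ∀ v, ∃ k : ℕ, 1 ≤ k ∧ ∑ d ∈ Finset.univ.filter (fun d => M.tail d = v), M.ang (K.Pe P' c ε) d = 2 * Real.pi * k := by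
    intro v
    refine sum_ccw _ M.σ (by intro d; simp [M.tail_σ]) (M.dir (K.Pe P' c ε)) ?_ ?_
    · intro d _ k; exact M.ne_head d (hinj (sub_eq_zero.1 k)).symm
    · obtain ⟨d, hd⟩ := M.surj v; exact ⟨d, by simp [hd]⟩
  choose k k1 k2 using ex
  rw [← Finset.sum_fiberwise_of_maps_to (t := Finset.univ) (g := M.tail) (fun _ _ => Finset.mem_univ _), Finset.sum_congr rfl fun v _ => k2 v, ← Finset.mul_sum] at hε
  have h1 : (∑ v, (k v : ℝ)) < Fintype.card V + 1 := by
    have : 2 * Real.pi * (∑ v, (k v : ℝ)) < 2 * Real.pi * (Fintype.card V + 1) := by linarith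
    exact lt_of_mul_lt_mul_left this (by positivity)
  have h2 : ∑ v, k v ≤ ∑ v : V, 1 := by
    simp only [Finset.sum_const, Finset.card_univ, smul_eq_mul, mul_one]
    have : ((∑ v, k v : ℕ) : ℝ) < (Fintype.card V + 1 : ℕ) := by push_cast; exact h1
    have := Nat.cast_lt.1 this; omega
  have h3 := (Finset.sum_eq_sum_iff_of_le (fun v _ => k1 v)).1 (le_antisymm (Finset.sum_le_sum fun v _ => k1 v) h2)
  intro v
  rw [k2 v, ← h3 v (Finset.mem_univ v)]; simp
end CT
end PTri

namespace PTri
open Finset Complex Filter Topology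
set_option linter.all false
lemma seg_open {f g f' g' : ℝ → ℂ} {l : Filter ℝ} {a b a' b' : ℂ} (h1 : Tendsto f l (𝓝 a)) (h2 : Tendsto g l (𝓝 b))
    (h3 : Tendsto f' l (𝓝 a')) (h4 : Tendsto g' l (𝓝 b')) (hd : Disjoint (segment ℝ a b) (segment ℝ a' b')) :
    ∀ᶠ x in l, Disjoint (segment ℝ (f x) (g x)) (segment ℝ (f' x) (g' x)) := by
  have c : ∀ a b : ℂ, IsCompact (segment ℝ a b) := fun a b => by
    rw [segment_eq_image]; exact isCompact_Icc.image (by fun_prop)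
  obtain ⟨r, hr, hT⟩ := hd.exists_thickenings (c a b) (c a' b').isClosed
  have key : ∀ {f g : ℝ → ℂ} {a b : ℂ}, Tendsto f l (𝓝 a) → Tendsto g l (𝓝 b) → ∀ᶠ x in l, segment ℝ (f x) (g x) ⊆ Metric.thickening r (segment ℝ a b) := by
    intro f g a b h1 h2
    have o : IsOpen (Metric.thickening r (segment ℝ a b)) := Metric.isOpen_thickening
    filter_upwards [h1 (o.mem_nhds (Metric.self_subset_thickening hr _ (left_mem_segment ℝ a b))), h2 (o.mem_nhds (Metric.self_subset_thickening hr _ (right_mem_segment ℝ a b)))] with x h1 h2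
    exact ((convex_segment a b).thickening r).segment_subset h1 h2
  filter_upwards [key h1 h2, key h3 h4] with x k1 k2
  exact hT.mono k1 k2
namespace CT
variable {V D : Type} [Fintype V] [DecidableEq V] [Fintype D] [DecidableEq D] {M : PMap V D} (K : CT M)
  {P' : {v // v ≠ K.u} → ℂ} {c : ℂ} (h : K.M'.Good P') {δ : ℝ} (Δ : K.Del P' δ c)
include h Δ
omit h Δ in
lemma f_inj {a b : V} (hab : a ≠ b) (h1 : ¬ (a = K.u ∧ b = K.w)) (h2 : ¬ (a = K.w ∧ b = K.u)) : K.f a ≠ K.f b := fun k => by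
  rcases K.f_eq k with e | e | e
  exacts [hab e, h1 e, h2 e]
lemma Pe_gp : ∀ᶠ ε : ℝ in 𝓝[>] 0, ∀ a b d, a ≠ b → a ≠ d → b ≠ d → cr (K.Pe P' c ε b - K.Pe P' c ε a) (K.Pe P' c ε d - K.Pe P' c ε a) ≠ 0 := by
  rw [eventually_all]; intro a; rw [eventually_all]; intro b; rw [eventually_all]; intro d
  by_cases hh : a ≠ b ∧ a ≠ d ∧ b ≠ d
  swap
  · filter_upwards with ε h1 h2 h3; exact absurd ⟨h1, h2, h3⟩ hh
  obtain ⟨n1, n2, n3⟩ := hh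
  have uw : ∀ ε : ℝ, 0 < ε → ∀ z, z ≠ K.u → z ≠ K.w → cr (K.Pe P' c ε K.w - K.Pe P' c ε K.u) (K.Pe P' c ε z - K.Pe P' c ε K.u) ≠ 0 := by
    intro ε hε z h1 h2 k
    refine Δ.gen z h1 h2 ?_
    have := (tab K).n1.symm
    simp only [Pe, if_neg h1, if_neg this, if_true, q_w] at k
    have e : ε * cr c (K.q P' z - K.q P' K.u) = 0 := by
      simp only [cr, sub_re, sub_im, add_re, add_im, mul_re, mul_im, ofReal_re, ofReal_im, add_zero] at k ⊢; linear_combination -k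
    exact (mul_eq_zero.1 e).resolve_left hε.ne'
  have rot : ∀ x y z : ℂ, cr (y - x) (z - x) = cr (z - y) (x - y) := fun x y z => by simp [cr]; ring
  have sw : ∀ x y z : ℂ, cr (y - x) (z - x) = - cr (z - x) (y - x) := fun x y z => by simp [cr]; ring
  by_cases ha : (a = K.u ∨ b = K.u ∨ d = K.u) ∧ (a = K.w ∨ b = K.w ∨ d = K.w)
  · filter_upwards [pos_nhds] with ε hε _ _ _
    have U := uw ε hε
    obtain ⟨e1 | e1 | e1, e2 | e2 | e2⟩ := ha <;> subst e1
    · exact absurd e2 (tab K).n1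
    · subst e2; exact U _ n2.symm n3.symm
    · subst e2; rw [sw, neg_ne_zero]; exact U _ n1.symm n3
    · subst e2; rw [rot, sw, neg_ne_zero]; exact U _ n3.symm n2.symm
    · exact absurd e2 (tab K).n1
    · subst e2; rw [rot]; exact U _ n1 n2
    · subst e2; rw [← rot]; exact U _ n3 n1.symm
    · subst e2; rw [← rot, sw, neg_ne_zero]; exact U _ n2 n1
    · exact absurd e2 (tab K).n1
  · have hne : ∀ x y : V, (x = a ∨ x = b ∨ x = d) → (y = a ∨ y = b ∨ y = d) → x ≠ y → K.f x ≠ K.f y := by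
      intro x y hx hy hxy
      refine K.f_inj hxy ?_ ?_
      · rintro ⟨rfl, rfl⟩; exact ha ⟨by tauto, by tauto⟩
      · rintro ⟨rfl, rfl⟩; exact ha ⟨by tauto, by tauto⟩
    have g := h.gp _ _ _ (hne a b (by simp) (by simp) n1) (hne a d (by simp) (by simp) n2) (hne b d (by simp) (by simp) n3)
    have t : Tendsto (fun ε : ℝ => cr (K.Pe P' c ε b - K.Pe P' c ε a) (K.Pe P' c ε d - K.Pe P' c ε a)) (𝓝[>] 0) (𝓝 (cr (K.q P' b - K.q P' a) (K.q P' d - K.q P' a))) := by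
      have cc : Continuous (fun x : ℂ × ℂ => cr x.1 x.2) := by unfold cr; fun_prop
      exact (cc.tendsto (_, _)).comp (((K.Pe_tendsto b).sub (K.Pe_tendsto a)).prodMk_nhds ((K.Pe_tendsto d).sub (K.Pe_tendsto a)))
    filter_upwards [t.eventually_ne g] with ε h1 _ _ _; exact h1
def Q (ε : ℝ) (P' : {v // v ≠ K.u} → ℂ) (c : ℂ) (d d' : D) : Prop := M.tail d ≠ M.tail d' → M.tail d ≠ M.head d' → M.head d ≠ M.tail d' → M.head d ≠ M.head d' →
    Disjoint (segment ℝ (K.Pe P' c ε (M.tail d)) (K.Pe P' c ε (M.head d))) (segment ℝ (K.Pe P' c ε (M.tail d')) (K.Pe P' c ε (M.head d')))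
omit h Δ in
lemma Q_symm {ε : ℝ} {d d' : D} (q : K.Q ε P' c d d') : K.Q ε P' c d' d := fun h1 h2 h3 h4 => (q h1.symm h3.symm h2.symm h4.symm).symm
omit h Δ in
lemma Q_τ {ε : ℝ} {d d' : D} (q : K.Q ε P' c d d') : K.Q ε P' c (M.τ d) d' := fun h1 h2 h3 h4 => by
  rw [M.head_τ] at *; rw [M.tail_τ] at *; rw [segment_symm]; exact q h3 h4 h1 h2
omit h Δ in
lemma seg_cr {a b z : ℂ} (hz : z ∈ segment ℝ a b) : cr (a - z) (b - z) = 0 := by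
  obtain ⟨s, t, hs, ht, hst, rfl⟩ := hz
  have : s = 1 - t := by linarith
  subst this; simp [cr]; ring
lemma Q_uw (d' : D) : ∀ᶠ ε : ℝ in 𝓝[>] 0, K.Q ε P' c K.uw d' := by
  have T := tab K
  have hh : M.head K.uw = K.w := by rw [PMap.head, T.t1', T.a2]
  by_cases k : M.tail d' ≠ K.u ∧ M.head d' ≠ K.u ∧ M.tail d' ≠ K.w ∧ M.head d' ≠ K.w
  swap
  · filter_upwards with ε h1 h2 h3 h4
    rw [T.a4] at h1 h2; rw [hh] at h3 h4; exact absurd ⟨h1.symm, h2.symm, h3.symm, h4.symm⟩ k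
  obtain ⟨k1, k2, k3, k4⟩ := k
  have key : Disjoint (segment ℝ (K.q P' (M.tail K.uw)) (K.q P' (M.head K.uw))) (segment ℝ (K.q P' (M.tail d')) (K.q P' (M.head d'))) := by
    rw [T.a4, hh, q_w, segment_same, Set.disjoint_singleton_left]
    intro hz
    exact h.gp (K.f K.u) (K.f (M.tail d')) (K.f (M.head d')) (K.f_inj k1.symm (by tauto) (by tauto)) (K.f_inj k2.symm (by tauto) (by tauto)) (K.f_inj (M.ne_head d') (by tauto) (by tauto)) (seg_cr hz)
  filter_upwards [seg_open (K.Pe_tendsto (P' := P') (c := c) _) (K.Pe_tendsto _) (K.Pe_tendsto _) (K.Pe_tendsto _) key] with ε hε _ _ _ _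
  exact hε
lemma Q_uw' (d' : D) : ∀ᶠ ε : ℝ in 𝓝[>] 0, K.Q ε P' c K.uw d' ∧ K.Q ε P' c K.wu d' ∧ K.Q ε P' c d' K.uw ∧ K.Q ε P' c d' K.wu := by
  filter_upwards [K.Q_uw h Δ d'] with ε hε
  have : K.Q ε P' c K.wu d' := by rw [← (tab K).t1']; exact K.Q_τ hε
  exact ⟨hε, this, K.Q_symm hε, K.Q_symm this⟩
lemma Q_sgn {d d' : D} (h1 : M.tail d = K.u) (h2 : M.tail d' = K.w) (h3 : d ≠ K.uw) (h4 : d' ≠ K.wu) {ε : ℝ} (hε : 0 < ε) : K.Q ε P' c d d' := by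
  intro _ _ _ hh
  obtain ⟨e1, e2⟩ := K.ne_uw_head h1 h3
  obtain ⟨e3, e4⟩ := K.ne_wu_head h2 h4
  rw [Set.disjoint_left]
  rintro z ⟨s', s, hs', hs, hst, rfl⟩ ⟨t', t, ht', ht, htt, ez⟩
  refine K.sgn h Δ h1 h2 h3 h4 hh hs ht (lam := ε * s') (by positivity) ?_ ?_
  · rcases hs.lt_or_eq with k | k
    · exact .inl k
    · right; rw [← k, add_zero] at hst; rw [hst]; linarith
  · have a1 : s' = 1 - s := by linarith
    have a2 : t' = 1 - t := by linarith
    subst a1 a2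
    rw [h1, h2] at ez
    simp only [Pe, if_neg e1, if_neg e3, if_true, if_neg (tab K).n1.symm, q_w, real_smul] at ez
    rw [K.k_u h1, K.k_w h2]
    push_cast at ez ⊢
    linear_combination -ez
lemma Q_ev (d d' : D) : ∀ᶠ ε : ℝ in 𝓝[>] 0, K.Q ε P' c d d' := by
  have T := tab K
  by_cases n1 : d = K.uw
  · rw [n1]; filter_upwards [K.Q_uw' h Δ d'] with ε hε; exact hε.1
  by_cases n2 : d = K.wu
  · rw [n2]; filter_upwards [K.Q_uw' h Δ d'] with ε hε; exact hε.2.1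
  by_cases n3 : d' = K.uw
  · rw [n3]; filter_upwards [K.Q_uw' h Δ d] with ε hε; exact hε.2.2.1
  by_cases n4 : d' = K.wu
  · rw [n4]; filter_upwards [K.Q_uw' h Δ d] with ε hε; exact hε.2.2.2
  have nτ : ∀ d, d ≠ K.uw → d ≠ K.wu → M.τ d ≠ K.uw ∧ M.τ d ≠ K.wu := fun d h1 h2 =>
    ⟨fun k => h2 (by rw [← T.t1', ← k, M.ττ]), fun k => h1 (by rw [← T.t1, ← k, M.ττ])⟩
  have main : ∀ d d', d ≠ K.uw → d ≠ K.wu → d' ≠ K.uw → d' ≠ K.wu → (M.tail d = K.u ∨ M.head d = K.u) → (M.tail d' = K.w ∨ M.head d' = K.w) → ∀ ε : ℝ, 0 < ε → K.Q ε P' c d d' := by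
    intro d d' n1 n2 n3 n4 h1 h2 ε hε
    have step : ∀ d, d ≠ K.uw → d ≠ K.wu → M.tail d = K.u → K.Q ε P' c d d' := by
      intro d n1 n2 h1
      rcases h2 with h2 | h2
      · exact K.Q_sgn h Δ h1 h2 n1 n4 hε
      · have := K.Q_τ (K.Q_symm (K.Q_sgn h Δ (d' := M.τ d') h1 h2 n1 (nτ d' n3 n4).2 hε))
        rw [M.ττ] at this; exact K.Q_symm this
    rcases h1 with h1 | h1
    · exact step d n1 n2 h1
    · have := K.Q_τ (step (M.τ d) (nτ d n1 n2).1 (nτ d n1 n2).2 h1); rwa [M.ττ] at this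
  by_cases m1 : (M.tail d = K.u ∨ M.head d = K.u) ∧ (M.tail d' = K.w ∨ M.head d' = K.w)
  · filter_upwards [pos_nhds] with ε hε; exact main d d' n1 n2 n3 n4 m1.1 m1.2 ε hε
  by_cases m2 : (M.tail d' = K.u ∨ M.head d' = K.u) ∧ (M.tail d = K.w ∨ M.head d = K.w)
  · filter_upwards [pos_nhds] with ε hε; exact K.Q_symm (main d' d n3 n4 n1 n2 m2.1 m2.2 ε hε)
  by_cases hh : M.tail d ≠ M.tail d' ∧ M.tail d ≠ M.head d' ∧ M.head d ≠ M.tail d' ∧ M.head d ≠ M.head d'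
  swap
  · filter_upwards with ε h1 h2 h3 h4; exact absurd ⟨h1, h2, h3, h4⟩ hh
  obtain ⟨k1, k2, k3, k4⟩ := hh
  have key := h.nc ⟨K.rep d, K.ret_rep n1 n2⟩ ⟨K.rep d', K.ret_rep n3 n4⟩
  simp only [tail', head', f_rep, f_head_rep] at key
  have key := key (K.f_inj k1 (by tauto) (by tauto)) (K.f_inj k2 (by tauto) (by tauto)) (K.f_inj k3 (by tauto) (by tauto)) (K.f_inj k4 (by tauto) (by tauto))
  filter_upwards [seg_open (K.Pe_tendsto (P' := P') (c := c) _) (K.Pe_tendsto _) (K.Pe_tendsto _) (K.Pe_tendsto _) key] with ε hε _ _ _ _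
  exact hε
end CT
end PTri

namespace PTri
open Finset Complex Filter Topology
set_option linter.all false
lemma sc_three {D : Type} [Fintype D] {ψ : Equiv.Perm D} {a b : D} (h : ψ.SameCycle a b) (h3 : ψ (ψ (ψ a)) = a) : b = a ∨ b = ψ a ∨ b = ψ (ψ a) := by
  obtain ⟨n, -, rfl⟩ := h.exists_pow_eq'
  clear h
  induction n with
  | zero => simp
  | succ n ih =>
    rw [pow_succ', Equiv.Perm.mul_apply]
    rcases ih with e | e | e <;> rw [e]
    · simp
    · simp
    · rw [h3]; simp
lemma PMap.Good.ne_pi {V D : Type} [Fintype V] [DecidableEq V] [Fintype D] [DecidableEq D] {M : PMap V D} {P : V → ℂ} (h : M.Good P) (d : D) : M.ang P d ≠ Real.pi := by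
  by_cases k : M.σ d = d
  · rw [PMap.ang, k, ccw_self (h.ne d)]; linarith [Real.pi_pos]
  · refine ccw_ne_pi (h.ne _) (h.ne _) ?_
    have := h.gp (M.tail d) (M.head d) (M.head (M.σ d)) (M.ne_head d) (by rw [← M.tail_σ]; exact M.ne_head _) (fun e => k (M.simple _ _ (M.tail_σ d) e.symm))
    rwa [PMap.dir, PMap.dir, M.tail_σ]
namespace CT
variable {V D : Type} [Fintype V] [DecidableEq V] [Fintype D] [DecidableEq D] {M : PMap V D} (K : CT M)
  {P' : {v // v ≠ K.u} → ℂ} {c : ℂ} (h : K.M'.Good P') {δ : ℝ} (Δ : K.Del P' δ c)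
include h Δ
lemma sc_ar (hc : ¬ K.c3) (d : D) : M.ψ.SameCycle d K.wu ↔ M.ψ.SameCycle d K.ar := by
  have e : M.ψ K.ar = K.wu := by
    rcases K.σ_ar with ⟨k, -⟩ | ⟨-, k⟩
    · exact absurd k hc
    · rw [M.ψ_apply, k, (tab K).t1']
  rw [← e, Equiv.Perm.sameCycle_apply_right]
lemma a0_outer (d : D) (hd : M.ψ.SameCycle d M.o) : Real.pi < K.a0 P' c d := by
  have T := tab K
  obtain ⟨p1, p2, p3, p4, p5, p6⟩ := K.ψ_wu
  have nx : ¬ M.ψ.SameCycle K.wx M.o := K.out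
  have nu : ¬ M.ψ.SameCycle K.uw M.o := by rw [← p1]; simpa using nx
  have nxu : ¬ M.ψ.SameCycle K.xu M.o := by rw [← p2]; simpa using nu
  have nwu : K.c3 → ¬ M.ψ.SameCycle K.wu M.o := K.qout
  have nyw : K.c3 → ¬ M.ψ.SameCycle K.yw M.o := fun c => by rw [← p4]; simpa using nwu c
  have nuy : K.c3 → ¬ M.ψ.SameCycle K.uy M.o := fun c => by rw [← p5]; simpa using nyw c
  have arr : ¬ K.c3 → M.ψ.SameCycle K.ar M.o → Real.pi < K.a0 P' c K.ar ∧ Real.pi < K.a0 P' c K.wu := fun hc hs => by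
    have := h.outer ⟨K.ar, K.ret_ar⟩ ((K.sc_o _).2 hs)
    rw [K.ang_ar h Δ hc] at this
    have := Δ.l1 hc this
    rw [K.a0_ar h Δ hc, K.a0_wu h Δ]; constructor <;> linarith
  by_cases hr : K.Rem d
  · rcases hr with rfl | rfl | rfl | rfl | ⟨hc, rfl | rfl⟩
    · exact absurd hd nx
    · exact absurd hd nu
    · exact absurd hd nxu
    · by_cases hc : K.c3
      · exact absurd hd (nwu hc)
      · exact (arr hc (((K.sc_ar h Δ hc _).1 hd.symm).symm)).2
    · exact absurd hd (nuy hc)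
    · exact absurd hd (nyw hc)
  · by_cases hs : M.σ d = K.uw
    · have hc : ¬ K.c3 := fun hc => K.σ_ret3 hc ⟨d, hr⟩ hs
      have e : d = K.ar := by rw [K.ar_eq hc, ← hs]; simp
      rw [e] at hd ⊢; exact (arr hc hd).1
    · rw [K.a0_ret h Δ ⟨d, hr⟩ hs]; exact h.outer _ ((K.sc_o _).2 hd)
open Classical in
lemma a0_bnd (d : D) (hd : ¬ M.ψ.SameCycle d M.o) : (Finset.univ.filter (fun d' => M.ψ.SameCycle d d' ∧ K.a0 P' c d' < Real.pi)).card = 3 := by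
  have T := tab K
  obtain ⟨p1, p2, p3, p4, p5, p6⟩ := K.ψ_wu
  rw [Finset.card_filter, K.sum_rem]
  have s1 : M.ψ.SameCycle d K.uw ↔ M.ψ.SameCycle d K.wx := by rw [← p1]; simp
  have s2 : M.ψ.SameCycle d K.xu ↔ M.ψ.SameCycle d K.wx := by rw [← p2]; simp [s1]
  have s3 : M.ψ.SameCycle d K.yw ↔ M.ψ.SameCycle d K.wu := by rw [← p4]; simp
  have s4 : M.ψ.SameCycle d K.uy ↔ M.ψ.SameCycle d K.wu := by rw [← p5]; simp [s3]
  have b1 := Δ.h0; have b2 := Δ.hp; have b3 := Δ.ha; have b4 := Δ.hb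
  have hpi := Real.pi_pos
  simp only [s1, s2, s3, s4, K.a0_wx h Δ, K.a0_uw h Δ, K.a0_xu, b2, hpi, show Real.pi - δ < Real.pi by linarith, and_true]
  have c3 : K.c3 → K.β P' = K.α P' ∧ K.a0 P' c K.wu < Real.pi ∧ K.a0 P' c K.uy < Real.pi ∧ K.a0 P' c K.yw < Real.pi := fun hc => by
    have e : K.α P' = K.β P' := K.αβ3 h hc
    rw [← K.bu3 hc, K.a0_bu h Δ, K.a0_wu h Δ, K.a0_yw hc]
    refine ⟨e.symm, ?_, ?_, hpi⟩ <;> linarith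
  by_cases h1 : M.ψ.SameCycle d K.wx
  · have hn : ∀ b, M.ψ.SameCycle d b → b = K.wx ∨ b = K.uw ∨ b = K.xu := fun b hb => sc_three (h1.symm.trans hb) K.p3
    have hw : ¬ M.ψ.SameCycle d K.wu := fun k => by
      obtain ⟨-, i2, i3, i4, i5, -⟩ := K.iffs
      rcases hn _ k with e | e | e
      · rw [i2, PMap.head, T.t1, T.a4] at e; exact T.n2 e.2
      · exact K.uw_ne_wu e
      · exact K.xuw.2.1 e.symm
    have h0 : ∀ e : K.D', ¬ M.ψ.SameCycle d e.1 := fun e k => by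
      obtain ⟨q1, q2, q3, q4, q5⟩ := K.nrem.1 e.2
      rcases hn _ k with e | e | e
      exacts [q1 e, q2 e, q3 e]
    simp [h1, hw, h0]
  by_cases h2 : K.c3 ∧ M.ψ.SameCycle d K.wu
  · obtain ⟨hc, h2⟩ := h2
    obtain ⟨-, c1, c2, c4⟩ := c3 hc
    have hn : ∀ b, M.ψ.SameCycle d b → b = K.wu ∨ b = K.yw ∨ b = K.uy := fun b hb => sc_three (h2.symm.trans hb) (by rw [p4, p5, p6 hc])
    have h0 : ∀ e : K.D', ¬ M.ψ.SameCycle d e.1 := fun e k => by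
      obtain ⟨q1, q2, q3, q4, q5⟩ := K.nrem.1 e.2
      rcases hn _ k with e | e | e
      exacts [q4 e, (q5 hc).2 e, (q5 hc).1 e]
    simp [h1, h2, h0, hc, c1, c2, c4]
  obtain ⟨e0, he0⟩ : ∃ e0 : K.D', M.ψ.SameCycle d e0.1 := by
    by_cases hr : K.Rem d
    · rcases hr with rfl | rfl | rfl | rfl | ⟨hc, rfl | rfl⟩
      · exact absurd (.refl _ _) h1
      · exact absurd (s1.1 (.refl _ _)) h1
      · exact absurd (s2.1 (.refl _ _)) h1
      · have hc : ¬ K.c3 := fun hc => h2 ⟨hc, .refl _ _⟩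
        exact ⟨⟨K.ar, K.ret_ar⟩, (K.sc_ar h Δ hc _).1 (.refl _ _)⟩
      · exact absurd ⟨hc, s4.1 (.refl _ _)⟩ h2
      · exact absurd ⟨hc, s3.1 (.refl _ _)⟩ h2
    · exact ⟨⟨d, hr⟩, .refl _ _⟩
  have B := h.bnd e0 (fun k => hd (he0.trans ((K.sc_o _).1 k)))
  rw [Finset.card_filter] at B
  have cong : ∀ e : K.D', K.M'.ψ.SameCycle e0 e ↔ M.ψ.SameCycle d e.1 := fun e => by
    rw [K.sc]; exact ⟨he0.trans, he0.symm.trans⟩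
  simp only [cong] at B
  by_cases hc : K.c3
  · have hw : ¬ M.ψ.SameCycle d K.wu := fun k => h2 ⟨hc, k⟩
    simp only [h1, hw, hc, if_true, if_false, false_and, add_zero]
    rw [← B]
    exact Finset.sum_congr rfl fun e _ => by rw [K.a0_ret h Δ e (K.σ_ret3 hc e)]
  · simp only [h1, hc, if_false, add_zero, zero_add]
    rw [← Finset.add_sum_erase _ _ (Finset.mem_univ (⟨K.ar, K.ret_ar⟩ : K.D'))] at B ⊢
    rw [← B, add_right_comm]
    congr 1
    · simp only [K.sc_ar h Δ hc]
      rw [K.ang_ar h Δ hc, K.a0_ar h Δ hc, K.a0_wu h Δ]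
      by_cases ha : M.ψ.SameCycle d K.ar
      · simp only [ha, true_and]
        have l1 := Δ.l1 hc; have l2 := Δ.l2 hc
        have n1 := (K.ang_tendsto h Δ K.ar).2
        rw [K.a0_ar h Δ hc] at n1
        have n2 := (K.ang_tendsto h Δ K.wu).2
        rw [K.a0_wu h Δ] at n2
        rcases lt_trichotomy (K.β P' - K.α P') Real.pi with g | g | g
        · rcases l2 g with ⟨g1, g2⟩ | ⟨g1, g2⟩
          · rw [if_neg (by linarith), if_pos (by linarith), if_pos g]
          · rw [if_pos (by linarith), if_neg (by linarith), if_pos g]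
        · exfalso
          have k := K.ang_ar h Δ hc
          rw [g] at k
          exact h.ne_pi _ k
        · obtain ⟨g1, g2⟩ := l1 g
          rw [if_neg (by linarith), if_neg (by linarith), if_neg (by linarith)]
      · simp [ha]
    · refine Finset.sum_congr rfl fun e he => ?_
      rw [K.a0_ret h Δ e (K.σ_ret2 hc e (Finset.ne_of_mem_erase he))]
omit Δ in
lemma good : ∃ P, M.Good P := by
  classical
  obtain ⟨δ, c, Δ⟩ := K.exists_Del h
  have ev1 : ∀ᶠ ε : ℝ in 𝓝[>] 0, ∀ d d', K.Q ε P' c d d' := by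
    rw [eventually_all]; intro d; rw [eventually_all]; exact K.Q_ev h Δ d
  have ev2 : ∀ᶠ ε : ℝ in 𝓝[>] 0, ∀ d, (M.ang (K.Pe P' c ε) d < Real.pi ↔ K.a0 P' c d < Real.pi) ∧ (Real.pi < K.a0 P' c d → Real.pi < M.ang (K.Pe P' c ε) d) := by
    rw [eventually_all]; intro d
    obtain ⟨t, n⟩ := K.ang_tendsto h Δ d
    rcases lt_or_gt_of_ne n with g | g
    · filter_upwards [t.eventually_lt_const g] with ε hε
      exact ⟨⟨fun _ => g, fun _ => hε⟩, fun k => absurd k (by linarith)⟩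
    · filter_upwards [t.eventually_const_lt g] with ε hε
      exact ⟨⟨fun k => absurd k (by linarith), fun k => absurd k (by linarith)⟩, fun _ => hε⟩
  obtain ⟨ε, gp, q, sm, lb⟩ := ((K.Pe_gp h Δ).and (ev1.and ((K.sums h Δ).and ev2))).exists
  have T := tab K
  have inj : Function.Injective (K.Pe P' c ε) := fun a b k => by
    by_contra hab
    obtain ⟨z, z1, z2⟩ : ∃ z, a ≠ z ∧ b ≠ z := by
      by_cases k1 : K.u ≠ a ∧ K.u ≠ b
      · exact ⟨_, k1.1.symm, k1.2.symm⟩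
      by_cases k2 : K.w ≠ a ∧ K.w ≠ b
      · exact ⟨_, k2.1.symm, k2.2.symm⟩
      by_cases k3 : K.x ≠ a ∧ K.x ≠ b
      · exact ⟨_, k3.1.symm, k3.2.symm⟩
      exfalso
      have := T.n1; have := T.n2; have := T.n3
      grind
    exact gp a b z hab z1 z2 (by rw [k]; simp [cr])
  refine ⟨_, inj, gp, q, sm inj, fun d hd => (lb d).2 (K.a0_outer h Δ d hd), fun d hd => ?_⟩
  rw [← K.a0_bnd h Δ d hd]
  congr 1
  ext d'; simp [(lb d').1]
end CT
end PTri

namespace PTri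
open Finset Complex Filter Topology
set_option linter.all false
lemma good_two {V D : Type} [Fintype V] [DecidableEq V] [Fintype D] [DecidableEq D] (M : PMap V D) (hV : Fintype.card V ≤ 2) : ∃ P, M.Good P := by
  classical
  have tri : ∀ a b c : V, a ≠ b → a ≠ c → b ≠ c → False := fun a b c h1 h2 h3 => by
    have := Finset.card_le_univ ({a, b, c} : Finset V)
    rw [Finset.card_eq_three.2 ⟨a, b, c, h1, h2, h3, rfl⟩] at this; omega
  have same : ∀ d d', M.tail d = M.tail d' → d = d' := fun d d' h => by
    refine M.simple _ _ h ?_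
    by_contra k
    exact tri (M.tail d) (M.head d) (M.head d') (M.ne_head d) (h ▸ M.ne_head d') k
  have σ1 : ∀ d, M.σ d = d := fun d => same _ _ (M.tail_σ d)
  have inj : Function.Injective (fun v : V => if v = M.tail M.o then (0 : ℂ) else 1) := by
    intro a b k
    by_cases h1 : a = M.tail M.o <;> by_cases h2 : b = M.tail M.o <;> simp [h1, h2] at k ⊢
    by_contra k; exact tri _ _ _ k h1 h2
  have ag : ∀ d, M.ang (fun v : V => if v = M.tail M.o then (0 : ℂ) else 1) d = 2 * Real.pi := fun d => by
    rw [PMap.ang, σ1]; exact ccw_self (sub_ne_zero.2 fun k => M.ne_head d (inj k).symm)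
  refine ⟨_, inj, fun a b c h1 h2 h3 => (tri a b c h1 h2 h3).elim, fun d d' h1 h2 h3 h4 => (tri _ _ _ h1 h2 (M.ne_head d')).elim, ?_, ?_, ?_⟩
  · intro v
    obtain ⟨d, rfl⟩ := M.surj v
    rw [show Finset.univ.filter (fun d' => M.tail d' = M.tail d) = {d} by ext d'; simp; exact ⟨same _ _, fun k => k ▸ rfl⟩]
    simp [ag]
  · intro d _; rw [ag]; linarith [Real.pi_pos]
  · intro d hd
    exfalso; apply hd
    by_cases k : M.tail d = M.tail M.o
    · rw [same _ _ k]
    · have : M.ψ d = M.o := by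
        rw [M.ψ_apply, σ1]
        apply same
        by_contra k'
        exact tri _ _ _ k (M.ne_head d) (Ne.symm k')
      rw [← this, Equiv.Perm.sameCycle_apply_right]
lemma exists_good (n : ℕ) : ∀ {V D : Type} [Fintype V] [DecidableEq V] [Fintype D] [DecidableEq D] (M : PMap V D) {L : Finset (Sym2 V)},
    Fintype.card V = n → Laman L → M.Sub L → ∃ P, M.Good P := by
  induction n using Nat.strong_induction_on with
  | _ n ih =>
    intro V D _ _ _ _ M L hn hL hs
    by_cases h2 : Fintype.card V ≤ 2
    · exact good_two M h2
    obtain ⟨K, L', hL', hs'⟩ := contract hL hs (by omega)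
    have hc : Fintype.card {v // v ≠ K.u} = Fintype.card V - 1 := by simp [Fintype.card_subtype_compl]
    obtain ⟨P', h⟩ := ih (n-1) (by omega) K.M' (by rw [hc, hn]) hL' hs'
    exact K.good h
end PTri

namespace PTri
open Finset
set_option linter.all false
section
variable {V : Type} [Fintype V] [DecidableEq V] {G : SimpleGraph V} [DecidableRel G.Adj] (E : PlaneEmb G)
lemma aF_rot (d : G.Dart) : E.angleFace (E.rot d).symm = E.angleFace d :=
  Quotient.sound (show (E.rot * dartSymmPerm G).SameCycle _ _ by
    rw [SimpleGraph.Dart.symm_symm]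
    have : E.rot d = (E.rot * dartSymmPerm G) d.symm := by simp [dartSymmPerm]
    rw [this, Equiv.Perm.sameCycle_apply_left])
include E in
lemma conn (S : V → Prop) (hS : ∀ d : G.Dart, S d.fst → S d.snd) {v w : V} (hv : S v) : S w := by
  obtain ⟨p⟩ := E.connected.preconnected v w
  induction p with
  | nil => exact hv
  | cons h p ih => exact ih (hS ⟨(_, _), h⟩ hv)
lemma rot_inv {A : Type} (g : G.Dart → A) (h : ∀ d, g (E.rot d) = g d) {d d' : G.Dart} (hd : d.fst = d'.fst) : g d = g d' := by
  obtain ⟨n, rfl⟩ := E.rot_vertex d d' hd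
  induction n with
  | zero => rfl
  | succ n ih => 
    rw [pow_succ', Equiv.Perm.mul_apply, h]; apply ih
    clear ih hd
    induction n with
    | zero => rfl
    | succ n ih => rw [pow_succ', Equiv.Perm.mul_apply, E.rot_fst]; exact ih
lemma aF_surj (F : E.Face) : ∃ d, E.angleFace d = F := by
  induction F using Quotient.inductionOn with
  | _ d => exact ⟨d.symm, by simp [PlaneEmb.angleFace]⟩
lemma dart_conn (g : G.Dart → Prop) (h1 : ∀ d, g (E.rot d) ↔ g d) (h2 : ∀ d, g d → g d.symm) {d d' : G.Dart} (hd : g d) : g d' := by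
  have key := conn E (fun v => ∀ d : G.Dart, d.fst = v → g d) (fun a ha b hb => by
    have := h2 _ (ha a rfl)
    rwa [rot_inv E g (fun d => propext (h1 d)) (d' := b) (by rw [hb]; rfl)] at this) (v := d.fst) (w := d'.fst)
    (fun b hb => by rwa [rot_inv E g (fun d => propext (h1 d)) (d' := d) hb])
  exact key d' rfl
variable {k : Type} [Field k]
open Classical in
theorem exactK (f : G.Dart → k) (h1 : ∀ d, f d.symm = - f d) (h2 : ∀ v, ∑ d ∈ univ.filter (fun d : G.Dart => d.fst = v), f d = 0) :
    ∃ c : E.Face → k, ∀ d, f d = c (E.angleFace d) - c (E.angleFace d.symm) := by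
  haveI : Fintype E.Face := Fintype.ofFinite _
  let Δ : (E.Face → k) →ₗ[k] (G.Dart → k) :=
    { toFun := fun c d => c (E.angleFace d) - c (E.angleFace d.symm)
      map_add' := fun a b => by ext d; simp; ring
      map_smul' := fun a b => by ext d; simp; ring }
  let A : Submodule k (G.Dart → k) :=
    { carrier := {f | ∀ d, f d.symm = - f d}
      add_mem' := fun ha hb d => by simp [ha d, hb d]; ring
      zero_mem' := fun d => by simp
      smul_mem' := fun c f hf d => by simp [hf d] }
  let B : (G.Dart → k) →ₗ[k] (V → k) :=
    { toFun := fun f v => ∑ d ∈ univ.filter (fun d : G.Dart => d.fst = v), f d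
      map_add' := fun a b => by ext d; simp [sum_add_distrib]
      map_smul' := fun a b => by ext d; simp [mul_sum] }
  have eu := E.euler
  rw [Nat.card_eq_fintype_card, Nat.card_eq_fintype_card (α := E.Face), Nat.card_eq_fintype_card, ← SimpleGraph.edgeFinset_card] at eu
  have dc := G.dart_card_eq_twice_card_edges
  -- dim A ≤ e
  have dA : Module.finrank k A ≤ #G.edgeFinset := by
    let e := Fintype.equivFin G.Dart
    let O := univ.filter (fun d : G.Dart => e d < e d.symm)
    have hO : #O ≤ #G.edgeFinset := by
      have : O ∪ O.image SimpleGraph.Dart.symm ⊆ univ := subset_univ _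
      have := card_le_card this
      rw [card_univ, card_union_of_disjoint, card_image_of_injective _ SimpleGraph.Dart.symm_involutive.injective] at this
      · omega
      · rw [disjoint_left]; intro d hd hd'
        obtain ⟨d', h', rfl⟩ := mem_image.1 hd'
        replace hd := (mem_filter.1 hd).2; replace h' := (mem_filter.1 h').2
        rw [SimpleGraph.Dart.symm_symm] at hd; exact absurd hd h'.not_gt
    have inj : Function.Injective ((LinearMap.funLeft k k (fun d : O => d.1)).comp A.subtype) := by
      rw [← LinearMap.ker_eq_bot, LinearMap.ker_eq_bot']
      rintro ⟨f, hf⟩ h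
      ext d
      have h' : ∀ d : G.Dart, e d < e d.symm → f d = 0 := fun d hd => congrFun h ⟨d, by simp [O, hd]⟩
      rcases lt_trichotomy (e d) (e d.symm) with q | q | q
      · exact h' d q
      · exact absurd (e.injective q).symm d.symm_ne
      · have := h' d.symm (by simpa using q)
        rw [hf d, neg_eq_zero] at this; exact this
    calc _ ≤ Module.finrank k (O → k) := LinearMap.finrank_le_finrank_of_injective inj
      _ = #O := by simp
      _ ≤ _ := hO
  -- rank B on A
  let BA := B.comp A.subtype
  have rB : Fintype.card V ≤ Module.finrank k (LinearMap.range BA) + 1 := by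
    obtain ⟨v0⟩ := E.connected.nonempty
    have top : LinearMap.range BA ⊔ Submodule.span k {(Pi.single v0 1 : V → k)} = ⊤ := by
      rw [eq_top_iff]
      have key : ∀ v, (Pi.single v 1 : V → k) ∈ LinearMap.range BA ⊔ Submodule.span k {(Pi.single v0 1 : V → k)} := by
        intro v
        refine conn E (fun v => (Pi.single v 1 : V → k) ∈ LinearMap.range BA ⊔ Submodule.span k {(Pi.single v0 1 : V → k)}) (v := v0) ?_ (Submodule.mem_sup_right (Submodule.mem_span_singleton_self _))
        intro d hd
        have : (Pi.single d.snd 1 : V → k) - Pi.single d.fst 1 ∈ LinearMap.range BA := by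
          refine ⟨⟨Pi.single d.symm 1 - Pi.single d 1, fun d' => ?_⟩, ?_⟩
          · have a1 : (Pi.single d.symm 1 : G.Dart → k) d'.symm = (Pi.single d 1 : G.Dart → k) d' := by
              simp only [Pi.single_apply, SimpleGraph.Dart.symm_involutive.injective.eq_iff]
            have a2 : (Pi.single d 1 : G.Dart → k) d'.symm = (Pi.single d.symm 1 : G.Dart → k) d' := by
              simp only [Pi.single_apply, SimpleGraph.Dart.symm_involutive.eq_iff]
            simp [a1, a2]
          · ext v
            show ∑ d' ∈ univ.filter (fun d : G.Dart => d.fst = v), (Pi.single d.symm 1 - Pi.single d 1 : G.Dart → k) d' = _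
            simp only [Pi.sub_apply, sum_sub_distrib, Pi.single_apply, sum_ite_eq', mem_filter, mem_univ, true_and]
            simp [eq_comm]
        have := Submodule.add_mem _ (Submodule.mem_sup_left this) hd
        simpa using this
      intro x _
      rw [← Finset.univ_sum_single x]
      refine Submodule.sum_mem _ fun v _ => ?_
      have := Submodule.smul_mem _ (x v) (key v)
      rwa [← Pi.single_smul, smul_eq_mul, mul_one] at this
    have := Submodule.finrank_add_le_finrank_add_finrank (LinearMap.range BA) (Submodule.span k {(Pi.single v0 1 : V → k)})
    rw [top, finrank_top, Module.finrank_fintype_fun_eq_card] at this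
    have : Module.finrank k (Submodule.span k {(Pi.single v0 1 : V → k)}) ≤ 1 := (finrank_span_le_card _).trans (by simp)
    omega
  have rn := LinearMap.finrank_range_add_finrank_ker BA
  -- Δ
  have kΔ : Module.finrank k (LinearMap.ker Δ) ≤ 1 := by
    refine (Submodule.finrank_mono (?_ : _ ≤ Submodule.span k {(fun _ => 1 : E.Face → k)})).trans ((finrank_span_le_card _).trans (by simp))
    intro c hc
    have hc : ∀ d, c (E.angleFace d) = c (E.angleFace d.symm) := fun d => sub_eq_zero.1 (congrFun hc d)
    obtain ⟨d0, -⟩ := aF_surj E E.outer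
    rw [Submodule.mem_span_singleton]
    refine ⟨c (E.angleFace d0), ?_⟩
    ext F
    obtain ⟨d, rfl⟩ := aF_surj E F
    simp only [Pi.smul_apply, smul_eq_mul, mul_one]
    refine dart_conn E (fun d => c (E.angleFace d0) = c (E.angleFace d)) (fun d => ?_) (fun d h => by rw [h, hc]) (d := d0) rfl
    rw [hc (E.rot d), aF_rot]
  have rΔ := LinearMap.finrank_range_add_finrank_ker Δ
  rw [Module.finrank_fintype_fun_eq_card] at rΔ
  have le : LinearMap.range Δ ≤ (LinearMap.ker BA).map A.subtype := by
    rintro _ ⟨c, rfl⟩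
    have hA : Δ c ∈ A := fun d => by simp [Δ]
    refine ⟨⟨Δ c, hA⟩, ?_, rfl⟩
    ext v
    show ∑ d ∈ univ.filter (fun d : G.Dart => d.fst = v), (c (E.angleFace d) - c (E.angleFace d.symm)) = 0
    rw [sum_sub_distrib, sub_eq_zero]
    refine sum_equiv E.rot (fun d => by simp [E.rot_fst]) (fun d _ => by rw [aF_rot])
  have fm : Module.finrank k ((LinearMap.ker BA).map A.subtype) ≤ Module.finrank k (LinearMap.ker BA) := Submodule.finrank_map_le _ _
  have eq := Submodule.eq_of_le_of_finrank_le le (by omega)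
  have : f ∈ (LinearMap.ker BA).map A.subtype := ⟨⟨f, h1⟩, by ext v; exact h2 v, rfl⟩
  rw [← eq] at this
  obtain ⟨c, rfl⟩ := this
  exact ⟨c, fun d => rfl⟩
end
end PTri

namespace PTri
open Finset
set_option linter.all false
section
variable {V : Type} [Fintype V] [DecidableEq V] {G : SimpleGraph V} [DecidableRel G.Adj] (E : PlaneEmb G)
include E in
lemma has_dart (v : V) : ∃ d : G.Dart, d.fst = v := by
  obtain ⟨d, -⟩ := aF_surj E E.outer
  exact conn E (fun v => ∃ d : G.Dart, d.fst = v) (fun d _ => ⟨d.symm, rfl⟩) (v := d.fst) ⟨d, rfl⟩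
noncomputable def toP : PMap V G.Dart where
  σ := E.rot
  τ := dartSymmPerm G
  tail d := d.fst
  ττ d := SimpleGraph.Dart.symm_symm d
  tail_σ := E.rot_fst
  trans g hg d d' h hd := by
    obtain ⟨n, rfl⟩ := E.rot_vertex d d' h
    clear h
    induction n with
    | zero => exact hd
    | succ n ih => rw [pow_succ', Equiv.Perm.mul_apply]; exact hg _ ih
  simple d d' h1 h2 := SimpleGraph.Dart.ext _ _ (Prod.ext h1 h2)
  noloop d := d.fst_ne_snd
  surj := has_dart E
  exact f h1 h2 := by
    obtain ⟨c, hc⟩ := exactK E f (fun d => by rw [ZMod.neg_eq_self_mod_two]; exact h1 d) h2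
    exact ⟨fun d => c (E.angleFace d), fun d => congrArg c (aF_rot E d), fun d => by rw [hc, ZModModule.sub_eq_add]; rfl⟩
  o := (aF_surj E E.outer).choose
lemma aF_o : E.angleFace (toP E).o = E.outer := (aF_surj E E.outer).choose_spec
lemma sc_iff (d d' : G.Dart) : (toP E).ψ.SameCycle d d' ↔ E.angleFace d = E.angleFace d' := by
  have e : (toP E).ψ = dartSymmPerm G * (E.rot * dartSymmPerm G) * (dartSymmPerm G)⁻¹ := by
    rw [mul_assoc, mul_assoc, mul_inv_cancel, mul_one]; rfl
  rw [e, Equiv.Perm.sameCycle_conj]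
  exact (Quotient.eq (r := faceSetoid (E.rot * dartSymmPerm G))).symm
lemma dartAngle_eq (P : V → ℂ) (p : V → ℝ × ℝ) (hp : ∀ v, P v = ⟨(p v).1, (p v).2⟩) (hi : Function.Injective P) (d : G.Dart) :
    dartAngle E p d = (toP E).ang P d := by
  have e : ∀ a b : V, (⟨(p a - p b).1, (p a - p b).2⟩ : ℂ) = P a - P b := fun a b => by rw [hp, hp]; rfl
  rw [dartAngle, ccwAngle, e, e, ccw_if, if_neg]
  · rfl
  · exact div_ne_zero (sub_ne_zero.2 fun k => (E.rot d).fst_ne_snd (hi k).symm) (sub_ne_zero.2 fun k => d.fst_ne_snd (hi k).symm)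
lemma cr_col {a b c : ℝ × ℝ} (h : Collinear ℝ ({a, b, c} : Set (ℝ × ℝ))) : (b.1 - a.1) * (c.2 - a.2) - (b.2 - a.2) * (c.1 - a.1) = 0 := by
  obtain ⟨v, hv⟩ := (collinear_iff_of_mem (p₀ := a) (by simp)).1 h
  obtain ⟨r, rfl⟩ := hv b (by simp)
  obtain ⟨s, rfl⟩ := hv c (by simp)
  simp; ring
lemma good_st {P : V → ℂ} (h : (toP E).Good P) : ∃ p, StretchesToPT G E p := by
  classical
  let L := Complex.equivRealProdLm
  let p : V → ℝ × ℝ := fun v => L (P v)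
  have ha := dartAngle_eq E P p (fun v => rfl) h.inj
  have seg : ∀ a b, segment ℝ (p a) (p b) = L '' segment ℝ (P a) (P b) := fun a b => (image_segment ℝ L.toLinearMap.toAffineMap _ _).symm
  have off : ∀ x a b : V, a ≠ b → x ≠ a → x ≠ b → P x ∉ segment ℝ (P a) (P b) := fun x a b h1 h2 h3 hm =>
    h.gp x a b h2 h3 h1 (CT.seg_cr hm)
  have one : ∀ a b c : V, a ≠ b → a ≠ c → b ≠ c → ∀ z, z ∈ segment ℝ (P a) (P b) → z ∈ segment ℝ (P a) (P c) → z = P a := by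
    rintro a b c h1 h2 h3 z ⟨s', s, -, -, hs, rfl⟩ ⟨t', t, -, -, ht, e⟩
    obtain rfl : s' = 1 - s := by linarith
    obtain rfl : t' = 1 - t := by linarith
    have g := h.gp a b c h1 h2 h3
    have e' : (t : ℂ) * (P c - P a) = s * (P b - P a) := by
      simp only [Complex.real_smul] at e; push_cast at e; linear_combination e
    have : s * cr (P b - P a) (P c - P a) = 0 := by
      have e1 := congrArg Complex.re e'; have e2 := congrArg Complex.im e'
      simp at e1 e2
      simp only [cr, Complex.sub_re, Complex.sub_im]
      linear_combination -((P c).im - (P a).im) * e1 + ((P c).re - (P a).re) * e2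
    obtain rfl := (mul_eq_zero.1 this).resolve_right g
    simp
  refine ⟨p, fun d => Real.pi < (toP E).ang P d, ⟨?_, ?_, ?_⟩, ⟨L.injective.comp h.inj, ⟨?_, ?_⟩, ?_⟩, ?_, ?_⟩
  · intro F hF
    obtain ⟨d, rfl⟩ := aF_surj E F
    rw [← h.bnd d (fun k => hF (by rw [← aF_o E]; exact (sc_iff E _ _).1 k)), Nat.card_eq_fintype_card, Fintype.card_subtype]
    congr 1; ext d'
    simp only [mem_filter, mem_univ, true_and, sc_iff, Set.mem_setOf_eq, not_lt, eq_comm (a := E.angleFace d)]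
    exact and_congr_right fun _ => ⟨fun k => lt_of_le_of_ne k (h.ne_pi _), le_of_lt⟩
  · intro d hd
    exact h.outer d ((sc_iff E _ _).2 (by rw [hd, aF_o]))
  · intro d d' h1 h2 hd
    by_contra hne
    have := h.sum d.fst
    have le : ∑ x ∈ {d, d'}, (toP E).ang P x ≤ ∑ x ∈ univ.filter (fun x => (toP E).tail x = d.fst), (toP E).ang P x :=
      sum_le_sum_of_subset_of_nonneg (by intro x hx; simp at hx; rcases hx with rfl | rfl <;> simp [toP, hd]) (fun _ _ _ => (ccw_pos _ _).le)
    rw [this, sum_pair hne] at le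
    linarith
  · rintro a b c d h1 h2 hne z ⟨z1, z2⟩
    rw [seg] at z1 z2
    obtain ⟨z, z1, rfl⟩ := z1
    obtain ⟨z', z2, e⟩ := z2
    obtain rfl := L.injective e
    have ab := h1.ne; have cd := h2.ne
    by_cases k1 : a = c
    · subst k1
      have : b ≠ d := fun k => hne (by rw [k])
      exact ⟨a, by simp, by rw [one a b d ab cd this z' z1 z2]⟩
    by_cases k2 : a = d
    · subst k2
      have : b ≠ c := fun k => hne (by rw [k, Set.pair_comm])
      rw [segment_symm] at z2
      exact ⟨a, by simp, by rw [one a b c ab cd.symm this z' z1 z2]⟩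
    by_cases k3 : b = c
    · subst k3
      rw [segment_symm] at z1
      exact ⟨b, by simp, by rw [one b a d ab.symm cd k2 z' z1 z2]⟩
    by_cases k4 : b = d
    · subst k4
      rw [segment_symm] at z1 z2
      exact ⟨b, by simp, by rw [one b a c ab.symm cd.symm k1 z' z1 z2]⟩
    exact absurd z2 (Set.disjoint_left.1 (h.nc ⟨(a, b), h1⟩ ⟨(c, d), h2⟩ k1 k2 k3 k4) z1)
  · intro x a b hab h1 h2 hm
    rw [seg] at hm
    obtain ⟨z, hz, e⟩ := hm
    rw [L.injective e] at hz
    exact off x a b hab.ne h1 h2 hz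
  · intro v _
    simp only [ha]; exact h.sum v
  · intro u v w h1 h2 h3 hc
    exact h.gp u v w h1 h2 h3 (cr_col hc)
  · intro d; rw [ha]
    exact ⟨id, fun k => lt_of_le_of_ne (not_lt.1 k) (h.ne_pi _)⟩
end
end PTri

namespace PTri
open Finset
set_option linter.all false
lemma exists_generic (V : Type) [Fintype V] : ∃ p : V → ℝ × ℝ, GenericConf p := by
  obtain ⟨s, hs⟩ := exists_isTranscendenceBasis ℚ ℝ
  have inf : Infinite s := by
    by_contra hf
    rw [not_infinite_iff_finite] at hf
    have c0 : Cardinal.mk ℝ ≤ Cardinal.aleph0 := by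
      rcases isEmpty_or_nonempty s with h | h
      · have := hs.isEmpty_iff_isAlgebraic.1 h
        exact (Algebra.IsAlgebraic.cardinalMk_le_max ℚ ℝ).trans (by simp)
      · have := hs.lift_cardinalMk_eq_max_lift
        simp at this
        exact this.le
    rw [Cardinal.mk_real] at c0
    exact absurd c0 (not_le.2 Cardinal.aleph0_lt_continuum)
  obtain ⟨g⟩ : Nonempty ((V ⊕ V) ↪ s) := by
    have := Infinite.natEmbedding s
    exact ⟨(Fintype.equivFin (V ⊕ V)).toEmbedding.trans (Fin.valEmbedding.trans this)⟩
  refine ⟨fun v => ((g (.inl v)).1, (g (.inr v)).1), ?_⟩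
  have := hs.1.comp g g.injective
  unfold GenericConf
  convert this using 1
  ext x; rcases x with v | v <;> rfl
end PTri

namespace PTri
open Finset
set_option linter.all false
section rig
variable {V : Type} [Fintype V] [DecidableEq V]
def rm {R : Type} [CommRing R] (c : V ⊕ V → R) : Matrix (Sym2 V) (V ⊕ V) R :=
  Sym2.lift ⟨fun u v x => x.elim (fun w => ((if w = u then 1 else 0) - (if w = v then 1 else 0)) * (c (.inl u) - c (.inl v)))
    (fun w => ((if w = u then 1 else 0) - (if w = v then 1 else 0)) * (c (.inr u) - c (.inr v))), by
    intro u v; ext x; rcases x with w | w <;> simp <;> ring⟩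
lemma rm_mul {R : Type} [CommRing R] (c q : V ⊕ V → R) (u v : V) :
    ∑ x, rm c s(u, v) x * q x = (c (.inl u) - c (.inl v)) * (q (.inl u) - q (.inl v)) + (c (.inr u) - c (.inr v)) * (q (.inr u) - q (.inr v)) := by
  simp only [rm, Sym2.lift_mk, Fintype.sum_sum_type, Sum.elim_inl, Sum.elim_inr, sub_mul, ite_mul, one_mul, zero_mul, Finset.sum_sub_distrib, Finset.sum_ite_eq', Finset.mem_univ, if_true]
  ring
def co (p : V → ℝ × ℝ) : V ⊕ V → ℝ := fun x => Sum.elim (fun v => (p v).1) (fun v => (p v).2) x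
def rw' {ι : Type} (p : V → ℝ × ℝ) (f : ι → Sym2 V) : Matrix ι (V ⊕ V) ℝ := fun i => rm (co p) (f i)
def IndE {ι : Type} (p : V → ℝ × ℝ) (f : ι → Sym2 V) : Prop := LinearIndependent ℝ (rw' p f).row
lemma rk {ι : Type} [Fintype ι] (p : V → ℝ × ℝ) (f : ι → Sym2 V) :
    (rw' p f).rank + Module.finrank ℝ (LinearMap.ker (rw' p f).mulVecLin) = 2 * Fintype.card V := by
  have := (rw' p f).mulVecLin.finrank_range_add_finrank_ker
  rw [Matrix.rank, this]; simp; ring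
/-- trivial motions on S, arbitrary off S -/
def tv (p : V → ℝ × ℝ) (S : Finset V) : (ℝ × ℝ × ℝ) × ({v // v ∉ S} ⊕ {v // v ∉ S} → ℝ) →ₗ[ℝ] (V ⊕ V → ℝ) where
  toFun a x := x.elim (fun v => if h : v ∈ S then - a.1.1 * (p v).2 + a.1.2.1 else a.2 (.inl ⟨v, h⟩))
    (fun v => if h : v ∈ S then a.1.1 * (p v).1 + a.1.2.2 else a.2 (.inr ⟨v, h⟩))
  map_add' a b := by ext x; rcases x with v | v <;> simp <;> split_ifs <;> ring
  map_smul' a b := by ext x; rcases x with v | v <;> simp <;> split_ifs <;> ring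
lemma tv_inj {p : V → ℝ × ℝ} (hp : Function.Injective p) {S : Finset V} (hS : 2 ≤ S.card) : Function.Injective (tv p S) := by
  rw [← LinearMap.ker_eq_bot, LinearMap.ker_eq_bot']
  rintro ⟨⟨a, b, c⟩, g⟩ h
  have h1 : ∀ v ∈ S, -a * (p v).2 + b = 0 ∧ a * (p v).1 + c = 0 := fun v hv => by
    have e1 := congrFun h (.inl v); have e2 := congrFun h (.inr v)
    simp [tv, hv] at e1 e2; exact ⟨by linarith, e2⟩
  obtain ⟨u, hu, v, hv, huv⟩ := Finset.one_lt_card.1 hS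
  have ha : a = 0 := by
    by_contra ha
    refine huv (hp (Prod.ext ?_ ?_)) <;> refine mul_left_cancel₀ ha ?_ <;> linarith [h1 u hu, h1 v hv, (h1 u hu).1, (h1 u hu).2, (h1 v hv).1, (h1 v hv).2]
  subst ha
  have h2 := h1 u hu
  have hg : g = 0 := by
    ext x; rcases x with ⟨v, hv⟩ | ⟨v, hv⟩
    · simpa [tv, hv] using congrFun h (.inl v)
    · simpa [tv, hv] using congrFun h (.inr v)
  simp at h2; simp [h2.1, h2.2, hg]
lemma tv_ker (p : V → ℝ × ℝ) (S : Finset V) {ι : Type} [Fintype ι] (f : ι → Sym2 V) (hf : ∀ i, ∃ u ∈ S, ∃ v ∈ S, f i = s(u, v)) :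
    LinearMap.range (tv p S) ≤ LinearMap.ker (rw' p f).mulVecLin := by
  rintro _ ⟨a, rfl⟩
  rw [LinearMap.mem_ker]; ext i
  obtain ⟨u, hu, v, hv, h⟩ := hf i
  simp only [Matrix.mulVecLin_apply, Matrix.mulVec, dotProduct, rw', h, rm_mul, co]
  simp [tv, hu, hv]; ring
lemma tv_rank {p : V → ℝ × ℝ} (hp : Function.Injective p) {S : Finset V} (hS : 2 ≤ S.card) :
    Module.finrank ℝ (LinearMap.range (tv p S)) + 2 * S.card = 3 + 2 * Fintype.card V := by
  rw [LinearMap.finrank_range_of_inj (tv_inj hp hS)]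
  have := Fintype.card_subtype_compl (fun v => v ∈ S)
  have h2 := Finset.card_le_univ S
  simp at this ⊢; omega
lemma ind_cnt {p : V → ℝ × ℝ} (hp : Function.Injective p) {S : Finset V} (hS : 2 ≤ S.card) {ι : Type} [Fintype ι]
    (f : ι → Sym2 V) (hf : ∀ i, ∃ u ∈ S, ∃ v ∈ S, f i = s(u, v)) (hi : IndE p f) : Fintype.card ι + 3 ≤ 2 * S.card := by
  have h1 := rk p f
  have h2 := Submodule.finrank_mono (tv_ker p S f hf)
  have h3 := tv_rank hp hS
  rw [hi.rank_matrix] at h1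
  omega
lemma sub_of_rank (G : SimpleGraph V) {p : V → ℝ × ℝ} (h : 2 * Fintype.card V ≤ (rw' p (fun e : G.edgeSet => e.1)).rank + 3)
    (hp : Function.Injective p) (hV : 2 ≤ Fintype.card V) :
    ∃ L : Finset (Sym2 V), Laman L ∧ (∀ e ∈ L, e ∈ G.edgeSet) ∧ IndE p (fun e : L => e.1) := by
  classical
  rw [Matrix.rank_eq_finrank_span_row] at h
  obtain ⟨b, hb, hs, hi⟩ := exists_linearIndependent ℝ (Set.range (rw' p (fun e : G.edgeSet => e.1)).row)
  choose g hg using fun x : b => hb x.2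
  rw [← hs] at h
  have hfb : Finite b := (Set.finite_range _).subset hb
  have : Fintype b := Fintype.ofFinite _
  have hgi : Function.Injective fun x => (g x).1 := fun x y e => Subtype.ext (by rw [← hg x, ← hg y, Subtype.ext e])
  rw [finrank_span_set_eq_card hi, Set.toFinset_card] at h
  have hL : IndE p (fun e : (univ.image fun x => (g x).1) => e.1) := by
    let e : b ≃ (univ.image fun x => (g x).1) := Equiv.ofBijective (fun x => ⟨(g x).1, by simp⟩)
      ⟨fun x y e => hgi (by simpa using e), by rintro ⟨y, hy⟩; simp at hy; obtain ⟨x, hx, rfl⟩ := hy; exact ⟨⟨x, hx⟩, rfl⟩⟩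
    refine (linearIndependent_equiv e).1 ?_
    exact (funext hg : (rw' p fun e : (univ.image fun x => (g x).1) => e.1).row ∘ e = (Subtype.val : b → _)) ▸ hi
  have hG : ∀ e ∈ (univ.image fun x => (g x).1), e ∈ G.edgeSet := by
    intro e he; simp only [mem_image] at he; obtain ⟨x, -, rfl⟩ := he; exact (g x).2
  refine ⟨_, ⟨fun e he hd => G.not_isDiag_of_mem_edgeSet (hG e he) hd, ?_, fun S hS => ?_⟩, hG, hL⟩
  · have := ind_cnt hp (S := univ) (by simpa using hV) (fun e : (univ.image fun x => (g x).1) => e.1) (fun i => by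
      induction i.1 with | _ u v => exact ⟨u, mem_univ _, v, mem_univ _, rfl⟩) hL
    rw [Finset.card_image_of_injective _ hgi] 
    simp only [Fintype.card_coe, Finset.card_image_of_injective _ hgi, Finset.card_univ] at this ⊢
    omega
  · have := ind_cnt hp hS (fun e : ((univ.image fun x => (g x).1) ∩ S.sym2 : Finset _) => e.1) (fun i => by
      have := (mem_inter.1 i.2).2; revert this
      induction i.1 with | _ u v => intro h; rw [mk_mem_sym2_iff] at h; exact ⟨u, h.1, v, h.2, rfl⟩)
      (LinearIndependent.comp hL (fun x : ((univ.image fun x => (g x).1) ∩ S.sym2 : Finset _) => ⟨x.1, (mem_inter.1 x.2).1⟩) fun x y e => Subtype.ext (by simpa using e))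
    rwa [Fintype.card_coe] at this
lemma rank_of_rigid (G : SimpleGraph V) {p : V → ℝ × ℝ} (h : InfRigid G p) :
    2 * Fintype.card V ≤ (rw' p (fun e : G.edgeSet => e.1)).rank + 3 := by
  classical
  rw [← rk p (fun e : G.edgeSet => e.1)]
  gcongr
  have : LinearMap.ker (rw' p (fun e : G.edgeSet => e.1)).mulVecLin ≤ LinearMap.range (tv p univ ∘ₗ LinearMap.inl ℝ (ℝ × ℝ × ℝ) _) := by
    intro q hq
    obtain ⟨a, t, ht⟩ := h (fun v => (q (.inl v), q (.inr v))) (fun u v huv => by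
      have := congrFun (LinearMap.mem_ker.1 hq) ⟨s(u, v), huv⟩
      simp only [Matrix.mulVecLin_apply, Matrix.mulVec, dotProduct, rw', rm_mul, co] at this
      exact this)
    refine ⟨(a, t.1, t.2), ?_⟩
    ext x; rcases x with v | v <;> have := ht v <;> simp [rot90, Prod.ext_iff] at this <;> simp [tv, this]
  refine (Submodule.finrank_mono this).trans ((LinearMap.finrank_range_le _).trans (by simp))
lemma rigid_of_ind (G : SimpleGraph V) {p : V → ℝ × ℝ} (hp : Function.Injective p) (hV : 2 ≤ Fintype.card V) (L : Finset (Sym2 V))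
    (hc : L.card + 3 = 2 * Fintype.card V) (hG : ∀ e ∈ L, e ∈ G.edgeSet) (hi : IndE p (fun e : L => e.1)) : InfRigid G p := by
  have h1 := rk p (fun e : L => e.1)
  have h2 := tv_ker p univ (fun e : L => e.1) (fun i => by
      induction i.1 with | _ u v => exact ⟨u, mem_univ _, v, mem_univ _, rfl⟩)
  have h3 := tv_rank hp (S := univ) (by simpa using hV)
  rw [hi.rank_matrix, Fintype.card_coe] at h1
  have h4 := Submodule.eq_of_le_of_finrank_eq h2 (by rw [Finset.card_univ] at h3; omega)
  intro q hq
  have : co q ∈ LinearMap.range (tv p univ) := by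
    rw [h4, LinearMap.mem_ker]; ext ⟨e, he⟩
    have := hG e he; revert this he
    induction e with | _ u v => 
    intro he h
    simp only [Matrix.mulVecLin_apply, Matrix.mulVec, dotProduct, rw', rm_mul, co]
    exact hq u v h
  obtain ⟨⟨⟨a, b, c⟩, g⟩, h⟩ := this
  refine ⟨a, (b, c), fun v => ?_⟩
  have e1 := congrFun h (.inl v); have e2 := congrFun h (.inr v)
  simp [tv, co] at e1 e2
  ext <;> simp [rot90, ← e1, ← e2]
lemma ind_iff {ι : Type} [Fintype ι] [DecidableEq ι] (M : Matrix ι (V ⊕ V) ℝ) : LinearIndependent ℝ M.row ↔ (M * M.transpose).det ≠ 0 := by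
  have h : ∀ {κ : Type} [Fintype κ] (A : Matrix ι κ ℝ), LinearIndependent ℝ A.row ↔ Fintype.card ι = A.rank := fun A => by
    rw [A.rank_eq_finrank_span_row, linearIndependent_iff_card_eq_finrank_span, Set.finrank]
  rw [h, ← M.rank_self_mul_transpose, ← h, Matrix.linearIndependent_rows_iff_isUnit, Matrix.isUnit_iff_isUnit_det, isUnit_iff_ne_zero]
lemma transfer {p p' : V → ℝ × ℝ} (L : Finset (Sym2 V)) (hi : IndE p (fun e : L => e.1)) (hg : GenericConf p') : IndE p' (fun e : L => e.1) := by
  let M : Matrix L (V ⊕ V) (MvPolynomial (V ⊕ V) ℚ) := fun e => rm MvPolynomial.X e.1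
  have key : ∀ q : V → ℝ × ℝ, MvPolynomial.aeval (co q) (M * M.transpose).det = (rw' q (fun e : L => e.1) * (rw' q (fun e : L => e.1)).transpose).det := by
    intro q
    rw [AlgHom.map_det]; congr 1
    have : (M.map (MvPolynomial.aeval (co q))) = rw' q (fun e : L => e.1) := by
      ext ⟨e, he⟩ x
      induction e with | _ u v => 
      change MvPolynomial.aeval (co q) (rm MvPolynomial.X s(u, v) x) = rm (co q) s(u, v) x
      rcases x with w | w <;> simp only [rm, Sym2.lift_mk, Sum.elim_inl, Sum.elim_inr, map_mul, map_sub, MvPolynomial.aeval_X] <;> split_ifs <;> simp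
    rw [← this]; ext i j; simp [Matrix.mul_apply, AlgHom.mapMatrix_apply]
  unfold IndE at *
  rw [ind_iff, ← key]
  rw [ind_iff, ← key] at hi
  intro h0
  have : (M * M.transpose).det = 0 := (algebraicIndependent_iff.1 hg) _ h0
  rw [this] at hi; simp at hi
lemma gen_inj {p : V → ℝ × ℝ} (h : GenericConf p) : Function.Injective p := by
  intro u v e
  have := AlgebraicIndependent.injective h (a₁ := .inl u) (a₂ := .inl v) (by simp [e])
  simpa using this
end rig
end PTri

namespace PTri
open Finset
set_option linter.all false
section
variable {V : Type} [Fintype V] [DecidableEq V] {G : SimpleGraph V} [DecidableRel G.Adj] (E : PlaneEmb G)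
include E in
lemma two_le : 2 ≤ Fintype.card V := by
  obtain ⟨d, -⟩ := aF_surj E E.outer
  exact Fintype.one_lt_card_iff.2 ⟨_, _, d.fst_ne_snd⟩
lemma forward (h : GenRigid G) : ∃ p, StretchesToPT G E p := by
  obtain ⟨p, hp⟩ := exists_generic V
  obtain ⟨L, hL, hG, -⟩ := sub_of_rank G (rank_of_rigid G (h p hp)) (gen_inj hp) (two_le E)
  obtain ⟨P, hP⟩ := exists_good _ (toP E) rfl hL (fun e he => by
    have := hG e he; revert this
    induction e with | _ u v => intro h; exact ⟨⟨(u, v), h⟩, rfl⟩)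
  exact good_st E hP
include E in
lemma backward {p : V → ℝ × ℝ} (hi : Function.Injective p) (h : 2 * Fintype.card V ≤ (rw' p (fun e : G.edgeSet => e.1)).rank + 3) : GenRigid G := by
  obtain ⟨L, hL, hG, hI⟩ := sub_of_rank G h hi (two_le E)
  exact fun q hq => rigid_of_ind G (gen_inj hq) (two_le E) L hL.tot hG (transfer L hI hq)
structure SP (big : G.Dart → Prop) (P : V → ℂ) : Prop where
  lab : IsCPTLabelling E big
  inj : Function.Injective P
  sum : ∀ v, ∑ d ∈ univ.filter (fun d : G.Dart => d.fst = v), (toP E).ang P d = 2 * Real.pi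
  hb : ∀ d, big d → Real.pi < (toP E).ang P d
  hs : ∀ d, ¬ big d → (toP E).ang P d < Real.pi
variable {E} {big : G.Dart → Prop} {P : V → ℂ} (h : SP E big P)
include h
lemma SP.ne (d : G.Dart) : (toP E).dir P d ≠ 0 := sub_ne_zero.2 fun k => d.fst_ne_snd (h.inj k).symm
omit h in
lemma dir_ψ (d : G.Dart) : (toP E).dir P ((toP E).ψ d) = - (toP E).dir P ((toP E).σ d) := by
  simp only [PMap.dir, PMap.head, PMap.ψ_apply, (toP E).ττ, neg_sub]
open Classical in
noncomputable def dl (E : PlaneEmb G) (big : G.Dart → Prop) (P : V → ℂ) (d : G.Dart) : ℝ := (toP E).ang P d - if big d then Real.pi else 0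
lemma SP.dl_mem (d : G.Dart) : 0 < dl E big P d ∧ dl E big P d ≤ Real.pi ∧ (big d ∨ dl E big P d < Real.pi) := by
  have h1 := ccw_pos ((toP E).dir P d) ((toP E).dir P ((toP E).σ d))
  have h2 := ccw_le ((toP E).dir P d) ((toP E).dir P ((toP E).σ d))
  have h3 := h.hb d; have h4 := h.hs d
  unfold dl; unfold PMap.ang at *
  split_ifs with hb
  · have := h3 hb; exact ⟨by linarith, by linarith, .inl hb⟩
  · have := h4 hb; exact ⟨by linarith, by linarith, .inr (by linarith)⟩
lemma SP.step (d : G.Dart) : ∃ r : ℝ, (toP E).dir P ((toP E).ψ d) = r * (Complex.exp (dl E big P d * Complex.I) * (toP E).dir P d) ∧ (big d → 0 < r) := by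
  obtain ⟨r, hr, e⟩ := exists_pl (h.ne d) (h.ne ((toP E).σ d))
  rw [dir_ψ, e, pl, dl]
  split_ifs with hb
  · refine ⟨r, ?_, fun _ => hr⟩
    push_cast; rw [sub_mul, Complex.exp_sub, Complex.exp_pi_mul_I, PMap.ang]; ring
  · exact ⟨-r, by push_cast; rw [PMap.ang, sub_zero]; ring, fun k => absurd k hb⟩
open Classical in
lemma SP.ccw_ψ (d : G.Dart) : ccw ((toP E).dir P d) ((toP E).dir P ((toP E).ψ d)) = dl E big P d + if big d then 0 else Real.pi := by
  obtain ⟨r, hr, e⟩ := exists_pl (h.ne d) (h.ne ((toP E).σ d))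
  have h0 := h.dl_mem d
  have h1 := h.hb d; have h2 := h.hs d
  rw [dir_ψ, e, pl_neg]
  nth_rw 1 [← pl_zero ((toP E).dir P d)]
  change ccw _ (pl _ r ((toP E).ang P d + Real.pi)) = _
  unfold dl at *
  split_ifs at * with hb
  · rw [← pl_sub _ r, ccw_pl (h.ne d) one_pos hr] <;> linarith
  · rw [ccw_pl (h.ne d) one_pos hr] <;> linarith
open Classical in
lemma SP.small (F : E.Face) (hF : F ≠ E.outer) : (univ.filter (fun d => E.angleFace d = F ∧ ¬ big d)).card = 3 := by
  rw [← h.lab.bounded_small F hF, Nat.card_eq_fintype_card]; exact (Fintype.card_subtype _).symm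
open Classical in
lemma SP.tot [Fintype E.Face] : (univ.filter big).card + 3 * Fintype.card E.Face = 3 + 2 * #G.edgeFinset ∧
    Fintype.card V + Fintype.card E.Face = #G.edgeFinset + 2 ∧
    Fintype.card {v // ¬ PointedVx big v} + (univ.filter big).card = Fintype.card V := by
  refine ⟨?_, ?_, ?_⟩
  · have e1 : (univ.filter fun d => ¬ big d).card = 3 * (Fintype.card E.Face - 1) := by
      rw [card_eq_sum_card_fiberwise (f := E.angleFace) (t := univ.erase E.outer), sum_congr rfl (g := fun _ => 3)]
      · simp [mul_comm]
      · intro F hF; rw [← h.small F (mem_erase.1 hF).1, filter_filter]; simp only [and_comm]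
      · intro d hd; simp at hd ⊢; exact fun k => hd (h.lab.outer_big d k)
    have e2 := card_filter_add_card_filter_not (s := (univ : Finset G.Dart)) big
    have : 0 < Fintype.card E.Face := Fintype.card_pos_iff.2 ⟨E.outer⟩
    rw [card_univ, G.dart_card_eq_twice_card_edges] at e2
    zify [this] at *
    linarith
  · have := E.euler
    rw [Nat.card_eq_fintype_card, Nat.card_eq_fintype_card, Nat.card_eq_fintype_card, ← G.edgeFinset_card] at this
    exact this
  · have e : (univ.filter big).card = Fintype.card {v // PointedVx big v} := by
      rw [Fintype.card_subtype, ← card_image_of_injOn (s := univ.filter big) (f := fun d : G.Dart => d.fst)]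
      · congr 1; ext v; rw [mem_filter, mem_image]; simp [PointedVx]
      · intro d hd d' hd'; simp at hd hd'; exact h.lab.one_big d d' hd hd'
    rw [e, add_comm]
    have := Fintype.card_subtype_compl (PointedVx big)
    have := Fintype.card_subtype_le (PointedVx big)
    omega
open Classical in
lemma SP.face (F : E.Face) : (if F = E.outer then 2 * Real.pi else Real.pi) ≤ ∑ d ∈ univ.filter (fun d => E.angleFace d = F), dl E big P d := by
  obtain ⟨d0, hd⟩ := aF_surj E F
  obtain ⟨k, hk, e⟩ := sum_ccw (univ.filter (fun d => E.angleFace d = F)) (toP E).ψ (fun d => by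
    simp only [mem_filter, mem_univ, true_and]; rw [show E.angleFace ((toP E).ψ d) = _ from aF_rot E d]) ((toP E).dir P) (fun d _ => h.ne d) ⟨d0, by simpa using hd⟩
  simp only [h.ccw_ψ, sum_add_distrib] at e
  have hp := Real.pi_pos
  split_ifs with hF
  · rw [sum_eq_zero (f := fun d => if big d then (0:ℝ) else Real.pi)] at e
    · have : (1:ℝ) ≤ k := by exact_mod_cast hk
      nlinarith
    · intro d hd; rw [if_pos (h.lab.outer_big d (by simpa [hF] using hd))]
  · rw [sum_ite, sum_const_zero, zero_add, sum_const, filter_filter, h.small F hF, nsmul_eq_mul] at e; push_cast at e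
    have h0 : 0 < ∑ d ∈ univ.filter (fun d => E.angleFace d = F), dl E big P d := sum_pos (fun d _ => (h.dl_mem d).1) ⟨d0, by simpa using hd⟩
    have : (3:ℝ) < 2 * k := by nlinarith
    have : 3 < 2 * k := by exact_mod_cast this
    have : (2:ℝ) ≤ k := by exact_mod_cast (by omega : 2 ≤ k)
    nlinarith
open Classical in
lemma SP.turn (F : E.Face) (hF : F ≠ E.outer) : ∑ d ∈ univ.filter (fun d => E.angleFace d = F), dl E big P d = Real.pi := by
  haveI : Fintype E.Face := Fintype.ofFinite _
  have t := h.tot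
  have e1 : ∑ F : E.Face, (if F = E.outer then 2 * Real.pi else Real.pi) = Real.pi * (Fintype.card E.Face + 1) := by
    rw [sum_congr rfl (g := fun F : E.Face => Real.pi + if F = E.outer then Real.pi else 0) (fun F _ => by split_ifs <;> ring), sum_add_distrib]
    simp; ring
  have e2 : ∑ F : E.Face, ∑ d ∈ univ.filter (fun d => E.angleFace d = F), dl E big P d = Real.pi * (Fintype.card E.Face + 1) := by
    rw [sum_fiberwise]
    simp only [dl, sum_sub_distrib]
    rw [← sum_fiberwise (g := fun d : G.Dart => d.fst), sum_congr rfl (fun v _ => h.sum v), ← sum_filter]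
    simp only [sum_const, card_univ, nsmul_eq_mul]
    have t1 : ((univ.filter big).card : ℝ) + 3 * Fintype.card E.Face = 3 + 2 * #G.edgeFinset := by exact_mod_cast t.1
    have t2 : (Fintype.card V : ℝ) + Fintype.card E.Face = #G.edgeFinset + 2 := by exact_mod_cast t.2.1
    rw [show ((univ.filter big).card : ℝ) = 3 + 2 * #G.edgeFinset - 3 * Fintype.card E.Face by linarith, show (Fintype.card V : ℝ) = #G.edgeFinset + 2 - Fintype.card E.Face by linarith]; ring
  have := (sum_eq_sum_iff_of_le (fun F _ => h.face F)).1 (e1.trans e2.symm) F (mem_univ _)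
  rw [← this, if_neg hF]
end
end PTri

namespace PTri
open Finset
set_option linter.all false
section
variable {V : Type} [Fintype V] [DecidableEq V] {G : SimpleGraph V} [DecidableRel G.Adj] {E : PlaneEmb G}
  {big : G.Dart → Prop} {P : V → ℂ} (h : SP E big P)
def ip (c z : ℂ) : ℝ := ((starRingEnd ℂ) c * z).re
include h
open ComplexConjugate in
lemma SP.walk {d0 : G.Dart} (hF : E.angleFace d0 ≠ E.outer) (hb : big d0) {c : ℂ}
    (hm : ∀ d, E.angleFace d = E.angleFace d0 → ip c (P d.fst - P d0.fst) ≤ 0)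
    (h0 : ip c ((toP E).dir P d0) < 0) (h1 : ip c ((toP E).dir P ((toP E).σ d0)) < 0) : False := by
  classical
  obtain ⟨s, hs⟩ : ∃ s : ℕ → G.Dart, s = fun i => (toP E).ψ^[i] d0 := ⟨_, rfl⟩
  have s0 : s 0 = d0 := by rw [hs]; rfl
  have sS : ∀ i, s (i+1) = (toP E).ψ (s i) := fun i => by rw [hs]; exact Function.iterate_succ_apply' _ _ _
  have sF : ∀ i, E.angleFace (s i) = E.angleFace d0 := fun i => by
    induction i with
    | zero => rw [s0]
    | succ i ih => rw [sS, ← ih]; exact aF_rot E (s i)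
  obtain ⟨m, hmm⟩ : ∃ m, m = Function.minimalPeriod (toP E).ψ d0 := ⟨_, rfl⟩
  have sm : s m = d0 := by rw [hs, hmm]; exact Function.iterate_minimalPeriod
  have mpos : 0 < m := by
    rw [hmm]; refine Function.minimalPeriod_pos_of_mem_periodicPts ?_
    exact Function.Injective.mem_periodicPts (toP E).ψ.injective d0
  obtain ⟨φ, hφ⟩ : ∃ φ : ℕ → ℝ, φ = fun i => ∑ j ∈ range i, dl E big P (s j) := ⟨_, rfl⟩
  have φS : ∀ i, φ (i+1) = φ i + dl E big P (s i) := fun i => by rw [hφ]; exact sum_range_succ _ _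
  have φ0 : φ 0 = 0 := by rw [hφ]; rfl
  have φm : Monotone φ := monotone_nat_of_le_succ fun i => by rw [φS]; linarith [(h.dl_mem (s i)).1]
  have φπ : φ m ≤ Real.pi := by
    rw [hφ, ← h.turn _ hF]
    beta_reduce
    rw [← sum_image (g := s) (f := dl E big P)]
    · refine sum_le_sum_of_subset_of_nonneg ?_ fun d _ _ => (h.dl_mem d).1.le
      intro d hd; obtain ⟨i, -, rfl⟩ := mem_image.1 hd; simpa using sF i
    · intro i hi j hj e
      rw [hs] at e
      exact Function.iterate_injOn_Iio_minimalPeriod (by simpa [← hmm] using hi) (by simpa [← hmm] using hj) e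
  have hρ : ∀ i, ∃ r : ℝ, (toP E).dir P (s i) = r * (Complex.exp (φ i * Complex.I) * (toP E).dir P d0) := fun i => by
    induction i with
    | zero => exact ⟨1, by simp [s0, φ0]⟩
    | succ i ih =>
      obtain ⟨r, hr⟩ := ih
      obtain ⟨r', hr', -⟩ := h.step (s i)
      refine ⟨r' * r, ?_⟩
      rw [sS, hr', hr, φS]; push_cast; rw [add_mul, Complex.exp_add]; ring
  choose ρ hρ using hρ
  obtain ⟨w, hw⟩ : ∃ w, w = conj c * (toP E).dir P d0 := ⟨_, rfl⟩
  obtain ⟨S, hS⟩ : ∃ S : ℕ → ℂ, S = fun i => conj c * (P (s i).fst - P d0.fst) := ⟨_, rfl⟩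
  obtain ⟨e, he⟩ : ∃ e : ℕ → ℂ, e = fun i => Complex.exp (φ i * Complex.I) * w := ⟨_, rfl⟩
  have SS : ∀ i, S (i+1) = S i - ρ (i+1) * e (i+1) := fun i => by
    have := hρ (i+1)
    rw [he, hS, hw]; beta_reduce
    rw [show (ρ (i+1) : ℂ) * (Complex.exp (φ (i+1) * Complex.I) * (conj c * (toP E).dir P d0)) = conj c * ((toP E).dir P (s (i+1))) by rw [this]; ring]
    rw [sS, dir_ψ, PMap.dir, (toP E).tail_σ]
    change _ = conj c * (P (s i).fst - _) - conj c * -(P ((toP E).ψ (s i)).fst - P (s i).fst)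
    ring
  have S0 : S 0 = 0 := by rw [hS]; simp [s0]
  have Sm : S m = 0 := by rw [hS]; simp [sm]
  have Y : ∀ i, (S i).re ≤ 0 := fun i => by rw [hS]; exact hm _ (sF i)
  have wre : w.re < 0 := by rw [hw]; exact h0
  have φ1 : φ 1 = dl E big P d0 := by rw [φS, φ0, s0]; ring
  have e1 : 0 < (e 1).re ∧ (S 1).re < 0 := by
    obtain ⟨r, hr, hr0⟩ := h.step d0
    have hr0 := hr0 hb
    have : (r : ℂ) * e 1 = conj c * (toP E).dir P ((toP E).ψ d0) := by rw [hr, ← φ1, he, hw]; ring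
    have k := congrArg Complex.re this
    rw [dir_ψ, mul_neg, Complex.neg_re, Complex.re_ofReal_mul] at k
    refine ⟨by unfold ip at h1; nlinarith, ?_⟩
    have : (ρ 1 : ℂ) * e 1 = conj c * (toP E).dir P ((toP E).ψ d0) := by
      have := hρ 1; rw [sS, s0] at this; rw [this, he, hw]; ring
    have k := congrArg Complex.re this
    rw [dir_ψ, mul_neg, Complex.neg_re] at k
    have := congrArg Complex.re (SS 0)
    rw [S0, zero_sub, Complex.neg_re, k] at this
    rw [this]; unfold ip at h1; linarith
  have ere : ∀ i, (e i).re = w.re * Real.cos (φ i) - w.im * Real.sin (φ i) := fun i => by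
    rw [he, Complex.mul_re, Complex.exp_ofReal_mul_I_re, Complex.exp_ofReal_mul_I_im]; ring
  have eim : ∀ i, (e i).im = w.re * Real.sin (φ i) + w.im * Real.cos (φ i) := fun i => by
    rw [he, Complex.mul_im, Complex.exp_ofReal_mul_I_re, Complex.exp_ofReal_mul_I_im]; ring
  have pp : ∀ i, 1 ≤ i → i ≤ m → 0 < (e i).re := fun i i1 im => by
    have a1 := φm i1
    have a2 := (φm im).trans φπ
    have a3 := (h.dl_mem d0).1
    rw [← φ1] at a3
    have k : (e i).re * Real.sin (φ 1) = (e 1).re * Real.sin (φ i) - w.re * Real.sin (φ i - φ 1) := by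
      rw [ere, ere, Real.sin_sub]; ring
    have k1 : 0 ≤ Real.sin (φ i) := Real.sin_nonneg_of_nonneg_of_le_pi (by linarith) a2
    have k2 : 0 ≤ Real.sin (φ i - φ 1) := Real.sin_nonneg_of_nonneg_of_le_pi (by linarith) (by linarith)
    have e10 := e1.1
    rcases a2.lt_or_eq with a | a
    · have k3 : 0 < Real.sin (φ i) := Real.sin_pos_of_pos_of_lt_pi (by linarith) a
      have k4 : 0 < Real.sin (φ 1) := Real.sin_pos_of_pos_of_lt_pi (by linarith) (by linarith)
      by_contra hn; nlinarith [mul_pos e10 k3]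
    · rw [ere, a, Real.cos_pi, Real.sin_pi]; linarith
  have Q : ∀ i, 1 ≤ i → i ≤ m → ((conj (S i) * e i).im ≤ 0 ∧ ((conj (S i) * e i).im < 0 ∨ (S i).re < 0)) := fun i i1 => by
    induction i, i1 using Nat.le_induction with
    | base => 
      intro _
      refine ⟨le_of_eq ?_, .inr e1.2⟩
      rw [SS 0, S0]; simp; ring
    | succ i i1 ih =>
      intro im
      obtain ⟨q1, q2⟩ := ih (by omega)
      have p1 := pp i i1 (by omega)
      have p2 := pp (i+1) (by omega) im
      have a0 := (h.dl_mem (s i)).1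
      have a3 := (h.dl_mem d0).1
      rw [← φ1] at a3
      have k5 := φm i1
      have k6 := (φm im).trans φπ
      have sp : 0 < Real.sin (φ (i+1) - φ i) := Real.sin_pos_of_pos_of_lt_pi (by rw [φS]; linarith) (by linarith)
      have wp : 0 < w.re ^ 2 + w.im ^ 2 := by nlinarith [sq_nonneg w.im]
      have D1 : (conj (S (i+1)) * e (i+1)).im = (S i).re * (e (i+1)).im - (S i).im * (e (i+1)).re := by
        rw [SS]; simp; ring
      have D2 : (conj (S i) * e i).im = (S i).re * (e i).im - (S i).im * (e i).re := by simp; ring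
      have key : (conj (S (i+1)) * e (i+1)).im * (e i).re = (conj (S i) * e i).im * (e (i+1)).re + (S i).re * ((w.re ^ 2 + w.im ^ 2) * Real.sin (φ (i+1) - φ i)) := by
        rw [D1, D2, Real.sin_sub, ere, ere, eim, eim]; ring
      have K := mul_pos wp sp
      have Yi := Y i
      have : (conj (S (i+1)) * e (i+1)).im < 0 := by
        by_contra hn
        push Not at hn
        have b0 := mul_nonneg hn p1.le
        rcases q2 with q2 | q2
        · nlinarith [mul_pos_of_neg_of_neg q2 (neg_neg_of_pos p2), mul_nonneg (neg_nonneg.2 Yi) K.le]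
        · nlinarith [mul_pos (neg_pos.2 q2) K, mul_nonneg (neg_nonneg.2 q1) p2.le]
      exact ⟨this.le, .inl this⟩
  have := Q m mpos le_rfl
  rw [Sm] at this; simp at this
end
end PTri

namespace PTri
open Finset
set_option linter.all false
lemma ip_eq (c z : ℂ) : ip c z = c.re * z.re + c.im * z.im := by simp [ip]
open Filter Topology in
lemma ev_ne {A B : ℝ} (h : A ≠ 0 ∨ B ≠ 0) : ∀ᶠ t : ℝ in 𝓝[>] 0, A + t * B ≠ 0 := by
  by_cases hA : A = 0
  · filter_upwards [self_mem_nhdsWithin] with t ht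
    have : B ≠ 0 := by tauto
    have h2 : t ≠ 0 := ne_of_gt ht
    rw [hA, zero_add]; exact mul_ne_zero h2 this
  · have : Tendsto (fun t : ℝ => A + t * B) (𝓝[>] 0) (𝓝 (A + 0 * B)) := 
      Tendsto.mono_left (Continuous.tendsto (by fun_prop) 0) nhdsWithin_le_nhds
    exact this.eventually_ne (by simpa using hA)
section
variable {V : Type} [Fintype V] [DecidableEq V] {G : SimpleGraph V} [DecidableRel G.Adj] {E : PlaneEmb G}
  {big : G.Dart → Prop} {P : V → ℂ} (h : SP E big P)
def vl (P : V → ℂ) (c : E.Face → ℂ) (b : E.Face → ℝ) (d : G.Dart) : ℝ := ip (c (E.angleFace d)) (P d.fst) + b (E.angleFace d)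
structure Lf (P : V → ℂ) (c : E.Face → ℂ) (b : E.Face → ℝ) : Prop where
  c0 : c E.outer = 0
  b0 : b E.outer = 0
  ct : ∀ d, ip (c (E.angleFace d)) (P d.fst) + b (E.angleFace d) = ip (c (E.angleFace d.symm)) (P d.fst) + b (E.angleFace d.symm)
variable {c : E.Face → ℂ} {b : E.Face → ℝ} (l : Lf P c b)
include l
lemma Lf.H : ∃ H : V → ℝ, (∀ d, vl P c b d = H d.fst) ∧ (∀ d, ip (c (E.angleFace d)) (P d.snd - P d.fst) = H d.snd - H d.fst) ∧
    ∀ d, ip (c (E.angleFace d)) (P (E.rot d).snd - P d.fst) = H (E.rot d).snd - H d.fst := by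
  choose δ hδ using has_dart E
  have key : ∀ d, vl P c b d = vl P c b (δ d.fst) := fun d => rot_inv E _ (fun d => by
    have := l.ct (E.rot d); rw [aF_rot, E.rot_fst] at this; rw [vl, E.rot_fst, this, vl]) (hδ _).symm
  refine ⟨fun v => vl P c b (δ v), key, fun d => ?_, fun d => ?_⟩
  · have k1 := key d; have k2 := key d.symm; have := l.ct d.symm
    rw [SimpleGraph.Dart.symm_symm] at this
    change ip _ (P d.snd) + _ = ip _ (P d.snd) + _ at this
    change ip _ (P d.snd) + _ = vl P c b (δ d.snd) at k2
    change ip _ (P d.fst) + _ = vl P c b (δ d.fst) at k1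
    beta_reduce
    rw [← k1, ← k2, this]
    simp only [ip_eq, Complex.sub_re, Complex.sub_im]; ring
  · have k1 := key d; have k2 := key (E.rot d).symm
    simp only [vl] at k1 k2
    rw [aF_rot] at k2
    change ip _ (P (E.rot d).snd) + _ = vl P c b (δ (E.rot d).snd) at k2
    change _ = vl P c b (δ d.fst) at k1
    beta_reduce
    rw [← k1, ← k2]; simp only [ip_eq, Complex.sub_re, Complex.sub_im]; ring
include h
open Filter Topology in
lemma SP.max (hz : ∀ d : G.Dart, ¬ PointedVx big d.fst → vl P c b d = 0) (d : G.Dart) : vl P c b d ≤ 0 := by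
  obtain ⟨H, H1, H2, H3⟩ := l.H
  by_contra hn
  push Not at hn
  rw [H1] at hn
  obtain ⟨s, hs⟩ : ∃ s : ℝ, ∀ u v, u ≠ v → (P u - P v).re + s * (P u - P v).im ≠ 0 := by
    refine Eventually.exists (f := 𝓝[>] (0:ℝ)) ?_
    simp only [eventually_all]
    intro u v huv
    refine ev_ne ?_
    by_contra! k
    exact huv (h.inj (sub_eq_zero.1 (Complex.ext k.1 k.2)))
  obtain ⟨g, hg⟩ : ∃ g : V → ℝ, g = fun u => (P u).re + s * (P u).im := ⟨_, rfl⟩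
  obtain ⟨t, t1, t2⟩ : ∃ t : ℝ, (∀ u v, u ≠ v → (H u - H v) + t * (g u - g v) ≠ 0) ∧ ∀ u, t * (g u - g d.fst) < H d.fst := by
    refine Eventually.exists (f := 𝓝[>] (0:ℝ)) (.and ?_ ?_)
    · simp only [eventually_all]
      exact fun u v huv => ev_ne (.inr fun k => hs u v huv (by rw [hg] at k; simp; linarith))
    · simp only [eventually_all]
      intro u
      have : Tendsto (fun t : ℝ => t * (g u - g d.fst)) (𝓝[>] 0) (𝓝 (0 * (g u - g d.fst))) := 
        Tendsto.mono_left (Continuous.tendsto (by fun_prop) 0) nhdsWithin_le_nhds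
      exact this.eventually_lt_const (by simpa using hn)
  haveI : Nonempty V := ⟨d.fst⟩
  obtain ⟨v, hv⟩ := Finite.exists_max fun u => H u + t * g u
  have Hv : H v ≠ 0 := fun k => by have := hv d.fst; have := t2 v; nlinarith
  have lt : ∀ u, u ≠ v → H u - H v + t * (g u - g v) < 0 := fun u hu => lt_of_le_of_ne (by have := hv u; linarith) (t1 u v hu)
  obtain ⟨d1, rfl⟩ := has_dart E v
  have pt : PointedVx big d1.fst := by
    by_contra k; exact Hv (by rw [← H1]; exact hz _ k)
  obtain ⟨d0, hb, e⟩ := pt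
  rw [← e] at Hv lt hv
  have gi : ∀ u w, ip ((t : ℂ) * ⟨1, s⟩) (P u - P w) = t * (g u - g w) := fun u w => by rw [ip_eq, hg]; simp; ring
  have ia : ∀ x y z, ip (x + y) z = ip x z + ip y z := fun x y z => by simp only [ip_eq]; simp; ring
  refine h.walk (d0 := d0) (fun k => Hv ?_) hb (c := c (E.angleFace d0) + (t : ℂ) * ⟨1, s⟩) (fun d' hd' => ?_) ?_ ?_
  · rw [← H1, vl, k, l.c0, l.b0]; simp [ip]
  · have h1 := H1 d'; have h2 := H1 d0
    rw [vl, hd'] at h1; rw [vl] at h2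
    have := hv d'.fst
    rw [ia, gi]
    rw [show ip (c (E.angleFace d0)) (P d'.fst - P d0.fst) = H d'.fst - H d0.fst by rw [← h1, ← h2]; simp only [ip_eq]; simp; ring]
    linarith
  · rw [ia, PMap.dir]
    change ip _ (P d0.snd - P d0.fst) + ip _ (P d0.snd - P d0.fst) < 0
    rw [gi, H2]; exact lt _ d0.snd_ne_fst
  · rw [ia, PMap.dir]
    have e2 : (toP E).tail ((toP E).σ d0) = d0.fst := E.rot_fst d0
    rw [e2]
    change ip _ (P (E.rot d0).snd - P d0.fst) + ip _ (P (E.rot d0).snd - P d0.fst) < 0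
    rw [gi, H3]; exact lt _ (by rw [← E.rot_fst d0]; exact (E.rot d0).snd_ne_fst)
lemma SP.zero (hz : ∀ d : G.Dart, ¬ PointedVx big d.fst → vl P c b d = 0) : c = 0 ∧ b = 0 := by
  classical
  have n1 : ∀ x z, ip (-x) z = - ip x z := fun x z => by simp [ip]
  have l' : Lf P (-c) (-b) := ⟨by simp [l.c0], by simp [l.b0], fun d => by
    have := l.ct d; simp only [Pi.neg_apply, n1]; linarith⟩
  have nv : ∀ d, vl P (-c) (-b) d = - vl P c b d := fun d => by simp only [vl, Pi.neg_apply, n1]; ring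
  have hz0 : ∀ d, vl P c b d = 0 := fun d => le_antisymm (h.max l hz d) (by
    have := h.max l' (fun d k => by rw [nv, hz d k, neg_zero]) d
    rw [nv] at this; linarith)
  have c0 : ∀ F, c F = 0 := fun F => by
    by_cases hF : F = E.outer
    · rw [hF, l.c0]
    obtain ⟨H, H1, H2, H3⟩ := l.H
    have hH : ∀ v, H v = 0 := fun v => by obtain ⟨d, rfl⟩ := has_dart E v; rw [← H1, hz0]
    have := h.small F hF
    obtain ⟨d, hd⟩ := card_pos.1 (by rw [this]; norm_num)
    simp only [mem_filter, mem_univ, true_and] at hd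
    have k1 := H2 d; have k2 := H3 d
    obtain ⟨r, hr, e⟩ := cr_eq (h.ne d) (h.ne ((toP E).σ d))
    have sp := Real.sin_pos_of_pos_of_lt_pi (ccw_pos _ _) (h.hs d hd.2)
    have cp : 0 < cr ((toP E).dir P d) ((toP E).dir P ((toP E).σ d)) := by rw [e]; exact mul_pos hr sp
    rw [hH, hH, sub_self, hd.1, ip_eq] at k1
    rw [hH, hH, sub_self, hd.1, ← E.rot_fst d, ip_eq] at k2
    change 0 < cr (P d.snd - P d.fst) (P (E.rot d).snd - P (E.rot d).fst) at cp
    rw [cr] at cp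
    generalize P d.snd - P d.fst = x at *
    generalize P (E.rot d).snd - P (E.rot d).fst = y at *
    refine Complex.ext ?_ ?_
    · refine mul_right_cancel₀ cp.ne' ?_
      rw [Complex.zero_re, zero_mul]; linear_combination y.im * k1 - x.im * k2
    · refine mul_right_cancel₀ cp.ne' ?_
      rw [Complex.zero_im, zero_mul]; linear_combination x.re * k2 - y.re * k1
  refine ⟨funext c0, funext fun F => ?_⟩
  obtain ⟨d, rfl⟩ := aF_surj E F
  have := hz0 d
  rw [vl, c0] at this; simpa [ip] using this
end
end PTri

namespace PTri
open Finset
set_option linter.all false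
section
variable {V : Type} [Fintype V] [DecidableEq V] {G : SimpleGraph V} [DecidableRel G.Adj]
def om (ω : G.edgeSet → ℝ) (d : G.Dart) : ℝ := ω ⟨d.edge, d.edge_mem⟩
lemma om_symm (ω : G.edgeSet → ℝ) (d : G.Dart) : om ω d.symm = om ω d := by
  unfold om; congr 1; exact Subtype.ext d.edge_symm
lemma edge_sum (F : G.Dart → ℝ) (K : G.edgeSet → ℝ) (hF : ∀ d : G.Dart, F d + F d.symm = K ⟨d.edge, d.edge_mem⟩) :
    ∑ e, K e = ∑ d, F d := by
  rw [← sum_fiberwise univ (fun d : G.Dart => (⟨d.edge, d.edge_mem⟩ : G.edgeSet)) F]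
  refine sum_congr rfl fun e _ => ?_
  obtain ⟨e, he⟩ := e
  induction e with
  | _ u v =>
    let d : G.Dart := ⟨(u, v), he⟩
    have : univ.filter (fun d' : G.Dart => (⟨d'.edge, d'.edge_mem⟩ : G.edgeSet) = ⟨s(u, v), he⟩) = {d, d.symm} := by
      rw [← d.edge_fiber]
      ext x; simp only [mem_filter, mem_univ, true_and, Subtype.ext_iff]; rfl
    rw [this, sum_pair d.symm_ne.symm]
    exact (hF d).symm
lemma stress (p : V → ℝ × ℝ) (ω : G.edgeSet → ℝ) (hω : Matrix.mulVec (rw' p (fun e : G.edgeSet => e.1)).transpose ω = 0) (v : V) :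
    ∑ d ∈ univ.filter (fun d : G.Dart => d.fst = v), om ω d * ((p d.snd).1 - (p d.fst).1) = 0 ∧
    ∑ d ∈ univ.filter (fun d : G.Dart => d.fst = v), om ω d * ((p d.snd).2 - (p d.fst).2) = 0 := by
  refine ⟨?_, ?_⟩
  · have := congrFun hω (.inl v)
    rw [Matrix.mulVec, dotProduct, edge_sum (fun d : G.Dart => if d.fst = v then -(om ω d * ((p d.snd).1 - (p d.fst).1)) else 0)] at this
    · rw [← sum_filter, sum_neg_distrib] at this
      exact neg_eq_zero.1 this
    · intro d
      rw [om_symm]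
      change (if d.fst = v then _ else _) + (if d.snd = v then -(om ω d * ((p d.fst).1 - (p d.snd).1)) else _) = (((if v = d.fst then 1 else 0) - (if v = d.snd then 1 else 0)) * ((p d.fst).1 - (p d.snd).1)) * om ω d
      simp only [eq_comm (a := v)]
      split_ifs <;> ring
  · have := congrFun hω (.inr v)
    rw [Matrix.mulVec, dotProduct, edge_sum (fun d : G.Dart => if d.fst = v then -(om ω d * ((p d.snd).2 - (p d.fst).2)) else 0)] at this
    · rw [← sum_filter, sum_neg_distrib] at this
      exact neg_eq_zero.1 this
    · intro d
      rw [om_symm]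
      change (if d.fst = v then _ else _) + (if d.snd = v then -(om ω d * ((p d.fst).2 - (p d.snd).2)) else _) = (((if v = d.fst then 1 else 0) - (if v = d.snd then 1 else 0)) * ((p d.fst).2 - (p d.snd).2)) * om ω d
      simp only [eq_comm (a := v)]
      split_ifs <;> ring
def Ls (E : PlaneEmb G) (P : V → ℂ) : Submodule ℝ ((G.edgeSet → ℝ) × (E.Face → ℂ) × (E.Face → ℝ)) where
  carrier := {x | Lf P x.2.1 x.2.2 ∧ ∀ d, x.2.1 (E.angleFace d) - x.2.1 (E.angleFace d.symm) = om x.1 d * (Complex.I * (P d.snd - P d.fst))}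
  add_mem' := by
    rintro x y ⟨⟨a1, a2, a3⟩, a4⟩ ⟨⟨b1, b2, b3⟩, b4⟩
    refine ⟨⟨by simp [a1, b1], by simp [a2, b2], fun d => ?_⟩, fun d => ?_⟩
    · have h1 := a3 d; have h2 := b3 d
      simp only [ip_eq, Prod.fst_add, Prod.snd_add, Pi.add_apply, Complex.add_re, Complex.add_im] at *; linarith
    · have h1 := a4 d; have h2 := b4 d
      simp only [om, Prod.fst_add, Prod.snd_add, Pi.add_apply, Complex.ofReal_add] at *
      linear_combination h1 + h2
  zero_mem' := ⟨⟨rfl, rfl, fun d => by simp [ip]⟩, fun d => by simp [om]⟩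
  smul_mem' := by
    rintro r x ⟨⟨a1, a2, a3⟩, a4⟩
    refine ⟨⟨by simp [a1], by simp [a2], fun d => ?_⟩, fun d => ?_⟩
    · have h1 := a3 d
      simp only [ip_eq, Prod.smul_fst, Prod.smul_snd, Pi.smul_apply, Complex.smul_re, Complex.smul_im, smul_eq_mul] at *
      linear_combination r * h1
    · have h1 := a4 d
      simp only [om, Prod.smul_fst, Prod.smul_snd, Pi.smul_apply, Complex.real_smul, smul_eq_mul, Complex.ofReal_mul] at *
      linear_combination r * h1
lemma lift (E : PlaneEmb G) (p : V → ℝ × ℝ) (P : V → ℂ) (hP : ∀ v, P v = ⟨(p v).1, (p v).2⟩) (ω : G.edgeSet → ℝ)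
    (hω : Matrix.mulVec (rw' p (fun e : G.edgeSet => e.1)).transpose ω = 0) : ∃ x ∈ Ls E P, x.1 = ω := by
  have hs := stress p ω hω
  have r1 : ∀ v, (p v).1 = (P v).re := fun v => by rw [hP]
  have r2 : ∀ v, (p v).2 = (P v).im := fun v => by rw [hP]
  simp only [r1, r2] at hs
  obtain ⟨c1, h1⟩ := exactK E (fun d => om ω d * ((P d.snd).re - (P d.fst).re)) (fun d => by
    rw [om_symm]; change _ * ((P d.fst).re - (P d.snd).re) = _; ring) (fun v => by convert (hs v).1)
  obtain ⟨c2, h2⟩ := exactK E (fun d => om ω d * ((P d.snd).im - (P d.fst).im)) (fun d => by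
    rw [om_symm]; change _ * ((P d.fst).im - (P d.snd).im) = _; ring) (fun v => by convert (hs v).2)
  obtain ⟨b, h3⟩ := exactK E (fun d => (om ω d * ((P d.snd).im - (P d.fst).im)) * (P d.fst).re - (om ω d * ((P d.snd).re - (P d.fst).re)) * (P d.fst).im) (fun d => by
    rw [om_symm]
    change (_ * ((P d.fst).im - (P d.snd).im)) * (P d.snd).re - (_ * ((P d.fst).re - (P d.snd).re)) * (P d.snd).im = _; ring) (fun v => by
      have k1 := (hs v).1; have k2 := (hs v).2
      trans (∑ d ∈ univ.filter (fun d : G.Dart => d.fst = v), om ω d * ((P d.snd).im - (P d.fst).im)) * (P v).re - (∑ d ∈ univ.filter (fun d : G.Dart => d.fst = v), om ω d * ((P d.snd).re - (P d.fst).re)) * (P v).im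
      · rw [sum_mul, sum_mul, ← sum_sub_distrib]
        refine sum_congr (by congr) fun d hd => ?_
        rw [(mem_filter.1 hd).2]
      · rw [k1, k2]; ring)
  refine ⟨(ω, fun F => ⟨-(c2 F - c2 E.outer), c1 F - c1 E.outer⟩, fun F => b F - b E.outer), ⟨⟨?_, ?_, fun d => ?_⟩, fun d => ?_⟩, rfl⟩
  · simp [Complex.ext_iff]
  · simp
  · have h1 := h1 d; have h2 := h2 d; have h3 := h3 d
    simp only [ip_eq]
    rw [h1, h2] at h3
    linear_combination -h3
  · have h1 := h1 d; have h2 := h2 d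
    apply Complex.ext
    · simp; linarith
    · simp; linarith
variable {E : PlaneEmb G} {big : G.Dart → Prop} {P : V → ℂ} (h : SP E big P)
include h
open Classical in
lemma SP.fin : Module.finrank ℝ (Ls E P) ≤ Fintype.card {v // ¬ PointedVx big v} := by
  haveI : Fintype E.Face := Fintype.ofFinite _
  choose δ hδ using has_dart E
  let T : Ls E P →ₗ[ℝ] ({v // ¬ PointedVx big v} → ℝ) :=
    { toFun := fun x v => vl P x.1.2.1 x.1.2.2 (δ v.1)
      map_add' := fun x y => by ext v; simp only [vl, ip_eq]; simp; ring
      map_smul' := fun x y => by ext v; simp only [vl, ip_eq]; simp; ring }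
  have hT : Function.Injective T := by
    rw [← LinearMap.ker_eq_bot, LinearMap.ker_eq_bot']
    rintro ⟨⟨ω, c, b⟩, l, e⟩ hx
    obtain ⟨H, H1, -, -⟩ := l.H
    obtain ⟨rfl, rfl⟩ := h.zero l fun d hd => by
      have := congrFun hx ⟨d.fst, hd⟩
      change vl P c b (δ d.fst) = 0 at this
      rw [H1, hδ] at this; rw [H1, this]
    ext i
    · obtain ⟨u, hu⟩ := i
      induction u with
      | _ u v =>
        have := e ⟨(u, v), hu⟩
        have k := h.ne ⟨(u, v), hu⟩
        change P v - P u ≠ 0 at k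
        change (0:ℂ) - 0 = ((ω ⟨s(u, v), hu⟩ : ℝ) : ℂ) * (Complex.I * (P v - P u)) at this
        simpa [k] using this.symm
    all_goals rfl
  have := LinearMap.finrank_le_finrank_of_injective hT
  rwa [Module.finrank_fintype_fun_eq_card] at this
end
section
variable {V : Type} [Fintype V] [DecidableEq V] {G : SimpleGraph V} [DecidableRel G.Adj]
theorem back (E : PlaneEmb G) (hh : ∃ p, StretchesToPT G E p) : GenRigid G := by
  classical
  obtain ⟨p, big, lab, ⟨hi, -, sm⟩, -, ang⟩ := hh
  let P : V → ℂ := fun v => ⟨(p v).1, (p v).2⟩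
  have hiP : Function.Injective P := fun u v k => hi (Prod.ext (congrArg Complex.re k) (congrArg Complex.im k))
  have ae := dartAngle_eq E P p (fun _ => rfl) hiP
  have h : SP E big P := ⟨lab, hiP, fun v => by rw [← sm v (has_dart E v)]; exact sum_congr rfl fun d _ => (ae d).symm,
    fun d hd => by rw [← ae]; exact (ang d).1 hd, fun d hd => by rw [← ae]; exact (ang d).2 hd⟩
  haveI : Fintype E.Face := Fintype.ofFinite _
  have tot := h.tot
  have f1 := h.fin
  have f2 : Module.finrank ℝ (LinearMap.ker (rw' p (fun e : G.edgeSet => e.1)).transpose.mulVecLin) ≤ Module.finrank ℝ (Ls E P) := by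
    refine le_trans (Submodule.finrank_mono (t := (Ls E P).map (LinearMap.fst ℝ _ _)) fun ω hω => ?_) (Submodule.finrank_map_le _ _)
    exact lift E p P (fun _ => rfl) ω hω
  have f3 := (rw' p (fun e : G.edgeSet => e.1)).transpose.mulVecLin.finrank_range_add_finrank_ker
  change Matrix.rank _ + _ = _ at f3
  rw [Matrix.rank_transpose, Module.finrank_fintype_fun_eq_card, ← SimpleGraph.edgeFinset_card] at f3
  refine backward E hi ?_
  have e1 : #G.edgeFinset + 3 = 2 * Fintype.card V + Fintype.card {v // ¬ PointedVx big v} := by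
    have := tot.1; have := tot.2.1; have := tot.2.2; clear f1 f2 f3; omega
  omega
end
end PTri

/-- **Theorem 1 (Main theorem).** For a plane graph `G`, the following are equivalent:
(1) `G` is generically rigid in the plane;
(2) `G` can be stretched to become a pseudo-triangulation of its vertex set with the given
topological embedding. -/
theorem plane_graph_genRigid_iff_stretchable_to_pseudoTriangulation
    {V : Type} [Fintype V] [DecidableEq V] (G : SimpleGraph V) [DecidableRel G.Adj]
    (E : PlaneEmb G) :
    GenRigid G ↔ ∃ p : V → ℝ × ℝ, StretchesToPT G E p := by
  exact ⟨PTri.forward E, PTri.back E⟩
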